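/- Fix distinct natural numbers d₁ < d₂ < … < d_k. For each n ≥ 1, let (T_n⁽¹⁾, T_n⁽²⁾) be chosen uniformly at random from the (nonempty, finite) set of ordered pairs of isomorphic rooted labeled trees on n vertices, and let X_n ∈ ℝ^k be the random vector whose i-th coordinate is the number of vertices of T_n⁽¹⁾ with out-degree dᵢ. Then there exist a vector μ ∈ ℝ^k and a symmetric positive semidefinite k×k matrix Σ such that: (i) the vector E[X_n] − nμ stays bounded as n → ∞; (ii) the matrix Cov(X_n) − nΣ stays bounded as n → ∞; and (iii) (X_n − E[X_n])/√n converges in distribution to the centered multivariate Gaussian distribution on ℝ^k with covariance matrix Σ. -/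

import Mathlib

open scoped Classical BigOperators

/-- A rooted labeled tree on `n` vertices: a simple graph on `Fin n` that is a
tree, together with a distinguished root vertex. -/
structure RTree (n : ℕ) where
  graph : SimpleGraph (Fin n)
  isTree : graph.IsTree
  root : Fin n

namespace RTree

/-- Two rooted labeled trees are isomorphic if there is a graph isomorphism
mapping root to root. -/
def Isom {n : ℕ} (T₁ T₂ : RTree n) : Prop :=
  ∃ φ : T₁.graph ≃g T₂.graph, φ T₁.root = T₂.root

/-- The out-degree (number of children) of a vertex: its degree if it is the
root and its degree minus one otherwise. -/
noncomputable def outdeg {n : ℕ} (T : RTree n) (v : Fin n) : ℕ :=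
  if v = T.root then (T.graph.neighborSet v).ncard
  else (T.graph.neighborSet v).ncard - 1

/-- The number of root-fixing graph automorphisms. -/
noncomputable def autCard {n : ℕ} (T : RTree n) : ℕ :=
  Nat.card {φ : T.graph ≃g T.graph // φ T.root = T.root}

instance finite {n : ℕ} : Finite (RTree n) := by
  have h : Function.Injective (fun T : RTree n => (T.graph, T.root)) := by
    rintro ⟨g₁, h₁, r₁⟩ ⟨g₂, h₂, r₂⟩ h
    simp_all
  exact Finite.of_injective _ h

noncomputable instance fintype {n : ℕ} : Fintype (RTree n) := Fintype.ofFinite _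

end RTree

open MeasureTheory ProbabilityTheory

/-- The set of ordered pairs of isomorphic rooted labeled trees on `n`
vertices (the sample space for a uniformly random such pair). -/
def IsoPair (n : ℕ) : Type :=
  {p : RTree n × RTree n // p.1.Isom p.2}

instance (n : ℕ) : Finite (IsoPair n) := by
  unfold IsoPair; infer_instance

noncomputable instance (n : ℕ) : Fintype (IsoPair n) := Fintype.ofFinite _

/-- The number of vertices of out-degree `m` in the first tree of a pair. -/
noncomputable def degCount {n : ℕ} (p : IsoPair n) (m : ℕ) : ℕ :=
  (Finset.univ.filter fun v => p.1.1.outdeg v = m).card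

/-- The expected value, under the uniform distribution on pairs of isomorphic
rooted labeled trees on `n` vertices, of the number of vertices of out-degree
`m` in the first tree. -/
noncomputable def degMean (n m : ℕ) : ℝ :=
  (∑ p : IsoPair n, (degCount p m : ℝ)) / (Nat.card (IsoPair n) : ℝ)

/-- The covariance of the numbers of vertices of out-degrees `m₁` and `m₂`. -/
noncomputable def degCov (n m₁ m₂ : ℕ) : ℝ :=
  (∑ p : IsoPair n,
      ((degCount p m₁ : ℝ) - degMean n m₁) * ((degCount p m₂ : ℝ) - degMean n m₂)) /
    (Nat.card (IsoPair n) : ℝ)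

open scoped Classical BigOperators
open MeasureTheory ProbabilityTheory

namespace IsoCLT

noncomputable def idx (p : ℕ) : ℕ := Nat.count Nat.Prime p + 1

noncomputable def pr (m : ℕ) : ℕ := Nat.nth Nat.Prime (m - 1)

lemma pr_prime (m : ℕ) : (pr m).Prime := Nat.nth_mem_of_infinite Nat.infinite_setOfPred_prime _

lemma idx_pos (p : ℕ) : 1 ≤ idx p := by unfold idx; omega

lemma idx_pr {m : ℕ} (hm : 1 ≤ m) : idx (pr m) = m := by
  unfold idx pr
  rw [Nat.count_nth_of_infinite Nat.infinite_setOfPred_prime]; omega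

lemma pr_idx {p : ℕ} (hp : p.Prime) : pr (idx p) = p := by
  unfold idx pr
  simpa using Nat.nth_count hp

lemma idx_lt {p : ℕ} (hp : p.Prime) : idx p < p := by
  have h2 := hp.two_le
  obtain ⟨k, rfl⟩ : ∃ k, p = k + 2 := ⟨p - 2, by omega⟩
  unfold idx
  have : Nat.count Nat.Prime (k + 2) ≤ k := by
    rw [add_comm k 2, Nat.count_add]
    have h0 : Nat.count Nat.Prime 2 = 0 := by
      rw [Nat.count_succ, Nat.count_succ]; simp [Nat.not_prime_zero, Nat.not_prime_one]
    rw [h0, zero_add]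
    exact Nat.count_le _
  omega

lemma idx_lt_of_mem {p m : ℕ} (hp : p ∈ m.primeFactors) : idx p < m :=
  lt_of_lt_of_le (idx_lt (Nat.prime_of_mem_primeFactors hp)) (Nat.le_of_mem_primeFactors hp)

noncomputable def fold {M : Type*} [CommMonoid M] (ψ : ℕ → M) (m : ℕ) : M :=
  ψ m * ∏ p ∈ m.primeFactors.attach, fold ψ (idx p.1) ^ (m.factorization p.1)
termination_by m
decreasing_by exact idx_lt_of_mem p.2

lemma fold_eq {M : Type*} [CommMonoid M] (ψ : ℕ → M) (m : ℕ) :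
    fold ψ m = ψ m * ∏ p ∈ m.primeFactors, fold ψ (idx p) ^ (m.factorization p) := by
  rw [fold, Finset.prod_attach m.primeFactors (fun p => fold ψ (idx p) ^ (m.factorization p))]

noncomputable def tsize (m : ℕ) : ℕ :=
  1 + ∑ p ∈ m.primeFactors.attach, m.factorization p.1 * tsize (idx p.1)
termination_by m
decreasing_by exact idx_lt_of_mem p.2

lemma tsize_eq (m : ℕ) :
    tsize m = 1 + ∑ p ∈ m.primeFactors, m.factorization p * tsize (idx p) := by
  rw [tsize, Finset.sum_attach m.primeFactors (fun p => m.factorization p * tsize (idx p))]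

lemma fold_const {M : Type*} [CommMonoid M] (x : M) (m : ℕ) :
    fold (fun _ => x) m = x ^ tsize m := by
  induction m using Nat.strong_induction_on with
  | _ m ih =>
    rw [fold_eq, tsize_eq, pow_add, pow_one, ← Finset.prod_pow_eq_pow_sum]
    congr 1
    refine Finset.prod_congr rfl fun p hp => ?_
    rw [ih _ (idx_lt_of_mem hp), ← pow_mul, mul_comm]

lemma fold_mul {M : Type*} [CommMonoid M] (ψ₁ ψ₂ : ℕ → M) (m : ℕ) :
    fold (fun m => ψ₁ m * ψ₂ m) m = fold ψ₁ m * fold ψ₂ m := by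
  induction m using Nat.strong_induction_on with
  | _ m ih =>
    rw [fold_eq, fold_eq ψ₁, fold_eq ψ₂, mul_mul_mul_comm, ← Finset.prod_mul_distrib]
    congr 1
    refine Finset.prod_congr rfl fun p hp => ?_
    rw [ih _ (idx_lt_of_mem hp), mul_pow]

lemma fold_map {M N : Type*} [CommMonoid M] [CommMonoid N] (g : M →* N) (ψ : ℕ → M) (m : ℕ) :
    g (fold ψ m) = fold (fun m => g (ψ m)) m := by
  induction m using Nat.strong_induction_on with
  | _ m ih =>
    rw [fold_eq, fold_eq, map_mul, map_prod]
    congr 1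
    refine Finset.prod_congr rfl fun p hp => ?_
    rw [map_pow, ih _ (idx_lt_of_mem hp)]

lemma fold_nonneg {ψ : ℕ → ℝ} (h : ∀ k, 0 ≤ ψ k) (m : ℕ) : 0 ≤ fold ψ m := by
  induction m using Nat.strong_induction_on with
  | _ m ih =>
    rw [fold_eq]
    exact mul_nonneg (h m) (Finset.prod_nonneg fun p hp => pow_nonneg (ih _ (idx_lt_of_mem hp)) _)

lemma fold_mono {ψ₁ ψ₂ : ℕ → ℝ} (h0 : ∀ k, 0 ≤ ψ₁ k) (h : ∀ k, ψ₁ k ≤ ψ₂ k) (m : ℕ) :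
    fold ψ₁ m ≤ fold ψ₂ m := by
  induction m using Nat.strong_induction_on with
  | _ m ih =>
    rw [fold_eq, fold_eq]
    refine mul_le_mul (h m) ?_ (Finset.prod_nonneg fun p hp => pow_nonneg (fold_nonneg h0 _) _)
      ((h0 m).trans (h m))
    refine Finset.prod_le_prod (fun p hp => pow_nonneg (fold_nonneg h0 _) _) fun p hp => ?_
    exact pow_le_pow_left₀ (fold_nonneg h0 _) (ih _ (idx_lt_of_mem hp)) _

lemma prod_factors_prod {M ι : Type*} [CommMonoid M] (S : Finset ι) (f : ι → ℕ) (hf : ∀ i ∈ S, 1 ≤ f i)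
    (g : ℕ → M) :
    ∏ p ∈ (∏ i ∈ S, pr (f i)).primeFactors, g (idx p) ^ ((∏ i ∈ S, pr (f i)).factorization p)
      = ∏ i ∈ S, g (f i) := by
  rw [← Nat.prod_factorization_eq_prod_primeFactors (fun p e => g (idx p) ^ e),
    Nat.factorization_prod (fun i _ => (pr_prime _).ne_zero)]
  rw [← Finsupp.prod_finsetSum_index (by simp) (by intros; rw [pow_add])]
  refine Finset.prod_congr rfl fun i hi => ?_
  rw [(pr_prime _).factorization, Finsupp.prod_single_index (by simp), pow_one, idx_pr (hf i hi)]

lemma cardFactors_prod_pr {ι : Type*} (S : Finset ι) (f : ι → ℕ) :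
    ArithmeticFunction.cardFactors (∏ i ∈ S, pr (f i)) = S.card := by
  induction S using Finset.induction_on with
  | empty => simp
  | insert a s ha ih =>
    rw [Finset.prod_insert ha, ArithmeticFunction.cardFactors_mul (pr_prime _).ne_zero
      (Finset.prod_ne_zero_iff.2 fun i _ => (pr_prime _).ne_zero), ih, Finset.card_insert_of_notMem ha,
      ArithmeticFunction.cardFactors_apply_prime (pr_prime _), add_comm]

lemma factorization_prod_pr {ι : Type*} (S : Finset ι) (f : ι → ℕ) (hf : ∀ i ∈ S, 1 ≤ f i) {p : ℕ}
    (hp : p.Prime) :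
    (∏ i ∈ S, pr (f i)).factorization p = (S.filter fun i => f i = idx p).card := by
  rw [Nat.factorization_prod (fun i _ => (pr_prime _).ne_zero), Finsupp.finsetSum_apply,
    Finset.card_filter]
  refine Finset.sum_congr rfl fun i hi => ?_
  rw [(pr_prime _).factorization, Finsupp.single_apply]
  have : pr (f i) = p ↔ f i = idx p :=
    ⟨fun h => by rw [← h, idx_pr (hf i hi)], fun h => by rw [h, pr_idx hp]⟩
  simp [this]

noncomputable def mfac (m : ℕ) : ℕ := ∏ p ∈ m.primeFactors, (m.factorization p).factorial

lemma mfac_pos (m : ℕ) : 0 < mfac m := Finset.prod_pos fun _ _ => Nat.factorial_pos _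

end IsoCLT

open scoped Classical BigOperators
open MeasureTheory ProbabilityTheory

namespace IsoCLT

@[ext] structure PT (V : Type) where
  root : V
  par : V → V
  par_root : par root = root
  hgt : ∃ h : V → ℕ, h root = 0 ∧ ∀ v, v ≠ root → h v = h (par v) + 1

namespace PT

variable {V W : Type}

lemma upInd (P : PT V) {p : V → Prop} (h0 : p P.root)
    (hs : ∀ v, v ≠ P.root → p (P.par v) → p v) : ∀ v, p v := by
  obtain ⟨h, hr, hh⟩ := P.hgt
  have key : ∀ k v, h v = k → p v := by
    intro k
    induction k with
    | zero =>
      intro v hv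
      by_cases hvr : v = P.root
      · rw [hvr]; exact h0
      · have := hh v hvr; omega
    | succ k ih =>
      intro v hv
      by_cases hvr : v = P.root
      · rw [hvr]; exact h0
      · have := hh v hvr
        exact hs v hvr (ih _ (by omega))
  exact fun v => key _ v rfl

lemma wfPar (P : PT V) : WellFounded (fun u v => v ≠ P.root ∧ P.par v = u) := by
  refine ⟨fun v => ?_⟩
  refine P.upInd (p := fun v => Acc (fun u v => v ≠ P.root ∧ P.par v = u) v) ?_ ?_ v
  · exact ⟨_, fun u hu => absurd rfl hu.1⟩
  · intro v hv ih
    exact ⟨_, fun u hu => hu.2 ▸ ih⟩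

lemma exists_rec (P : PT V) (r : W) (e : V → W → W) :
    ∃ φ : V → W, φ P.root = r ∧ ∀ v, v ≠ P.root → φ v = e v (φ (P.par v)) := by
  refine ⟨P.wfPar.fix (fun v ih => if h : v = P.root then r else e v (ih (P.par v) ⟨h, rfl⟩)), ?_, ?_⟩
  · rw [WellFounded.fix_eq]; simp
  · intro v hv
    rw [WellFounded.fix_eq]; simp [hv]

variable [Fintype V] [Fintype W]

noncomputable def ch (P : PT V) (v : V) : Finset V :=
  Finset.univ.filter fun u => u ≠ P.root ∧ P.par u = v

lemma mem_ch {P : PT V} {u v : V} : u ∈ P.ch v ↔ u ≠ P.root ∧ P.par u = v := by simp [ch]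

lemma downInd (P : PT V) {p : V → Prop} (hs : ∀ v, (∀ u ∈ P.ch v, p u) → p v) : ∀ v, p v := by
  obtain ⟨h, hr, hh⟩ := P.hgt
  obtain ⟨N, hN⟩ : ∃ N, ∀ v, h v ≤ N := ⟨Finset.univ.sup h, fun v => Finset.le_sup (Finset.mem_univ v)⟩
  have key : ∀ k v, N ≤ h v + k → p v := by
    intro k
    induction k with
    | zero =>
      intro v hv
      refine hs v fun u hu => ?_
      rw [mem_ch] at hu
      have := hh u hu.1
      have := hN u
      rw [hu.2] at *; omega
    | succ k ih =>
      intro v hv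
      refine hs v fun u hu => ih u ?_
      rw [mem_ch] at hu
      have := hh u hu.1
      rw [hu.2] at this; omega
  exact fun v => key N v (by omega)

lemma wfCh (P : PT V) : WellFounded (fun u v => u ∈ P.ch v) :=
  ⟨fun v => P.downInd (p := fun v => Acc (fun u v => u ∈ P.ch v) v) (fun _ h => ⟨_, h⟩) v⟩

noncomputable def code (P : PT V) : V → ℕ :=
  P.wfCh.fix (fun v ih => ∏ u ∈ (P.ch v).attach, pr (ih u.1 u.2))

lemma code_eq (P : PT V) (v : V) : P.code v = ∏ u ∈ P.ch v, pr (P.code u) := by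
  rw [code, WellFounded.fix_eq, Finset.prod_attach (P.ch v)
    (fun u => pr (P.wfCh.fix (fun v ih => ∏ u ∈ (P.ch v).attach, pr (ih u.1 u.2)) u))]

lemma code_unique (P : PT V) (f : V → ℕ) (hf : ∀ v, f v = ∏ u ∈ P.ch v, pr (f u)) (v : V) :
    f v = P.code v := by
  refine P.downInd (p := fun v => f v = P.code v) (fun v ih => ?_) v
  rw [hf, code_eq]
  exact Finset.prod_congr rfl fun u hu => by rw [ih u hu]

lemma code_pos (P : PT V) (v : V) : 1 ≤ P.code v := by
  rw [code_eq]
  exact Nat.one_le_iff_ne_zero.2 (Finset.prod_ne_zero_iff.2 fun i _ => (pr_prime _).ne_zero)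

lemma omega_code (P : PT V) (v : V) :
    ArithmeticFunction.cardFactors (P.code v) = (P.ch v).card := by
  rw [code_eq, cardFactors_prod_pr]

lemma fact_code (P : PT V) (v : V) {m : ℕ} (hm : 1 ≤ m) :
    ((P.ch v).filter fun u => P.code u = m).card = (P.code v).factorization (pr m) := by
  conv_rhs => rw [code_eq]
  rw [factorization_prod_pr _ _ (fun i _ => P.code_pos i) (pr_prime m), idx_pr hm]

lemma prod_code {K : Type*} [Field K] (P : PT V) (ψ : ℕ → K) (hψ : ∀ k, k ≠ 0 → fold ψ k ≠ 0) :
    ∏ v, ψ (P.code v) = fold ψ (P.code P.root) := by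
  have h1 : ∀ v, fold ψ (P.code v) = ψ (P.code v) * ∏ u ∈ P.ch v, fold ψ (P.code u) := by
    intro v
    rw [fold_eq]
    congr 1
    conv_lhs => rw [code_eq]
    exact prod_factors_prod (P.ch v) P.code (fun i _ => P.code_pos i) (fold ψ)
  have h2 : ∏ v, ∏ u ∈ P.ch v, fold ψ (P.code u) = ∏ u ∈ Finset.univ.erase P.root, fold ψ (P.code u) := by
    rw [← Finset.prod_fiberwise (Finset.univ.erase P.root) P.par]
    refine Finset.prod_congr rfl fun v _ => Finset.prod_congr ?_ fun _ _ => rfl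
    ext u; simp [mem_ch]
  have h3 : ∏ v, fold ψ (P.code v) = fold ψ (P.code P.root) * ∏ u ∈ Finset.univ.erase P.root, fold ψ (P.code u) :=
    (Finset.mul_prod_erase Finset.univ _ (Finset.mem_univ _)).symm
  have h4 : ∏ u ∈ Finset.univ.erase P.root, fold ψ (P.code u) ≠ 0 :=
    Finset.prod_ne_zero_iff.2 fun u _ => hψ _ (by have := P.code_pos u; omega)
  have h5 : ∏ v, fold ψ (P.code v) = (∏ v, ψ (P.code v)) * ∏ u ∈ Finset.univ.erase P.root, fold ψ (P.code u) := by
    rw [← h2, ← Finset.prod_mul_distrib]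
    exact Finset.prod_congr rfl fun v _ => h1 v
  exact mul_right_cancel₀ h4 (h5.symm.trans h3)

lemma card_eq (P : PT V) : Fintype.card V = tsize (P.code P.root) := by
  have := P.prod_code (fun _ => (2 : ℚ)) (fun k _ => by rw [fold_const]; positivity)
  rw [fold_const, Finset.prod_const, Finset.card_univ] at this
  exact pow_right_injective₀ (by norm_num) (by norm_num) this

def map (e : V ≃ W) (P : PT V) : PT W where
  root := e P.root
  par := fun w => e (P.par (e.symm w))
  par_root := by simp [P.par_root]
  hgt := by
    obtain ⟨h, hr, hh⟩ := P.hgt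
    refine ⟨fun w => h (e.symm w), by simpa using hr, fun v hv => ?_⟩
    have := hh (e.symm v) (by intro h; apply hv; rw [← h]; simp)
    simpa using this

lemma ch_map (e : V ≃ W) (P : PT V) (v : V) : (P.map e).ch (e v) = (P.ch v).map e.toEmbedding := by
  ext w
  simp only [mem_ch, Finset.mem_map, map]
  constructor
  · rintro ⟨h1, h2⟩
    exact ⟨e.symm w, ⟨by intro h; apply h1; rw [← h]; simp, e.injective h2⟩, by simp⟩
  · rintro ⟨u, ⟨h1, h2⟩, rfl⟩
    simp [h1, h2]

lemma code_map (e : V ≃ W) (P : PT V) (v : V) : (P.map e).code (e v) = P.code v := by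
  refine P.code_unique (fun v => (P.map e).code (e v)) (fun v => ?_) v
  rw [code_eq, ch_map, Finset.prod_map]; rfl

lemma exists_ref {α β : Type*} (A : Finset α) (B : Finset β) (f : α → ℕ) (g : β → ℕ)
    (h : ∀ y, (A.filter fun a => f a = y).card = (B.filter fun b => g b = y).card) :
    ∃ e : A ≃ B, ∀ a : A, g (e a) = f a := by
  have hc : ∀ y, Nonempty ({a : A // f a = y} ≃ {b : B // g b = y}) := by
    intro y
    refine Fintype.card_eq.1 ?_
    have h1 : Fintype.card {a : A // f a = y} = (A.filter fun a => f a = y).card := by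
      rw [Fintype.card_subtype, ← Finset.card_map (Function.Embedding.subtype _)]
      congr 1; ext a; simp [and_comm]
    have h2 : Fintype.card {b : B // g b = y} = (B.filter fun a => g a = y).card := by
      rw [Fintype.card_subtype, ← Finset.card_map (Function.Embedding.subtype _)]
      congr 1; ext a; simp [and_comm]
    rw [h1, h2, h]
  let E := fun y => (hc y).some
  refine ⟨(Equiv.sigmaFiberEquiv (fun a : A => f a)).symm.trans
    ((Equiv.sigmaCongrRight E).trans (Equiv.sigmaFiberEquiv (fun b : B => g b))), fun a => ?_⟩
  simp only [Equiv.trans_apply]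
  exact (E (f a) ⟨a, rfl⟩).2

end PT
end IsoCLT

open scoped Classical BigOperators
open MeasureTheory ProbabilityTheory

namespace IsoCLT
namespace PT
variable {V W : Type} [Fintype V] [Fintype W]

def Good (P : PT V) (Q : PT V) (e : V → V → V → V) : Prop :=
  ∀ a b, P.code a = Q.code b → Set.InjOn (e a b) (P.ch a) ∧
    ∀ u ∈ P.ch a, e a b u ∈ Q.ch b ∧ Q.code (e a b u) = P.code u

lemma exists_rec_iso (P Q : PT V) (e : V → V → V → V) (he : Good P Q e)
    (hc : P.code P.root = Q.code Q.root) :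
    ∃ φ : Equiv.Perm V, P.map φ = Q ∧ ∀ v, v ≠ P.root → φ v = e (P.par v) (φ (P.par v)) v := by
  obtain ⟨φ, h0, hs⟩ := P.exists_rec Q.root (fun v x => e (P.par v) x v)
  have hcode : ∀ v, Q.code (φ v) = P.code v := by
    refine P.upInd (by rw [h0, hc]) fun v hv ih => ?_
    rw [hs v hv]
    exact ((he _ _ ih.symm).2 v (mem_ch.2 ⟨hv, rfl⟩)).2
  have hch : ∀ v, v ≠ P.root → φ v ≠ Q.root ∧ Q.par (φ v) = φ (P.par v) := by
    intro v hv
    have := ((he _ _ (hcode (P.par v)).symm).2 v (mem_ch.2 ⟨hv, rfl⟩)).1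
    rw [← hs v hv] at this
    exact mem_ch.1 this
  have hinj : Function.Injective φ := by
    have : ∀ v, ∀ w, φ v = φ w → v = w := by
      refine P.upInd ?_ fun v hv ih => ?_
      · intro w hw
        by_contra hne
        exact (hch w (Ne.symm hne)).1 (hw.symm.trans h0)
      · intro w hw
        have hwr : w ≠ P.root := by
          rintro rfl
          exact (hch v hv).1 (hw.trans h0)
        have hp : P.par v = P.par w := by
          apply ih
          rw [← (hch v hv).2, ← (hch w hwr).2, hw]
        have h1 := hs v hv
        have h2 := hs w hwr
        rw [← hp] at h2
        refine (he _ _ (hcode (P.par v)).symm).1 (mem_ch.2 ⟨hv, rfl⟩) (mem_ch.2 ⟨hwr, hp.symm⟩) ?_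
        rw [← h1, ← h2, hw]
    exact fun v w => this v w
  refine ⟨Equiv.ofBijective φ (Finite.injective_iff_bijective.1 hinj), ?_, fun v hv => hs v hv⟩
  have hpar : ∀ v, φ (P.par v) = Q.par (φ v) := by
    intro v
    by_cases hv : v = P.root
    · rw [hv, P.par_root, h0, Q.par_root]
    · exact (hch v hv).2.symm
  refine PT.ext h0 ?_
  funext w
  obtain ⟨v, rfl⟩ := (Finite.injective_iff_bijective.1 hinj).2 w
  have : (Equiv.ofBijective φ (Finite.injective_iff_bijective.1 hinj)).symm (φ v) = v :=
    Equiv.ofBijective_symm_apply_apply φ _ v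
  simp only [map, this]
  exact hpar v

lemma exists_good (P Q : PT V) : ∃ R : V → V → V → V, Good P Q R := by
  have : ∀ a b, ∃ r : V → V, P.code a = Q.code b → Set.InjOn r (P.ch a) ∧
      ∀ u ∈ P.ch a, r u ∈ Q.ch b ∧ Q.code (r u) = P.code u := by
    intro a b
    by_cases h : P.code a = Q.code b
    · obtain ⟨e, he⟩ := exists_ref (P.ch a) (Q.ch b) P.code Q.code (by
        intro y
        by_cases hy : 1 ≤ y
        · rw [fact_code P a hy, fact_code Q b hy, h]
        · have h1 : ∀ u, P.code u ≠ y := fun u => by have := P.code_pos u; omega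
          have h2 : ∀ u, Q.code u ≠ y := fun u => by have := Q.code_pos u; omega
          simp [h1, h2])
      refine ⟨fun u => if hu : u ∈ P.ch a then (e ⟨u, hu⟩ : V) else u, fun _ => ⟨?_, ?_⟩⟩
      · intro u hu w hw huw
        have hu' : u ∈ P.ch a := hu
        have hw' : w ∈ P.ch a := hw
        simp only [hu', hw', dif_pos] at huw
        have := e.injective (Subtype.ext huw)
        simpa using this
      · intro u hu
        simp only [hu, dif_pos]
        exact ⟨(e ⟨u, hu⟩).2, he ⟨u, hu⟩⟩
    · exact ⟨id, fun h' => absurd h' h⟩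
  choose R hR using this
  exact ⟨R, fun a b h => hR a b h⟩

lemma iso_iff (P Q : PT V) : (∃ π : Equiv.Perm V, P.map π = Q) ↔ P.code P.root = Q.code Q.root := by
  constructor
  · rintro ⟨π, rfl⟩
    exact (P.code_map π P.root).symm
  · intro h
    obtain ⟨R, hR⟩ := exists_good P Q
    obtain ⟨φ, h1, _⟩ := exists_rec_iso P Q R hR h
    exact ⟨φ, h1⟩

def LA (P : PT V) (v : V) : Type := {f : Equiv.Perm (P.ch v) // ∀ u, P.code (f u) = P.code u}

noncomputable instance (P : PT V) (v : V) : Fintype (LA P v) := by unfold LA; infer_instance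

noncomputable def LA.ap {P : PT V} {v : V} (f : LA P v) (u : V) : V :=
  if hu : u ∈ P.ch v then (f.1 ⟨u, hu⟩ : V) else u

lemma LA.ap_mem {P : PT V} {v : V} (f : LA P v) {u : V} (hu : u ∈ P.ch v) :
    f.ap u ∈ P.ch v ∧ P.code (f.ap u) = P.code u := by
  unfold LA.ap
  rw [dif_pos hu]
  exact ⟨(f.1 ⟨u, hu⟩).2, f.2 ⟨u, hu⟩⟩

lemma LA.ap_inj {P : PT V} {v : V} (f : LA P v) {u w : V} (hu : u ∈ P.ch v) (hw : w ∈ P.ch v)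
    (h : f.ap u = f.ap w) : u = w := by
  unfold LA.ap at h
  rw [dif_pos hu, dif_pos hw] at h
  simpa using f.1.injective (Subtype.ext h)

lemma LA.ext' {P : PT V} {v : V} (f g : LA P v) (h : ∀ u ∈ P.ch v, f.ap u = g.ap u) : f = g := by
  refine Subtype.ext (Equiv.ext fun u => Subtype.ext ?_)
  have := h u.1 u.2
  unfold LA.ap at this
  rwa [dif_pos u.2, dif_pos u.2] at this

lemma LA.exists_of {P : PT V} {v : V} (r : V → V) (hi : Set.InjOn r (P.ch v))
    (hm : ∀ u ∈ P.ch v, r u ∈ P.ch v ∧ P.code (r u) = P.code u) :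
    ∃ f : LA P v, ∀ u ∈ P.ch v, f.ap u = r u := by
  have hinj : Function.Injective (fun u : P.ch v => (⟨r u, (hm u u.2).1⟩ : P.ch v)) := by
    intro u w h
    exact Subtype.ext (hi u.2 w.2 (by simpa using h))
  refine ⟨⟨Equiv.ofBijective _ (Finite.injective_iff_bijective.1 hinj), fun u => (hm u u.2).2⟩, ?_⟩
  intro u hu
  unfold LA.ap
  rw [dif_pos hu]; rfl

lemma card_LA (P : PT V) (v : V) : Fintype.card (LA P v) = mfac (P.code v) := by
  have h := DomMulAct.stabilizer_card' (fun u : P.ch v => P.code u)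
  have h1 : Fintype.card (LA P v) =
      Fintype.card {g : Equiv.Perm (P.ch v) // (fun u : P.ch v => P.code u) ∘ g = fun u : P.ch v => P.code u} := by
    unfold LA
    refine Fintype.card_congr (Equiv.subtypeEquivRight fun g => ?_)
    rw [funext_iff]; rfl
  have hfib : ∀ y, Fintype.card {a : P.ch v // P.code a = y} = ((P.ch v).filter fun u => P.code u = y).card := by
    intro y
    rw [Fintype.card_subtype, ← Finset.card_map (Function.Embedding.subtype _)]
    congr 1; ext a; simp [and_comm]
  rw [h1]
  refine (h.trans ?_)
  unfold mfac
  have h2 : (P.code v).primeFactors = (Finset.univ.image fun u : P.ch v => P.code u).image pr := by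
    ext p
    simp only [Finset.mem_image, Finset.mem_univ, true_and, exists_exists_eq_and]
    constructor
    · intro hp
      have hpp := Nat.prime_of_mem_primeFactors hp
      have hd := Nat.dvd_of_mem_primeFactors hp
      rw [code_eq, Prime.dvd_finsetProd_iff hpp.prime] at hd
      obtain ⟨u, hu, hd⟩ := hd
      exact ⟨⟨u, hu⟩, ((Nat.prime_dvd_prime_iff_eq hpp (pr_prime _)).1 hd).symm⟩
    · rintro ⟨u, rfl⟩
      refine Nat.mem_primeFactors.2 ⟨pr_prime _, ?_, by have := P.code_pos v; omega⟩
      rw [code_eq P v]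
      exact Finset.dvd_prod_of_mem (fun u => pr (P.code u)) u.2
  rw [h2]
  symm
  rw [Finset.prod_image (s := Finset.univ.image fun u : P.ch v => P.code u) (g := pr)]
  · refine Finset.prod_congr rfl fun y hy => ?_
    obtain ⟨u, -, rfl⟩ := Finset.mem_image.1 hy
    rw [← fact_code P v (P.code_pos u), ← hfib]
  · intro a ha b hb hab
    obtain ⟨u, -, rfl⟩ := Finset.mem_image.1 ha
    obtain ⟨w, -, rfl⟩ := Finset.mem_image.1 hb
    rw [← idx_pr (P.code_pos u), ← idx_pr (P.code_pos w)]
    exact congrArg idx hab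

lemma card_aut (P : PT V) :
    Fintype.card {π : Equiv.Perm V // P.map π = P} = ∏ v, mfac (P.code v) := by
  have h0 : ∏ v, mfac (P.code v) = Fintype.card (∀ v, LA P v) := by
    rw [Fintype.card_pi]; exact Finset.prod_congr rfl fun v _ => (P.card_LA v).symm
  rw [h0]
  obtain ⟨R, hR⟩ := exists_good P P
  have hg : ∀ ε : ∀ v, LA P v, Good P P (fun a b u => R a b ((ε a).ap u)) := by
    intro ε a b hab
    refine ⟨?_, ?_⟩
    · intro u hu w hw huw
      exact (ε a).ap_inj hu hw ((hR a b hab).1 ((ε a).ap_mem hu).1 ((ε a).ap_mem hw).1 huw)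
    · intro u hu
      have h1 := (ε a).ap_mem hu
      have h2 := (hR a b hab).2 _ h1.1
      exact ⟨h2.1, h2.2.trans h1.2⟩
  choose Φ h1 h2 using fun ε : ∀ v, LA P v => exists_rec_iso P P _ (hg ε) rfl
  symm
  refine Fintype.card_congr (Equiv.ofBijective (fun ε => (⟨Φ ε, h1 ε⟩ : {π : Equiv.Perm V // P.map π = P})) ⟨?_, ?_⟩)
  · intro ε ε' h
    have h : Φ ε = Φ ε' := by simpa using h
    funext a
    refine LA.ext' _ _ fun u hu => ?_
    have e1 := h2 ε u (mem_ch.1 hu).1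
    have e2 := h2 ε' u (mem_ch.1 hu).1
    rw [(mem_ch.1 hu).2] at e1 e2
    rw [← h] at e2
    have hc : P.code a = P.code (Φ ε a) := by
      conv_rhs => rw [← h1 ε]
      rw [code_map]
    exact (hR _ _ hc).1 ((ε a).ap_mem hu).1 ((ε' a).ap_mem hu).1 (e1.symm.trans e2)
  · rintro ⟨π, hπ⟩
    have hc : ∀ v, P.code (π v) = P.code v := fun v => by
      conv_lhs => rw [← hπ]
      rw [code_map]
    have hroot : π P.root = P.root := congrArg PT.root hπ
    have hpar : ∀ v, P.par (π v) = π (P.par v) := by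
      intro v
      have := congrFun (congrArg PT.par hπ) (π v)
      simpa [map] using this.symm
    have hch : ∀ a u, u ∈ P.ch a → π u ∈ P.ch (π a) := by
      intro a u hu
      rw [mem_ch] at hu ⊢
      refine ⟨fun h => hu.1 (π.injective (h.trans hroot.symm)), by rw [hpar, hu.2]⟩
    have hex : ∀ a, ∃ f : LA P a, ∀ u ∈ P.ch a, R a (π a) (f.ap u) = π u := by
      intro a
      obtain ⟨hi, hm⟩ := hR a (π a) (hc a).symm
      have hsurj : ∀ w ∈ P.ch (π a), ∃ u ∈ P.ch a, R a (π a) u = w := by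
        have := Finset.surj_on_of_inj_on_of_card_le (s := P.ch a) (t := P.ch (π a))
          (fun u _ => R a (π a) u) (fun u hu => (hm u hu).1) (fun u w hu hw h => hi hu hw h)
          (by rw [← omega_code, ← omega_code, hc])
        intro w hw
        obtain ⟨u, hu, h⟩ := this w hw
        exact ⟨u, hu, h.symm⟩
      choose! r hr1 hr2 using hsurj
      obtain ⟨f, hf⟩ := LA.exists_of (P := P) (v := a) (fun u => r (π u)) (by
        intro u hu w hw h
        apply π.injective
        rw [← hr2 _ (hch a u hu), ← hr2 _ (hch a w hw)]
        exact congrArg _ h) (by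
        intro u hu
        refine ⟨hr1 _ (hch a u hu), ?_⟩
        rw [← (hm _ (hr1 _ (hch a u hu))).2, hr2 _ (hch a u hu), hc])
      exact ⟨f, fun u hu => by rw [hf u hu, hr2 _ (hch a u hu)]⟩
    choose ε hε using hex
    refine ⟨ε, Subtype.ext (Equiv.ext ?_)⟩
    show ∀ v, Φ ε v = π v
    refine P.upInd ?_ fun v hv ih => ?_
    · rw [hroot]; exact congrArg PT.root (h1 ε)
    · rw [h2 ε v hv, ih]
      exact hε _ _ (mem_ch.2 ⟨hv, rfl⟩)

end PT
end IsoCLT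

open scoped Classical BigOperators
open MeasureTheory ProbabilityTheory

namespace IsoCLT
namespace PT
variable {V W : Type} [Fintype V] [Fintype W]

def gr (P : PT V) : SimpleGraph V where
  Adj u v := (u ≠ P.root ∧ P.par u = v) ∨ (v ≠ P.root ∧ P.par v = u)
  symm := ⟨fun _ _ h => h.symm⟩
  loopless := ⟨by
    intro u hu
    obtain ⟨h, hr, hh⟩ := P.hgt
    rcases hu with hu | hu <;>
    · have := hh u hu.1
      rw [hu.2] at this; omega⟩

lemma gr_adj {P : PT V} {u v : V} :
    P.gr.Adj u v ↔ (u ≠ P.root ∧ P.par u = v) ∨ (v ≠ P.root ∧ P.par v = u) := Iff.rfl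

lemma gr_connected (P : PT V) : P.gr.Connected := by
  have h : ∀ v, P.gr.Reachable v P.root := by
    refine P.upInd (SimpleGraph.Reachable.refl _) fun v hv ih => ?_
    exact (SimpleGraph.Adj.reachable (Or.inl ⟨hv, rfl⟩ : P.gr.Adj v (P.par v))).trans ih
  haveI : Nonempty V := ⟨P.root⟩
  exact ⟨fun u v => (h u).trans (h v).symm⟩

lemma gr_isTree (P : PT V) : P.gr.IsTree := by
  refine SimpleGraph.isTree_iff_connected_and_card.2 ⟨P.gr_connected, ?_⟩
  have h1 := P.gr_connected.card_vert_le_card_edgeSet_add_one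
  have h2 : Nat.card P.gr.edgeSet ≤ Nat.card {v : V // v ≠ P.root} := by
    refine Nat.card_le_card_of_surjective
      (fun v : {v : V // v ≠ P.root} => (⟨s(v.1, P.par v.1), Or.inl ⟨v.2, rfl⟩⟩ : P.gr.edgeSet)) ?_
    rintro ⟨e, he⟩
    induction e using Sym2.ind with
    | _ u v =>
      rcases (he : P.gr.Adj u v) with h | h
      · exact ⟨⟨u, h.1⟩, Subtype.ext (by simp [h.2])⟩
      · exact ⟨⟨v, h.1⟩, Subtype.ext (by simp [h.2, Sym2.eq_swap])⟩
  have h3 : Nat.card {v : V // v ≠ P.root} + 1 = Nat.card V := by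
    rw [Nat.card_eq_fintype_card, Nat.card_eq_fintype_card, Fintype.card_subtype_compl,
      Fintype.card_subtype_eq]
    have : 0 < Fintype.card V := Fintype.card_pos_iff.2 ⟨P.root⟩
    omega
  omega

lemma gr_dist (P : PT V) {h : V → ℕ} (hr : h P.root = 0)
    (hh : ∀ v, v ≠ P.root → h v = h (P.par v) + 1) (v : V) : P.gr.dist P.root v = h v := by
  apply le_antisymm
  · have : ∀ v, ∃ p : P.gr.Walk P.root v, p.length = h v := by
      refine P.upInd ⟨SimpleGraph.Walk.nil, by simp [hr]⟩ fun v hv ⟨p, hp⟩ => ?_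
      have hadj : P.gr.Adj (P.par v) v := Or.inr ⟨hv, rfl⟩
      refine ⟨p.concat hadj, ?_⟩
      rw [SimpleGraph.Walk.length_concat, hp, hh v hv]
    obtain ⟨p, hp⟩ := this v
    exact hp ▸ SimpleGraph.dist_le p
  · obtain ⟨p, hp⟩ := P.gr_connected.exists_walk_length_eq_dist P.root v
    rw [← hp]
    have : ∀ (a b : V) (p : P.gr.Walk a b), h b ≤ h a + p.length := by
      intro a b p
      induction p with
      | nil => simp
      | cons hadj q ih =>
        rw [SimpleGraph.Walk.length_cons]
        rcases hadj with h' | h'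
        · have := hh _ h'.1; rw [h'.2] at this; omega
        · have := hh _ h'.1; rw [h'.2] at this; omega
    have := this _ _ p
    omega

lemma gr_inj {P Q : PT V} (hg : P.gr = Q.gr) (hr : P.root = Q.root) : P = Q := by
  refine PT.ext hr ?_
  funext v
  by_cases hv : v = P.root
  · rw [hv, P.par_root, hr, Q.par_root]
  obtain ⟨h, h0, hh⟩ := P.hgt
  obtain ⟨k, k0, kk⟩ := Q.hgt
  have hk : ∀ v, h v = k v := fun v => by
    rw [← P.gr_dist h0 hh, ← Q.gr_dist k0 kk, hg, hr]
  have h1 : P.gr.Adj v (Q.par v) := by rw [hg]; exact Or.inl ⟨hr ▸ hv, rfl⟩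
  rcases h1 with h1 | h1
  · exact h1.2
  · have e1 := hh _ h1.1
    have e2 := kk v (hr ▸ hv)
    rw [h1.2] at e1
    rw [hk, hk] at e1
    omega

lemma exists_of_tree (G : SimpleGraph V) (hG : G.IsTree) (r : V) : ∃ P : PT V, P.gr = G ∧ P.root = r := by
  have hp : ∀ v, ∃ w, v ≠ r → G.Adj v w ∧ G.dist r v = G.dist r w + 1 := by
    intro v
    by_cases hv : v = r
    · exact ⟨v, fun h => absurd hv h⟩
    obtain ⟨p, hp⟩ := hG.connected.exists_walk_length_eq_dist v r
    cases p with
    | nil => exact absurd rfl hv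
    | cons hadj q =>
      rename_i w
      refine ⟨w, fun _ => ⟨hadj, ?_⟩⟩
      have h1 := hG.dist_eq_dist_add_one_of_adj r hadj
      have h2 := SimpleGraph.dist_le q
      rw [SimpleGraph.Walk.length_cons] at hp
      rw [SimpleGraph.dist_comm (u := v)] at hp
      rw [SimpleGraph.dist_comm (v := r)] at h2
      omega
  choose f hf using hp
  let P : PT V := ⟨r, fun v => if v = r then r else f v, by simp, G.dist r, by simp, fun v hv => by
    simp only [hv, if_false]; exact (hf v hv).2⟩
  refine ⟨P, ?_, rfl⟩
  have hle : P.gr ≤ G := by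
    intro u v huv
    rcases huv with ⟨h1, h2⟩ | ⟨h1, h2⟩
    · have h1' : u ≠ r := h1
      have : f u = v := by rw [← h2]; simp [P, h1']
      exact this ▸ (hf u h1').1
    · have h1' : v ≠ r := h1
      have : f v = u := by rw [← h2]; simp [P, h1']
      exact this ▸ (hf v h1').1.symm
  exact le_antisymm hle ((SimpleGraph.isTree_iff_minimal_connected.1 hG).2 P.gr_connected hle)

lemma gr_map (P : PT V) (e : Equiv.Perm V) (u v : V) : (P.map e).gr.Adj (e u) (e v) ↔ P.gr.Adj u v := by
  simp [gr_adj, map]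

lemma neighbor_card (P : PT V) (v : V) :
    (P.gr.neighborSet v).ncard = (P.ch v).card + if v = P.root then 0 else 1 := by
  have hp : P.par v ∉ P.ch v ∨ v = P.root := by
    by_cases hv : v = P.root
    · exact Or.inr hv
    · left
      intro hm
      obtain ⟨h, h0, hh⟩ := P.hgt
      rw [mem_ch] at hm
      have h1 := hh _ hm.1
      have h2 := hh v hv
      rw [hm.2] at h1
      omega
  split_ifs with hv
  · have : P.gr.neighborSet v = (P.ch v : Set V) := by
      ext u
      simp only [SimpleGraph.mem_neighborSet, gr_adj, Finset.mem_coe, mem_ch]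
      constructor
      · rintro (h | h)
        · exact absurd hv h.1
        · exact h
      · exact Or.inr
    rw [this, Set.ncard_coe_finset, add_zero]
  · have hp := hp.resolve_right hv
    have : P.gr.neighborSet v = (insert (P.par v) (P.ch v) : Finset V) := by
      ext u
      simp only [SimpleGraph.mem_neighborSet, gr_adj, Finset.mem_coe, mem_ch, Finset.mem_insert]
      constructor
      · rintro (h | h)
        · exact Or.inl h.2.symm
        · exact Or.inr h
      · rintro (h | h)
        · exact Or.inl ⟨hv, h.symm⟩
        · exact Or.inr h
    rw [this, Set.ncard_coe_finset, Finset.card_insert_of_notMem hp]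

noncomputable def graft (P : PT V) (Q : PT W) : PT (V ⊕ W) where
  root := Sum.inl P.root
  par := Sum.elim (fun v => Sum.inl (P.par v)) (fun w => if w = Q.root then Sum.inl P.root else Sum.inr (Q.par w))
  par_root := by simp [P.par_root]
  hgt := by
    obtain ⟨h, h0, hh⟩ := P.hgt
    obtain ⟨k, k0, kk⟩ := Q.hgt
    refine ⟨Sum.elim h (fun w => k w + 1), by simpa using h0, ?_⟩
    rintro (v | w) hv
    · simpa using hh v (by simpa using hv)
    · by_cases hw : w = Q.root
      · simp [hw, h0, k0]
      · simp [hw, kk w hw]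

lemma graft_code (P : PT V) (Q : PT W) :
    (P.graft Q).code (P.graft Q).root = pr (Q.code Q.root) * P.code P.root := by
  have key := (P.graft Q).code_unique (Sum.elim
    (fun v => (if v = P.root then pr (Q.code Q.root) else 1) * P.code v) Q.code) ?_ (P.graft Q).root
  · rw [← key]; simp [graft]
  · rintro (v | w)
    · have hc : (P.graft Q).ch (Sum.inl v) =
          (P.ch v).map Function.Embedding.inl ∪ (if v = P.root then {Sum.inr Q.root} else ∅) := by
        ext (u | w)
        · simp [mem_ch, graft]
          by_cases hv : v = P.root <;> simp [hv]
        · by_cases hw : w = Q.root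
          · by_cases hv : v = P.root
            · simp [mem_ch, graft, hv, hw]
            · simp [mem_ch, graft, hv, hw, Ne.symm hv]
          · by_cases hv : v = P.root <;> simp [mem_ch, graft, hv, hw]
      rw [hc, Finset.prod_union, Finset.prod_map]
      · simp only [Sum.elim_inl, Function.Embedding.inl_apply]
        rw [mul_comm, code_eq]
        congr 1
        · refine Finset.prod_congr rfl fun u hu => ?_
          rw [if_neg (mem_ch.1 hu).1, one_mul]
        · split_ifs <;> simp
      · rw [Finset.disjoint_left]
        intro a ha
        obtain ⟨u, -, rfl⟩ := Finset.mem_map.1 ha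
        split_ifs <;> simp
    · have hc : (P.graft Q).ch (Sum.inr w) = (Q.ch w).map Function.Embedding.inr := by
        ext (u | x)
        · simp [mem_ch, graft]
        · by_cases hx : x = Q.root <;> simp [mem_ch, graft, hx]
      rw [hc, Finset.prod_map]
      simp only [Sum.elim_inr, Function.Embedding.inr_apply]
      rw [code_eq]

lemma exists_code (m : ℕ) : m ≠ 0 → ∃ (V : Type) (_ : Fintype V) (P : PT V), P.code P.root = m := by
  induction m using Nat.strong_induction_on with
  | _ m ih =>
    intro hm
    by_cases h1 : m = 1
    · refine ⟨Unit, inferInstance, ⟨(), id, rfl, fun _ => 0, rfl, fun v hv => absurd rfl hv⟩, ?_⟩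
      rw [code_eq, Finset.prod_eq_one, h1]
      intro u hu
      exact absurd rfl (mem_ch.1 hu).1
    · obtain ⟨p, hp, k, rfl⟩ := Nat.exists_prime_and_dvd h1
      have hk : k ≠ 0 := by rintro rfl; simp at hm
      have hkl : k < p * k := by nlinarith [hp.two_le, Nat.pos_of_ne_zero hk]
      have hpl : idx p < p * k := lt_of_lt_of_le (idx_lt hp) (Nat.le_mul_of_pos_right _ (Nat.pos_of_ne_zero hk))
      obtain ⟨V, _, P, hP⟩ := ih k hkl hk
      obtain ⟨W, _, Q, hQ⟩ := ih (idx p) hpl (by have := idx_pos p; omega)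
      refine ⟨V ⊕ W, inferInstance, P.graft Q, ?_⟩
      rw [graft_code, hP, hQ, pr_idx hp]

lemma exists_code_fin {m n : ℕ} (hm : m ≠ 0) (hn : tsize m = n) :
    ∃ P : PT (Fin n), P.code P.root = m := by
  obtain ⟨V, _, P, hP⟩ := exists_code m hm
  have hc : Fintype.card V = Fintype.card (Fin n) := by rw [P.card_eq, hP, hn, Fintype.card_fin]
  let e := Fintype.equivOfCardEq hc
  exact ⟨P.map e, (P.code_map e P.root).trans hP⟩

noncomputable instance : Fintype (PT V) :=
  Fintype.ofInjective (fun P : PT V => (P.root, P.par)) (fun P Q h => by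
    simp only [Prod.mk.injEq] at h; exact PT.ext h.1 h.2)

noncomputable instance : MulAction (Equiv.Perm V) (PT V) where
  smul π P := P.map π
  one_smul P := rfl
  mul_smul π σ P := rfl

lemma smul_def (π : Equiv.Perm V) (P : PT V) : π • P = P.map π := rfl

lemma card_code (P : PT V) :
    (Finset.univ.filter fun Q : PT V => Q.code Q.root = P.code P.root).card * ∏ v, mfac (P.code v)
      = (Fintype.card V).factorial := by
  have h := MulAction.card_orbit_mul_card_stabilizer_eq_card_group (Equiv.Perm V) P
  rw [Fintype.card_perm] at h
  rw [← h, ← card_aut]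
  congr 1
  · rw [← Fintype.card_coe]
    refine Fintype.card_congr (Equiv.subtypeEquivRight fun Q => ?_)
    rw [Finset.mem_filter, MulAction.mem_orbit_iff, eq_comm, ← iso_iff]
    simp [smul_def]

end PT

noncomputable def treeEquiv (n : ℕ) : PT (Fin n) ≃ RTree n :=
  Equiv.ofBijective (fun P => ⟨P.gr, P.gr_isTree, P.root⟩) ⟨fun P Q h => by
    simp only [RTree.mk.injEq] at h
    exact PT.gr_inj h.1 h.2, fun T => by
    obtain ⟨P, h1, h2⟩ := PT.exists_of_tree T.graph T.isTree T.root
    refine ⟨P, ?_⟩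
    cases T
    simp at h1 h2 ⊢
    exact ⟨h1, h2⟩⟩

lemma treeEquiv_outdeg {n : ℕ} (P : PT (Fin n)) (v : Fin n) :
    (treeEquiv n P).outdeg v = ArithmeticFunction.cardFactors (P.code v) := by
  rw [PT.omega_code]
  unfold RTree.outdeg
  have h1 : (treeEquiv n P).graph = P.gr := rfl
  have h2 : (treeEquiv n P).root = P.root := rfl
  rw [h1, h2, PT.neighbor_card]
  split_ifs <;> simp

lemma treeEquiv_isom {n : ℕ} (P Q : PT (Fin n)) :
    (treeEquiv n P).Isom (treeEquiv n Q) ↔ P.code P.root = Q.code Q.root := by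
  rw [← PT.iso_iff]
  constructor
  · rintro ⟨φ, hφ⟩
    refine ⟨φ.toEquiv, PT.gr_inj ?_ hφ⟩
    ext u v
    obtain ⟨u, rfl⟩ := φ.toEquiv.surjective u
    obtain ⟨v, rfl⟩ := φ.toEquiv.surjective v
    rw [PT.gr_map]
    exact φ.map_rel_iff.symm
  · rintro ⟨π, rfl⟩
    exact ⟨⟨π, fun {a b} => P.gr_map π a b⟩, rfl⟩

noncomputable def codes (n : ℕ) : Finset ℕ :=
  Finset.univ.image fun P : PT (Fin n) => P.code P.root

lemma mem_codes {n m : ℕ} : m ∈ codes n ↔ m ≠ 0 ∧ tsize m = n := by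
  simp only [codes, Finset.mem_image, Finset.mem_univ, true_and]
  constructor
  · rintro ⟨P, rfl⟩
    exact ⟨by have := P.code_pos P.root; omega, by rw [← P.card_eq, Fintype.card_fin]⟩
  · rintro ⟨h1, h2⟩
    exact PT.exists_code_fin h1 h2

theorem comb_main (n : ℕ) (ψ : ℕ → ℂ) (hψ : ∀ k, ψ k ≠ 0) :
    ∑ p : IsoPair n, ∏ v, ψ (p.1.1.outdeg v) = ((n.factorial : ℂ)) ^ 2 *
      ∑ m ∈ codes n, fold (fun m => ψ (ArithmeticFunction.cardFactors m) / (mfac m : ℂ) ^ 2) m := by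
  have hm0 : ∀ k, (mfac k : ℂ) ≠ 0 := fun k => by exact_mod_cast (mfac_pos k).ne'
  have hfold : ∀ (χ : ℕ → ℂ), (∀ k, χ k ≠ 0) → ∀ k, fold χ k ≠ 0 := by
    intro χ hχ k
    induction k using Nat.strong_induction_on with
    | _ m ih =>
      rw [fold_eq]
      exact mul_ne_zero (hχ m) (Finset.prod_ne_zero_iff.2 fun p hp => pow_ne_zero _ (ih _ (idx_lt_of_mem hp)))
  let κ : PT (Fin n) → ℕ := fun P => P.code P.root
  let N : ℕ → ℕ := fun m => (Finset.univ.filter fun Q : PT (Fin n) => κ Q = m).card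
  let F : ℕ → ℂ := fun m => fold (fun m => ψ (ArithmeticFunction.cardFactors m)) m
  have hF : ∀ P : PT (Fin n), ∏ v, ψ ((treeEquiv n P).outdeg v) = F (κ P) := by
    intro P
    simp only [treeEquiv_outdeg]
    exact P.prod_code (fun m => ψ (ArithmeticFunction.cardFactors m)) (fun k _ => hfold _ (fun _ => hψ _) k)
  have hA : ∀ P : PT (Fin n), (N (κ P) : ℂ) * fold (fun m => (mfac m : ℂ)) (κ P) = n.factorial := by
    intro P
    have h1 := P.card_code
    rw [Fintype.card_fin] at h1
    rw [← P.prod_code (fun m => (mfac m : ℂ)) (fun k _ => hfold _ hm0 k), ← h1]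
    push_cast
    rfl
  have e1 : ∑ p : IsoPair n, ∏ v, ψ (p.1.1.outdeg v) =
      ∑ q : {q : PT (Fin n) × PT (Fin n) // κ q.1 = κ q.2}, F (κ q.1.1) := by
    symm
    let E : {q : PT (Fin n) × PT (Fin n) // κ q.1 = κ q.2} ≃ IsoPair n :=
      (Equiv.prodCongr (treeEquiv n) (treeEquiv n)).subtypeEquiv
      (fun q => (treeEquiv_isom q.1 q.2).symm)
    refine Fintype.sum_equiv E _ _ fun q => ?_
    rw [← hF]; rfl
  have e2 : ∑ q : {q : PT (Fin n) × PT (Fin n) // κ q.1 = κ q.2}, F (κ q.1.1) =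
      ∑ P : PT (Fin n), (N (κ P) : ℂ) * F (κ P) := by
    rw [← Finset.sum_subtype (Finset.univ.filter fun q : PT (Fin n) × PT (Fin n) => κ q.1 = κ q.2)
      (by simp) (fun q => F (κ q.1)), Finset.sum_filter, ← Finset.univ_product_univ, Finset.sum_product]
    refine Finset.sum_congr rfl fun P _ => ?_
    rw [← Finset.sum_filter]
    show ∑ a ∈ Finset.univ.filter (fun a => κ P = κ a), F (κ P) = _
    rw [Finset.sum_const, nsmul_eq_mul]
    congr 3
    ext Q
    simp [eq_comm]
  have e3 : ∑ P : PT (Fin n), (N (κ P) : ℂ) * F (κ P) = ∑ m ∈ codes n, (N m : ℂ) * (N m * F m) := by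
    rw [Finset.sum_comp (fun m => (N m : ℂ) * F m) κ]
    refine Finset.sum_congr rfl fun m _ => ?_
    rw [nsmul_eq_mul]
  rw [e1, e2, e3, Finset.mul_sum]
  refine Finset.sum_congr rfl fun m hm => ?_
  obtain ⟨P, -, hP⟩ := Finset.mem_image.1 hm
  have h1 := hA P
  have hP' : κ P = m := hP
  rw [hP'] at h1
  have h2 : F m = fold (fun m => ψ (ArithmeticFunction.cardFactors m) / (mfac m : ℂ) ^ 2) m *
      (fold (fun m => (mfac m : ℂ)) m * fold (fun m => (mfac m : ℂ)) m) := by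
    rw [← fold_mul, ← fold_mul]
    show fold (fun m => ψ (ArithmeticFunction.cardFactors m)) m = _
    congr 1
    funext k
    have := hm0 k
    field_simp
  rw [h2, ← h1]
  ring
end IsoCLT

open scoped Classical BigOperators
open MeasureTheory ProbabilityTheory

namespace IsoCLT

section mf
variable {K : Type*} [Field K]

noncomputable def mf (α a : ℕ → K) (m : ℕ) : K :=
  if m = 0 then 0 else m.factorization.prod fun p e => α e * a (idx p) ^ e

@[simp] lemma mf_zero (α a : ℕ → K) : mf α a 0 = 0 := by simp [mf]

@[simp] lemma mf_one (α a : ℕ → K) : mf α a 1 = 1 := by simp [mf]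

lemma mf_mul (α a : ℕ → K) {m n : ℕ} (h : Nat.Coprime m n) : mf α a (m * n) = mf α a m * mf α a n := by
  by_cases hm : m = 0
  · simp [hm]
  by_cases hn : n = 0
  · simp [hn]
  simp only [mf, hm, hn, mul_eq_zero, or_self, if_false]
  rw [Nat.factorization_mul_of_coprime h, Finsupp.prod_add_index_of_disjoint]
  exact h.disjoint_primeFactors

lemma mf_prime_pow (α a : ℕ → K) (h0 : α 0 = 1) {p : ℕ} (hp : p.Prime) (e : ℕ) :
    mf α a (p ^ e) = α e * a (idx p) ^ e := by
  have : p ^ e ≠ 0 := pow_ne_zero _ hp.ne_zero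
  simp only [mf, this, if_false]
  rw [hp.factorization_pow, Finsupp.prod_single_index (by simp [h0])]

lemma mf_smul (α a : ℕ → K) (s : K) (m : ℕ) :
    mf α (fun i => s * a i) m = s ^ (ArithmeticFunction.cardFactors m) * mf α a m := by
  by_cases hm : m = 0
  · simp [hm]
  simp only [mf, hm, if_false]
  rw [ArithmeticFunction.cardFactors_eq_sum_factorization, Finsupp.prod, Finsupp.prod, Finsupp.sum,
    ← Finset.prod_pow_eq_pow_sum, ← Finset.prod_mul_distrib]
  refine Finset.prod_congr rfl fun p _ => ?_
  rw [mul_pow]; ring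

end mf

lemma norm_mf (α a : ℕ → ℂ) (m : ℕ) : ‖mf α a m‖ = mf (fun e => ‖α e‖) (fun i => ‖a i‖) m := by
  by_cases hm : m = 0
  · simp [hm]
  simp only [mf, hm, if_false]
  rw [Finsupp.prod, Finsupp.prod, norm_prod]
  refine Finset.prod_congr rfl fun p _ => ?_
  rw [norm_mul, norm_pow]

lemma ofReal_mf (α a : ℕ → ℝ) (m : ℕ) : ((mf α a m : ℝ) : ℂ) = mf (fun e => (α e : ℂ)) (fun i => (a i : ℂ)) m := by
  by_cases hm : m = 0
  · simp [hm]
  simp only [mf, hm, if_false]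
  rw [Finsupp.prod, Finsupp.prod]
  push_cast; rfl

lemma mf_nonneg {α a : ℕ → ℝ} (h : ∀ e, 0 ≤ α e) (ha : ∀ i, 0 ≤ a i) (m : ℕ) : 0 ≤ mf α a m := by
  by_cases hm : m = 0
  · simp [hm]
  simp only [mf, hm, if_false]
  exact Finset.prod_nonneg fun p _ => mul_nonneg (h _) (pow_nonneg (ha _) _)

lemma mf_mono {α a b : ℕ → ℝ} (h : ∀ e, 0 ≤ α e) (ha : ∀ i, 0 ≤ a i) (hab : ∀ i, a i ≤ b i) (m : ℕ) :
    mf α a m ≤ mf α b m := by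
  by_cases hm : m = 0
  · simp [hm]
  simp only [mf, hm, if_false]
  exact Finset.prod_le_prod (fun p _ => mul_nonneg (h _) (pow_nonneg (ha _) _)) fun p _ =>
    mul_le_mul_of_nonneg_left (pow_le_pow_left₀ (ha _) (hab _) _) (h _)

lemma mf_sum_le {α a : ℕ → ℝ} (h0 : α 0 = 1) (h : ∀ e, 0 ≤ α e) (ha : ∀ i, 0 ≤ a i)
    (hs : ∀ i, Summable fun e => α e * a i ^ e) (N : ℕ) :
    ∑ m ∈ Finset.range N, mf α a m ≤ ∏ p ∈ N.primesBelow, ∑' e, α e * a (idx p) ^ e := by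
  obtain ⟨h1, h2⟩ := EulerProduct.summable_and_hasSum_smoothNumbers_prod_primesBelow_tsum
    (f := mf α a) (mf_one _ _) (fun h => mf_mul α a h) (fun {p} hp => by
      refine ((hs (idx p)).congr fun e => ?_).norm
      rw [mf_prime_pow _ _ h0 hp]) N
  have h3 : ∏ p ∈ N.primesBelow, ∑' e, mf α a (p ^ e) = ∏ p ∈ N.primesBelow, ∑' e, α e * a (idx p) ^ e := by
    refine Finset.prod_congr rfl fun p hp => ?_
    exact tsum_congr fun e => mf_prime_pow _ _ h0 (Nat.prime_of_mem_primesBelow hp) e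
  rw [h3] at h2
  have h4 : HasSum (Set.indicator N.smoothNumbers (mf α a))
      (∏ p ∈ N.primesBelow, ∑' e, α e * a (idx p) ^ e) := hasSum_subtype_iff_indicator.1 h2
  have h5 : ∀ m ∈ Finset.range N, mf α a m = Set.indicator N.smoothNumbers (mf α a) m := by
    intro m hm
    by_cases hm0 : m = 0
    · subst hm0
      rw [mf_zero]
      symm
      by_cases h : 0 ∈ N.smoothNumbers
      · rw [Set.indicator_of_mem h, mf_zero]
      · rw [Set.indicator_of_notMem h]
    · have hmem : m ∈ N.smoothNumbers := by
        rw [Nat.mem_smoothNumbers']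
        intro p hp hd
        exact lt_of_le_of_lt (Nat.le_of_dvd (Nat.pos_of_ne_zero hm0) hd) (Finset.mem_range.1 hm)
      rw [Set.indicator_of_mem hmem]
  rw [Finset.sum_congr rfl h5]
  exact sum_le_hasSum (Finset.range N)
    (fun i _ => Set.indicator_nonneg (fun m _ => mf_nonneg h ha m) i) h4

lemma mf_prod_le {α a : ℕ → ℝ} (h0 : α 0 = 1) (h : ∀ e, 0 ≤ α e) (ha : ∀ i, 0 ≤ a i)
    (hs : Summable (mf α a)) (N : ℕ) :
    ∏ p ∈ N.primesBelow, ∑' e, α e * a (idx p) ^ e ≤ ∑' m, mf α a m := by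
  have h1 := EulerProduct.prod_primesBelow_tsum_eq_tsum_smoothNumbers
    (f := mf α a) (mf_one _ _) (fun h => mf_mul α a h) hs.norm N
  have h3 : ∏ p ∈ N.primesBelow, ∑' e, mf α a (p ^ e) = ∏ p ∈ N.primesBelow, ∑' e, α e * a (idx p) ^ e := by
    refine Finset.prod_congr rfl fun p hp => ?_
    exact tsum_congr fun e => mf_prime_pow _ _ h0 (Nat.prime_of_mem_primesBelow hp) e
  rw [← h3, h1]
  exact hs.tsum_subtype_le _ _ (fun m => mf_nonneg h ha m)

lemma mf_euler (α a : ℕ → ℂ) (h0 : α 0 = 1) (hs : Summable fun m => ‖mf α a m‖) :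
    Filter.Tendsto (fun N : ℕ => ∏ p ∈ N.primesBelow, ∑' e, α e * a (idx p) ^ e) Filter.atTop
      (nhds (∑' m, mf α a m)) := by
  have := EulerProduct.eulerProduct (f := mf α a) (mf_one _ _) (fun h => mf_mul α a h) hs (mf_zero _ _)
  refine this.congr fun N => Finset.prod_congr rfl fun p hp => ?_
  exact tsum_congr fun e => mf_prime_pow _ _ h0 (Nat.prime_of_mem_primesBelow hp) e

lemma idx_inj {p q : ℕ} (hp : p.Prime) (hq : q.Prime) (h : idx p = idx q) : p = q := by
  rw [← pr_idx hp, ← pr_idx hq, h]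

lemma hasSum_primes {E : Type*} [NormedAddCommGroup E] [CompleteSpace E] {a : ℕ → E} (h0 : a 0 = 0) {S : E}
    (hs : HasSum a S) : HasSum (fun p => if p.Prime then a (idx p) else 0) S := by
  have hinj : Function.Injective (fun p : Nat.Primes => idx p) := fun p q h =>
    Subtype.ext (idx_inj p.2 q.2 h)
  have h1 : HasSum (a ∘ (fun p : Nat.Primes => idx p)) S := by
    refine (hinj.hasSum_iff fun m hm => ?_).2 hs
    by_cases hm0 : m = 0
    · rw [hm0, h0]
    · exact absurd ⟨⟨pr m, pr_prime m⟩, idx_pr (by omega)⟩ hm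
  have h2 : HasSum ((fun p => a (idx p)) ∘ ((↑) : {p : ℕ | p.Prime} → ℕ)) S := h1
  have h3 := hasSum_subtype_iff_indicator.1 h2
  convert h3 using 1
  funext p
  by_cases h : p.Prime <;> simp [Set.indicator, h]

lemma tendsto_primes {E : Type*} [NormedAddCommGroup E] [CompleteSpace E] {a : ℕ → E} (h0 : a 0 = 0) {S : E}
    (hs : HasSum a S) : Filter.Tendsto (fun N : ℕ => ∑ p ∈ N.primesBelow, a (idx p)) Filter.atTop (nhds S) := by
  refine (hasSum_primes h0 hs).tendsto_sum_nat.congr fun N => ?_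
  rw [Nat.primesBelow, Finset.sum_filter]

lemma sum_primes_le {a : ℕ → ℝ} (ha : ∀ i, 0 ≤ a i) (N : ℕ) :
    ∑ p ∈ (N + 1).primesBelow, a (idx p) ≤ ∑ m ∈ Finset.range N, a m := by
  have : ∑ p ∈ (N + 1).primesBelow, a (idx p) = ∑ m ∈ ((N + 1).primesBelow).image idx, a m := by
    rw [Finset.sum_image]
    intro p hp q hq h
    exact idx_inj (Nat.prime_of_mem_primesBelow hp) (Nat.prime_of_mem_primesBelow hq) h
  rw [this]
  refine Finset.sum_le_sum_of_subset_of_nonneg ?_ fun i _ _ => ha i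
  intro m hm
  obtain ⟨p, hp, rfl⟩ := Finset.mem_image.1 hm
  have h1 := idx_lt (Nat.prime_of_mem_primesBelow hp)
  have h2 := Nat.lt_of_mem_primesBelow hp
  rw [Finset.mem_range]; omega

lemma mf_summable {α a b : ℕ → ℝ} (h0 : α 0 = 1) (h : ∀ e, 0 ≤ α e) (ha : ∀ i, 0 ≤ a i)
    (hs : ∀ i, Summable fun e => α e * a i ^ e) (hb : ∀ i, 0 ≤ b i)
    (hle : ∀ i, ∑' e, α e * a i ^ e ≤ 1 + b i) (hbs : Summable b) : Summable (mf α a) := by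
  refine summable_of_sum_range_le (c := Real.exp (∑' i, b i)) (fun m => mf_nonneg h ha m) fun N => ?_
  refine (mf_sum_le h0 h ha hs N).trans ?_
  calc ∏ p ∈ N.primesBelow, ∑' e, α e * a (idx p) ^ e
      ≤ ∏ p ∈ N.primesBelow, Real.exp (b (idx p)) := by
        refine Finset.prod_le_prod (fun p _ => tsum_nonneg fun e => mul_nonneg (h e) (pow_nonneg (ha _) _)) ?_
        intro p _
        refine (hle _).trans ?_
        rw [add_comm]; exact Real.add_one_le_exp _
    _ = Real.exp (∑ p ∈ N.primesBelow, b (idx p)) := (Real.exp_sum _ _).symm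
    _ ≤ _ := by
        rw [Real.exp_le_exp]
        have h1 : ∑ p ∈ N.primesBelow, b (idx p) ≤ ∑ p ∈ (N + 1).primesBelow, b (idx p) := by
          refine Finset.sum_le_sum_of_subset_of_nonneg ?_ fun i _ _ => hb _
          intro p hp
          exact Nat.mem_primesBelow.2 ⟨(Nat.lt_of_mem_primesBelow hp).trans (Nat.lt_succ_self _),
            Nat.prime_of_mem_primesBelow hp⟩
        exact h1.trans ((sum_primes_le hb N).trans (hbs.sum_le_tsum _ fun i _ => hb i))

noncomputable def iC (e : ℕ) : ℝ := 1 / (e.factorial : ℝ) ^ 2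

noncomputable def jC (e : ℕ) : ℝ :=
  ∑ ab ∈ Finset.HasAntidiagonal.antidiagonal e, (-1) ^ ab.1 / (ab.1.factorial : ℝ) * iC ab.2

lemma iC_zero : iC 0 = 1 := by simp [iC]

lemma jC_zero : jC 0 = 1 := by simp [jC, iC]

lemma jC_one : jC 1 = 0 := by
  simp [jC, iC, Finset.Nat.antidiagonal_succ]

lemma iC_pos (e : ℕ) : 0 < iC e := by unfold iC; positivity

lemma iC_le (e : ℕ) : iC e ≤ 1 / (e.factorial : ℝ) := by
  unfold iC
  have : (1 : ℝ) ≤ e.factorial := by exact_mod_cast Nat.one_le_iff_ne_zero.2 (Nat.factorial_ne_zero e)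
  apply one_div_le_one_div_of_le (by positivity)
  nlinarith

lemma jC_abs_le (e : ℕ) : |jC e| ≤ 2 ^ e / (e.factorial : ℝ) := by
  unfold jC
  refine (Finset.abs_sum_le_sum_abs _ _).trans ?_
  have h2 : (2 : ℝ) ^ e / (e.factorial : ℝ) = ∑ ab ∈ Finset.HasAntidiagonal.antidiagonal e,
      1 / (ab.1.factorial : ℝ) * (1 / (ab.2.factorial : ℝ)) := by
    have : (2 : ℝ) ^ e = (1 + 1) ^ e := by norm_num
    rw [this, Commute.add_pow' (Commute.all _ _), Finset.sum_div]
    refine Finset.sum_congr rfl fun ab hab => ?_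
    have hab := Finset.HasAntidiagonal.mem_antidiagonal.1 hab
    have hc : (e.choose ab.1 : ℝ) * (ab.1.factorial * ab.2.factorial) = e.factorial := by
      have := Nat.add_choose_mul_factorial_mul_factorial ab.1 ab.2
      rw [hab] at this
      have hsy : e.choose ab.1 = e.choose ab.2 := Nat.choose_symm_of_eq_add hab.symm
      rw [← this, hsy]; push_cast; ring
    have hf : (e.factorial : ℝ) ≠ 0 := by positivity
    simp only [one_pow, mul_one, nsmul_eq_mul]
    rw [← hc]
    have : (e.choose ab.1 : ℝ) ≠ 0 := by
      intro h; rw [h, zero_mul] at hc; exact hf hc.symm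
    field_simp
  rw [h2]
  refine Finset.sum_le_sum fun ab _ => ?_
  rw [abs_mul, abs_div, abs_pow, abs_neg, abs_one, one_pow, abs_of_pos (iC_pos _), Nat.abs_cast]
  exact mul_le_mul_of_nonneg_left (iC_le _) (by positivity)

lemma summable_iC (q : ℝ) : Summable fun e => iC e * |q| ^ e := by
  refine Summable.of_nonneg_of_le (fun e => mul_nonneg (iC_pos e).le (by positivity)) (fun e => ?_)
    (Real.summable_pow_div_factorial |q|)
  rw [div_eq_mul_one_div, mul_comm]
  exact mul_le_mul_of_nonneg_left (iC_le e) (by positivity)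

lemma summable_jC (q : ℝ) : Summable fun e => |jC e| * |q| ^ e := by
  refine Summable.of_nonneg_of_le (fun e => by positivity) (fun e => ?_)
    (Real.summable_pow_div_factorial (2 * |q|))
  rw [mul_pow, mul_div_right_comm]
  exact mul_le_mul_of_nonneg_right (jC_abs_le e) (by positivity)

lemma summable_iC' (q : ℂ) : Summable fun e => ‖(iC e : ℂ) * q ^ e‖ := by
  refine (summable_iC ‖q‖).congr fun e => ?_
  rw [norm_mul, norm_pow, Complex.norm_real, Real.norm_of_nonneg (iC_pos e).le, abs_norm]

lemma jC_tsum (q : ℂ) : ∑' e, (jC e : ℂ) * q ^ e = Complex.exp (-q) * ∑' e, (iC e : ℂ) * q ^ e := by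
  have h1 : Complex.exp (-q) = ∑' e : ℕ, (-q) ^ e / (e.factorial : ℂ) := by
    rw [Complex.exp_eq_exp_ℂ, NormedSpace.exp_eq_tsum_div]
  rw [h1, tsum_mul_tsum_eq_tsum_sum_antidiagonal_of_summable_norm
    (NormedSpace.norm_expSeries_div_summable (-q)) (summable_iC' q)]
  refine tsum_congr fun e => ?_
  unfold jC
  push_cast
  rw [Finset.sum_mul]
  refine Finset.sum_congr rfl fun ab hab => ?_
  rw [← Finset.HasAntidiagonal.mem_antidiagonal.1 hab, pow_add, neg_pow]
  ring

lemma jC_abs_tsum_le {q : ℝ} (h0 : 0 ≤ q) (h1 : q ≤ 1) : ∑' e, |jC e| * q ^ e ≤ 1 + 8 * q ^ 2 := by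
  have hs : Summable fun e => |jC e| * q ^ e := by simpa [abs_of_nonneg h0] using summable_jC q
  rw [← hs.sum_add_tsum_nat_add 2]
  simp only [Finset.sum_range_succ, Finset.sum_range_zero, jC_zero, jC_one]
  have hb : ∀ e, |jC (e + 2)| * q ^ (e + 2) ≤ q ^ 2 * (2 ^ (e + 2) / ((e + 2).factorial : ℝ)) := by
    intro e
    rw [mul_comm]
    refine mul_le_mul ?_ (jC_abs_le _) (abs_nonneg _) (by positivity)
    rw [pow_add]
    exact mul_le_of_le_one_left (by positivity) (pow_le_one₀ h0 h1)
  have hs2 : Summable fun e : ℕ => (2 : ℝ) ^ (e + 2) / ((e + 2).factorial : ℝ) :=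
    (summable_nat_add_iff 2).2 (Real.summable_pow_div_factorial 2)
  have h3 : ∑' e : ℕ, (2 : ℝ) ^ (e + 2) / ((e + 2).factorial : ℝ) ≤ 8 := by
    have : Real.exp 2 = ∑' e : ℕ, (2 : ℝ) ^ e / (e.factorial : ℝ) := by
      rw [Real.exp_eq_exp_ℝ, NormedSpace.exp_eq_tsum_div]
    have h4 := (Real.summable_pow_div_factorial 2).sum_add_tsum_nat_add 2
    rw [← this] at h4
    have h5 : Real.exp 2 ≤ 9 := by
      have : Real.exp 2 = Real.exp 1 * Real.exp 1 := by rw [← Real.exp_add]; norm_num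
      rw [this]
      nlinarith [Real.exp_one_lt_d9, Real.exp_pos 1]
    simp [Finset.sum_range_succ] at h4
    linarith
  have h6 : ∑' e, |jC (e + 2)| * q ^ (e + 2) ≤ q ^ 2 * 8 := by
    refine (((summable_nat_add_iff 2).2 hs).tsum_le_tsum hb (hs2.mul_left _)).trans ?_
    rw [tsum_mul_left]
    exact mul_le_mul_of_nonneg_left h3 (by positivity)
  simp
  linarith
end IsoCLT

open scoped Classical BigOperators
open MeasureTheory ProbabilityTheory

namespace IsoCLT

noncomputable abbrev om (m : ℕ) : ℕ := ArithmeticFunction.cardFactors m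

noncomputable def wt (m : ℕ) : ℝ := fold (fun m => 1 / (mfac m : ℝ) ^ 2) m

lemma wt_pos (m : ℕ) : 0 < wt m := by
  unfold wt
  induction m using Nat.strong_induction_on with
  | _ m ih =>
    rw [fold_eq]
    have := mfac_pos m
    exact mul_pos (by positivity) (Finset.prod_pos fun p hp => pow_pos (ih _ (idx_lt_of_mem hp)) _)

lemma wt_le_one (m : ℕ) : wt m ≤ 1 := by
  have h : wt m ≤ fold (fun _ => (1 : ℝ)) m := by
    refine fold_mono (fun k => by positivity) (fun k => ?_) m
    have : (1 : ℝ) ≤ mfac k := by exact_mod_cast mfac_pos k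
    rw [div_le_one (by positivity)]
    nlinarith
  rwa [fold_const, one_pow] at h

noncomputable def gam (c : ℕ → ℝ) (m : ℕ) : ℝ :=
  Multiplicative.toAdd (fold (fun m => Multiplicative.ofAdd (c (om m))) m)

lemma gam_eq (c : ℕ → ℝ) (m : ℕ) :
    gam c m = c (om m) + ∑ p ∈ m.primeFactors, m.factorization p * gam c (idx p) := by
  unfold gam
  rw [fold_eq, toAdd_mul, toAdd_prod, toAdd_ofAdd]
  congr 1
  refine Finset.sum_congr rfl fun p _ => ?_
  rw [toAdd_pow, nsmul_eq_mul]

lemma gam_abs_le {c : ℕ → ℝ} {C : ℝ} (hc : ∀ j, |c j| ≤ C) (m : ℕ) : |gam c m| ≤ C * tsize m := by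
  induction m using Nat.strong_induction_on with
  | _ m ih =>
    rw [gam_eq, tsize_eq]
    push_cast
    rw [mul_add, mul_one, Finset.mul_sum]
    refine (abs_add_le _ _).trans (add_le_add (hc _) ?_)
    refine (Finset.abs_sum_le_sum_abs _ _).trans (Finset.sum_le_sum fun p hp => ?_)
    rw [abs_mul, Nat.abs_cast]
    have := mul_le_mul_of_nonneg_left (ih _ (idx_lt_of_mem hp)) (Nat.cast_nonneg (α := ℝ) (m.factorization p))
    linarith

noncomputable def q (c : ℕ → ℝ) (x t : ℂ) (m : ℕ) : ℂ :=
  if m = 0 then 0 else (wt m : ℂ) * x ^ tsize m * Complex.exp (t * gam c m)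

noncomputable def qr (X : ℝ) (m : ℕ) : ℝ := if m = 0 then 0 else wt m * X ^ tsize m

@[simp] lemma q_zero (c : ℕ → ℝ) (x t : ℂ) : q c x t 0 = 0 := by simp [q]
@[simp] lemma qr_zero (X : ℝ) : qr X 0 = 0 := by simp [qr]

lemma wt_eq (m : ℕ) : wt m = 1 / (mfac m : ℝ) ^ 2 * ∏ p ∈ m.primeFactors, wt (idx p) ^ (m.factorization p) := by
  unfold wt; rw [fold_eq]

lemma inv_mfac (m : ℕ) : 1 / (mfac m : ℝ) ^ 2 = ∏ p ∈ m.primeFactors, iC (m.factorization p) := by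
  unfold mfac iC
  rw [Finset.prod_div_distrib, Finset.prod_const_one]
  push_cast
  rw [Finset.prod_pow]

lemma q_rec (c : ℕ → ℝ) (x t : ℂ) {m : ℕ} (hm : m ≠ 0) :
    q c x t m = x * Complex.exp (t * c (om m)) * mf (fun e => (iC e : ℂ)) (q c x t) m := by
  have h1 : mf (fun e => (iC e : ℂ)) (q c x t) m = ∏ p ∈ m.primeFactors, ((iC (m.factorization p) : ℂ) *
      ((wt (idx p) : ℂ) ^ (m.factorization p) * (x ^ (m.factorization p * tsize (idx p)) *
      Complex.exp (t * (m.factorization p * gam c (idx p)))))) := by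
    simp only [mf, hm, if_false]
    rw [Finsupp.prod]
    refine Finset.prod_congr rfl fun p hp => ?_
    have : idx p ≠ 0 := by have := idx_pos p; omega
    simp only [q, this, if_false]
    rw [mul_pow, mul_pow, ← pow_mul, ← Complex.exp_nat_mul, mul_comm (tsize _)]
    ring_nf
  rw [h1, Finset.prod_mul_distrib, Finset.prod_mul_distrib, Finset.prod_mul_distrib, Finset.prod_pow_eq_pow_sum,
    ← Complex.exp_sum]
  simp only [q, hm, if_false]
  rw [wt_eq, inv_mfac, gam_eq, tsize_eq, pow_add, pow_one]
  push_cast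
  rw [mul_add, Complex.exp_add, Finset.mul_sum]
  ring

lemma q_ofReal (c : ℕ → ℝ) (X : ℝ) (m : ℕ) : q c X 0 m = (qr X m : ℂ) := by
  unfold q qr
  by_cases hm : m = 0 <;> simp [hm]

lemma qr_rec (X : ℝ) {m : ℕ} (hm : m ≠ 0) : qr X m = X * mf iC (qr X) m := by
  have := q_rec (fun _ => 0) X 0 hm
  have h2 : q (fun _ => 0) (X : ℂ) 0 = fun i => (qr X i : ℂ) := funext fun i => q_ofReal _ X i
  rw [h2] at this
  rw [← ofReal_mf] at this
  simp only [zero_mul, Complex.exp_zero, mul_one] at this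
  exact_mod_cast this

lemma qr_nonneg {X : ℝ} (hX : 0 ≤ X) (m : ℕ) : 0 ≤ qr X m := by
  unfold qr; split_ifs
  · exact le_rfl
  · have := wt_pos m; positivity

lemma qr_mono {X Y : ℝ} (hX : 0 ≤ X) (hXY : X ≤ Y) (m : ℕ) : qr X m ≤ qr Y m := by
  unfold qr; split_ifs
  · exact le_rfl
  · exact mul_le_mul_of_nonneg_left (pow_le_pow_left₀ hX hXY _) (wt_pos m).le

lemma qr_le_one {X : ℝ} (hX : 0 ≤ X) (hX1 : X ≤ 1) (m : ℕ) : qr X m ≤ 1 := by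
  unfold qr; split_ifs
  · exact zero_le_one
  · exact mul_le_one₀ (wt_le_one m) (by positivity) (pow_le_one₀ hX hX1)

lemma qr_sq_le {X : ℝ} (hX : 0 ≤ X) (m : ℕ) : qr X m ^ 2 ≤ qr (X ^ 2) m := by
  unfold qr; split_ifs
  · simp
  · rw [mul_pow, ← pow_mul, ← pow_mul, mul_comm 2]
    refine mul_le_mul_of_nonneg_right ?_ (by positivity)
    nlinarith [wt_pos m, wt_le_one m]

lemma norm_q_le {c : ℕ → ℝ} {C : ℝ} (hc : ∀ j, |c j| ≤ C) (x t : ℂ) (m : ℕ) :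
    ‖q c x t m‖ ≤ qr (‖x‖ * Real.exp (C * ‖t‖)) m := by
  unfold q qr; split_ifs
  · simp
  · rw [norm_mul, norm_mul, norm_pow, Complex.norm_real, Real.norm_of_nonneg (wt_pos m).le, Complex.norm_exp,
      mul_pow, ← Real.exp_nat_mul, mul_assoc]
    refine mul_le_mul_of_nonneg_left (mul_le_mul_of_nonneg_left ?_ (by positivity)) (wt_pos m).le
    rw [Real.exp_le_exp]
    refine (Complex.re_le_norm _).trans ?_
    rw [norm_mul, Complex.norm_real, Real.norm_eq_abs]
    nlinarith [gam_abs_le hc m, norm_nonneg t]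

lemma qr_one (X : ℝ) : qr X 1 = X := by
  rw [qr_rec _ one_ne_zero]; simp

lemma idx_two : idx 2 = 1 := by
  have h : Nat.count Nat.Prime 2 = 0 := by
    rw [Nat.count_succ, Nat.count_succ]; simp [Nat.not_prime_zero, Nat.not_prime_one]
  unfold idx; rw [h]

lemma qr_two (X : ℝ) : qr X 2 = X ^ 2 := by
  rw [qr_rec _ two_ne_zero]
  have := mf_prime_pow iC (qr X) iC_zero Nat.prime_two 1
  rw [pow_one, idx_two, qr_one] at this
  rw [this]; simp [iC]; ring

lemma pow_unique {C : ℕ → ℂ} (hs : Summable fun j => ‖C j‖)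
    (h : ∀ s : ℂ, ‖s‖ < 1 → ∑' j, C j * s ^ j = 0) : ∀ j, C j = 0 := by
  intro j
  induction j using Nat.strong_induction_on with
  | _ j ih =>
  have hs' : Summable fun i => ‖C (i + j)‖ := (summable_nat_add_iff j).2 hs
  have key : ∀ s : ℂ, ‖s‖ < 1 → s ≠ 0 → ∑' i, C (i + j) * s ^ i = 0 := by
    intro s hs1 hs0
    have hsum : Summable fun i => C i * s ^ i := by
      refine Summable.of_norm_bounded hs fun i => ?_
      rw [norm_mul, norm_pow]
      exact mul_le_of_le_one_right (norm_nonneg _) (pow_le_one₀ (norm_nonneg _) hs1.le)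
    have h1 := hsum.sum_add_tsum_nat_add j
    rw [h s hs1, Finset.sum_eq_zero fun i hi => by rw [ih i (Finset.mem_range.1 hi), zero_mul], zero_add] at h1
    have h2 : ∑' i, C (i + j) * s ^ (i + j) = s ^ j * ∑' i, C (i + j) * s ^ i := by
      rw [← tsum_mul_left]
      exact tsum_congr fun i => by rw [pow_add]; ring
    rw [h2] at h1
    exact (mul_eq_zero.1 h1).resolve_left (pow_ne_zero _ hs0)
  have hcont : ContinuousOn (fun s : ℂ => ∑' i, C (i + j) * s ^ i) (Metric.ball 0 1) := by
    refine continuousOn_tsum (fun i => by fun_prop) hs' fun i s hs1 => ?_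
    rw [norm_mul, norm_pow]
    exact mul_le_of_le_one_right (norm_nonneg _) (pow_le_one₀ (norm_nonneg _) (by simpa using (mem_ball_zero_iff.1 hs1).le))
  have h0 : Filter.Tendsto (fun s : ℂ => ∑' i, C (i + j) * s ^ i) (nhdsWithin 0 {0}ᶜ) (nhds (C j)) := by
    have h1 : ContinuousAt (fun s : ℂ => ∑' i, C (i + j) * s ^ i) 0 :=
      hcont.continuousAt (Metric.ball_mem_nhds _ one_pos)
    have h2 : ∑' i, C (i + j) * (0 : ℂ) ^ i = C j := by
      rw [tsum_eq_single 0 fun i hi => by simp [hi]]; simp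
    have h3 := h1.tendsto
    simp only [h2] at h3
    exact h3.mono_left nhdsWithin_le_nhds
  have h1 : Filter.Tendsto (fun s : ℂ => ∑' i, C (i + j) * s ^ i) (nhdsWithin 0 {0}ᶜ) (nhds 0) := by
    refine tendsto_const_nhds.congr' ?_
    have : ∀ᶠ s : ℂ in nhdsWithin 0 {0}ᶜ, s ∈ Metric.ball (0 : ℂ) 1 :=
      nhdsWithin_le_nhds (Metric.ball_mem_nhds _ one_pos)
    filter_upwards [this, self_mem_nhdsWithin] with s hs1 hs2
    exact (key s (mem_ball_zero_iff.1 hs1) hs2).symm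
  exact tendsto_nhds_unique h0 h1

lemma tsum_fiber {ι : Type*} {a : ι → ℂ} (ha : Summable fun i => ‖a i‖) (ω : ι → ℕ) :
    (Summable fun j => ‖∑' i : {i // ω i = j}, a i‖) ∧
    ∀ g : ℕ → ℂ, (∃ B, ∀ j, ‖g j‖ ≤ B) → ∑' i, g (ω i) * a i = ∑' j, g j * ∑' i : {i // ω i = j}, a i := by
  have key : ∀ {b : ι → ℂ}, (Summable b) → HasSum (fun j => ∑' i : {i // ω i = j}, b i) (∑' i, b i) := by
    intro b hb
    have h1 : HasSum (b ∘ (Equiv.sigmaFiberEquiv ω)) (∑' i, b i) :=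
      (Equiv.hasSum_iff _).2 hb.hasSum
    refine h1.sigma fun j => ?_
    exact (hb.comp_injective Subtype.val_injective).hasSum
  refine ⟨?_, ?_⟩
  · have h2 : HasSum (fun j => ∑' i : {i // ω i = j}, ‖a i‖) (∑' i, ‖a i‖) := by
      have h1 : HasSum ((fun i => ‖a i‖) ∘ (Equiv.sigmaFiberEquiv ω)) (∑' i, ‖a i‖) :=
        (Equiv.hasSum_iff _).2 ha.hasSum
      refine h1.sigma fun j => ?_
      exact (ha.comp_injective Subtype.val_injective).hasSum
    refine Summable.of_nonneg_of_le (fun _ => norm_nonneg _) (fun j => ?_) h2.summable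
    exact norm_tsum_le_tsum_norm (ha.comp_injective Subtype.val_injective)
  · rintro g ⟨B, hB⟩
    have hs : Summable fun i => g (ω i) * a i := by
      refine Summable.of_norm_bounded (ha.mul_left B) fun i => ?_
      rw [norm_mul]
      exact mul_le_mul_of_nonneg_right (hB _) (norm_nonneg _)
    rw [← (key hs).tsum_eq]
    refine tsum_congr fun j => ?_
    rw [← tsum_mul_left]
    exact tsum_congr fun i => by rw [i.2]

lemma fiber_transfer {ι κ : Type*} {a : ι → ℂ} {b : κ → ℂ} (ha : Summable fun i => ‖a i‖)
    (hb : Summable fun i => ‖b i‖) (ω : ι → ℕ) (ω' : κ → ℕ)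
    (h : ∀ s : ℂ, ‖s‖ < 1 → ∑' i, s ^ ω i * a i = ∑' k, s ^ ω' k * b k)
    (g : ℕ → ℂ) (hg : ∃ B, ∀ j, ‖g j‖ ≤ B) : ∑' i, g (ω i) * a i = ∑' k, g (ω' k) * b k := by
  obtain ⟨ha1, ha2⟩ := tsum_fiber ha ω
  obtain ⟨hb1, hb2⟩ := tsum_fiber hb ω'
  have key : ∀ j, (∑' i : {i // ω i = j}, a i) - ∑' k : {k // ω' k = j}, b k = 0 := by
    refine pow_unique ?_ fun s hs => ?_
    · refine Summable.of_nonneg_of_le (fun _ => norm_nonneg _) (fun j => norm_sub_le _ _) (ha1.add hb1)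
    · have hbd : ∃ B, ∀ j, ‖s ^ j‖ ≤ B := ⟨1, fun j => by
        rw [norm_pow]; exact pow_le_one₀ (norm_nonneg _) hs.le⟩
      have h1 := h s hs
      rw [ha2 (fun j => s ^ j) hbd, hb2 (fun j => s ^ j) hbd] at h1
      have hsm : ∀ {A : ℕ → ℂ}, (Summable fun j => ‖A j‖) → Summable fun j => s ^ j * A j := by
        intro A hA
        refine Summable.of_norm_bounded hA fun j => ?_
        rw [norm_mul, norm_pow]
        exact mul_le_of_le_one_left (norm_nonneg _) (pow_le_one₀ (norm_nonneg _) hs.le)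
      rw [← sub_eq_zero, ← (hsm ha1).tsum_sub (hsm hb1)] at h1
      rw [← h1]
      exact tsum_congr fun j => by ring
  rw [ha2 g hg, hb2 g hg]
  exact tsum_congr fun j => by rw [sub_eq_zero.1 (key j)]

end IsoCLT

open scoped Classical BigOperators
open MeasureTheory ProbabilityTheory

namespace IsoCLT

noncomputable abbrev fI (a : ℕ → ℂ) : ℕ → ℂ := mf (fun e => (iC e : ℂ)) a
noncomputable abbrev hJ (a : ℕ → ℂ) : ℕ → ℂ := mf (fun e => (jC e : ℂ)) a

lemma norm_fI (a : ℕ → ℂ) (m : ℕ) : ‖fI a m‖ = mf iC (fun i => ‖a i‖) m := by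
  rw [fI, norm_mf]
  congr 1
  funext e
  rw [Complex.norm_real, Real.norm_of_nonneg (iC_pos e).le]

lemma norm_hJ (a : ℕ → ℂ) (m : ℕ) : ‖hJ a m‖ = mf (fun e => |jC e|) (fun i => ‖a i‖) m := by
  rw [hJ, norm_mf]
  congr 1
  funext e
  rw [Complex.norm_real, Real.norm_eq_abs]

lemma iC_tsum_le {x : ℝ} (hx : 0 ≤ x) : ∑' e, iC e * x ^ e ≤ Real.exp x := by
  have hs := summable_iC x
  rw [abs_of_nonneg hx] at hs
  rw [Real.exp_eq_exp_ℝ, NormedSpace.exp_eq_tsum_div]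
  refine hs.tsum_le_tsum (fun e => ?_) (Real.summable_pow_div_factorial x)
  rw [div_eq_mul_one_div, mul_comm]
  exact mul_le_mul_of_nonneg_left (iC_le e) (by positivity)

lemma summable_mf_iC {a : ℕ → ℝ} (h0 : ∀ i, 0 ≤ a i) (hs : Summable a) : Summable (mf iC a) := by
  refine mf_summable (b := fun i => a i * Real.exp (∑' i, a i)) iC_zero (fun e => (iC_pos e).le) h0
    (fun i => by simpa [abs_of_nonneg (h0 i)] using summable_iC (a i)) (fun i => by have := h0 i; positivity)
    (fun i => ?_) (hs.mul_right _)
  refine (iC_tsum_le (h0 i)).trans ?_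
  have h1 : Real.exp (a i) ≤ Real.exp (∑' i, a i) := by
    rw [Real.exp_le_exp]; exact hs.le_tsum i fun j _ => h0 j
  have h2 : 1 - a i ≤ Real.exp (-a i) := by linarith [Real.add_one_le_exp (-a i)]
  have h3 : Real.exp (a i) * Real.exp (-a i) = 1 := by rw [← Real.exp_add]; simp
  nlinarith [h0 i, Real.exp_pos (a i)]

lemma summable_mf_jC {a : ℕ → ℝ} (h0 : ∀ i, 0 ≤ a i) (h1 : ∀ i, a i ≤ 1) (hs : Summable fun i => a i ^ 2) :
    Summable (mf (fun e => |jC e|) a) := by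
  refine mf_summable (b := fun i => 8 * a i ^ 2) (by simp [jC_zero]) (fun e => abs_nonneg _) h0
    (fun i => by simpa [abs_of_nonneg (h0 i)] using summable_jC (a i)) (fun i => by positivity)
    (fun i => jC_abs_tsum_le (h0 i) (h1 i)) (hs.mul_left _)

lemma summable_fI {a : ℕ → ℂ} (hs : Summable fun i => ‖a i‖) : Summable fun m => ‖fI a m‖ := by
  simp only [norm_fI]; exact summable_mf_iC (fun i => norm_nonneg _) hs

lemma summable_sq_of {a : ℕ → ℝ} (h0 : ∀ i, 0 ≤ a i) (h1 : ∀ i, a i ≤ 1) (hs : Summable a) :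
    Summable fun i => a i ^ 2 :=
  Summable.of_nonneg_of_le (fun i => by positivity) (fun i => by nlinarith [h0 i, h1 i]) hs

lemma summable_hJ {a : ℕ → ℂ} (h1 : ∀ i, ‖a i‖ ≤ 1) (hs : Summable fun i => ‖a i‖) :
    Summable fun m => ‖hJ a m‖ := by
  simp only [norm_hJ]
  exact summable_mf_jC (fun i => norm_nonneg _) h1 (summable_sq_of (fun i => norm_nonneg _) h1 hs)

lemma euler_exp {a : ℕ → ℂ} (ha0 : a 0 = 0) (h1 : ∀ i, ‖a i‖ ≤ 1) (hs : Summable fun i => ‖a i‖) :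
    ∑' m, fI a m = Complex.exp (∑' i, a i) * ∑' m, hJ a m := by
  have e1 := mf_euler (fun e => (iC e : ℂ)) a (by simp [iC_zero]) (summable_fI hs)
  have e2 := mf_euler (fun e => (jC e : ℂ)) a (by simp [jC_zero]) (summable_hJ h1 hs)
  have e3 := (Complex.continuous_exp.tendsto _).comp (tendsto_primes ha0 hs.of_norm.hasSum)
  refine tendsto_nhds_unique e1 ((e3.mul e2).congr fun N => ?_)
  simp only [Function.comp]
  rw [Complex.exp_sum, ← Finset.prod_mul_distrib]
  refine Finset.prod_congr rfl fun p _ => ?_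
  rw [jC_tsum, ← mul_assoc, ← Complex.exp_add]; simp

lemma summable_pair {T : ℂ} {h : ℕ → ℂ} (hh : Summable fun m => ‖h m‖) :
    Summable fun k : ℕ × ℕ => ‖T ^ k.1 / (k.1.factorial : ℂ) * h k.2‖ := by
  refine ((NormedSpace.norm_expSeries_div_summable T).mul_of_nonneg hh (fun _ => norm_nonneg _)
    (fun _ => norm_nonneg _)).congr fun k => ?_
  rw [norm_mul]

lemma main_identity1 {a : ℕ → ℂ} (ha0 : a 0 = 0) (h1 : ∀ i, ‖a i‖ ≤ 1) (hs : Summable fun i => ‖a i‖)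
    (s : ℂ) (hs1 : ‖s‖ < 1) : ∑' m, s ^ om m * fI a m =
      ∑' k : ℕ × ℕ, s ^ (k.1 + om k.2) * ((∑' i, a i) ^ k.1 / (k.1.factorial : ℂ) * hJ a k.2) := by
  have hsa : Summable fun i => ‖s * a i‖ := by
    refine Summable.of_nonneg_of_le (fun _ => norm_nonneg _) (fun i => ?_) hs
    rw [norm_mul]; exact mul_le_of_le_one_left (norm_nonneg _) hs1.le
  have hsa1 : ∀ i, ‖s * a i‖ ≤ 1 := fun i => by
    rw [norm_mul]; exact mul_le_one₀ hs1.le (norm_nonneg _) (h1 i)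
  have e := euler_exp (a := fun i => s * a i) (by simp [ha0]) hsa1 hsa
  have e1 : ∀ m, s ^ om m * fI a m = fI (fun i => s * a i) m := fun m => (mf_smul _ _ _ _).symm
  have e2 : ∀ m, s ^ om m * hJ a m = hJ (fun i => s * a i) m := fun m => (mf_smul _ _ _ _).symm
  have e3 : Complex.exp (∑' i, s * a i) * ∑' m, hJ (fun i => s * a i) m =
      ∑' k : ℕ × ℕ, (∑' i, s * a i) ^ k.1 / (k.1.factorial : ℂ) * hJ (fun i => s * a i) k.2 := by
    rw [Complex.exp_eq_exp_ℂ, NormedSpace.exp_eq_tsum_div]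
    exact tsum_mul_tsum_of_summable_norm (NormedSpace.norm_expSeries_div_summable _) (summable_hJ hsa1 hsa)
  rw [tsum_congr e1, e, e3]
  refine tsum_congr fun k => ?_
  rw [← e2 k.2, tsum_mul_left, pow_add, mul_pow]
  ring

lemma main_identity {a : ℕ → ℂ} (ha0 : a 0 = 0) (h1 : ∀ i, ‖a i‖ ≤ 1) (hs : Summable fun i => ‖a i‖)
    (g : ℕ → ℂ) (hg : ∃ B, ∀ j, ‖g j‖ ≤ B) :
    ∑' m, g (om m) * fI a m = ∑' k : ℕ × ℕ, g (k.1 + om k.2) * ((∑' i, a i) ^ k.1 / (k.1.factorial : ℂ) * hJ a k.2) :=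
  fiber_transfer (a := fI a)
      (b := fun k : ℕ × ℕ => (∑' i, a i) ^ k.1 / (k.1.factorial : ℂ) * hJ a k.2)
      (summable_fI hs) (summable_pair (summable_hJ h1 hs)) om (fun k => k.1 + om k.2)
      (main_identity1 ha0 h1 hs) g hg

noncomputable def Ssum (c : ℕ → ℝ) (k : ℕ) (x w t : ℂ) : ℂ :=
  ∑' p : ℕ × ℕ, w ^ p.1 / (p.1.factorial : ℂ) * Complex.exp (t * c (p.1 + k + om p.2)) * hJ (q c x t) p.2

lemma T_eq {c : ℕ → ℝ} {C : ℝ} (hc : ∀ j, |c j| ≤ C) (x t : ℂ) {X : ℝ} (hX : ‖x‖ * Real.exp (C * ‖t‖) ≤ X)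
    (hX1 : X ≤ 1) (hs : Summable (qr X)) :
    ∑' m, q c x t m = x * Ssum c 0 x (∑' m, q c x t m) t := by
  have hn : ∀ m, ‖q c x t m‖ ≤ qr X m := fun m => (norm_q_le hc x t m).trans (qr_mono (by positivity) hX m)
  have hX0 : 0 ≤ X := le_trans (by positivity) hX
  have hq : Summable fun m => ‖q c x t m‖ := Summable.of_nonneg_of_le (fun _ => norm_nonneg _) hn hs
  have hb : ∃ B, ∀ j, ‖Complex.exp (t * c j)‖ ≤ B := ⟨Real.exp (‖t‖ * C), fun j => by
    rw [Complex.norm_exp, Real.exp_le_exp]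
    refine (Complex.re_le_norm _).trans ?_
    rw [norm_mul, Complex.norm_real, Real.norm_eq_abs]
    exact mul_le_mul_of_nonneg_left (hc j) (norm_nonneg _)⟩
  have e := main_identity (q_zero c x t) (fun m => (hn m).trans (qr_le_one hX0 hX1 m)) hq
    (fun j => Complex.exp (t * c j)) hb
  have e1 : ∑' m, q c x t m = x * ∑' m, Complex.exp (t * c (om m)) * fI (q c x t) m := by
    rw [← tsum_mul_left]
    refine tsum_congr fun m => ?_
    by_cases hm : m = 0
    · simp [hm]
    · rw [q_rec c x t hm]; ring
  rw [Ssum]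
  nth_rewrite 1 [e1]
  rw [e]
  congr 1
  refine tsum_congr fun p => ?_
  rw [add_zero]; ring

noncomputable def Tn (X : ℝ) (N : ℕ) : ℝ := ∑ m ∈ Finset.range N, qr X m

noncomputable def Jr (x : ℝ) : ℝ := Real.exp (-x) * ∑' e, iC e * x ^ e

lemma Jr_nonneg {x : ℝ} (hx : 0 ≤ x) : 0 ≤ Jr x :=
  mul_nonneg (Real.exp_pos _).le (tsum_nonneg fun e => mul_nonneg (iC_pos e).le (by positivity))

lemma Jr_le_one {x : ℝ} (hx : 0 ≤ x) : Jr x ≤ 1 := by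
  unfold Jr
  have := mul_le_mul_of_nonneg_left (iC_tsum_le hx) (Real.exp_pos (-x)).le
  rwa [← Real.exp_add, neg_add_cancel, Real.exp_zero] at this

lemma Jr_cont : Continuous Jr := by
  unfold Jr
  refine (Real.continuous_exp.comp continuous_neg).mul ?_
  rw [← continuousOn_univ]
  refine continuousOn_of_forall_continuousAt fun x _ => ?_
  have : ContinuousOn (fun x : ℝ => ∑' e, iC e * x ^ e) (Metric.ball 0 (|x| + 1)) := by
    refine continuousOn_tsum (u := fun e => iC e * |(|x| + 1)| ^ e) (fun e => by fun_prop) (summable_iC _) fun e y hy => ?_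
    rw [norm_mul, norm_pow, Real.norm_of_nonneg (iC_pos e).le]
    refine mul_le_mul_of_nonneg_left (pow_le_pow_left₀ (norm_nonneg _) ?_ _) (iC_pos e).le
    rw [abs_of_nonneg (by positivity)]
    simpa using (mem_ball_zero_iff.1 hy).le
  exact this.continuousAt (Metric.isOpen_ball.mem_nhds (by simp))

lemma iC_tsum_eq (x : ℝ) : ∑' e, iC e * x ^ e = Real.exp x * Jr x := by
  unfold Jr; rw [← mul_assoc, ← Real.exp_add]; simp

lemma Tn_step {X : ℝ} (hX : 0 ≤ X) {M N : ℕ} (hM : M ≤ N + 1) :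
    Tn X (N + 1) ≤ X * (Real.exp (Tn X N) * ∏ p ∈ M.primesBelow, Jr (qr X (idx p))) := by
  have h1 : Tn X (N + 1) ≤ X * ∑ m ∈ Finset.range (N + 1), mf iC (qr X) m := by
    rw [Tn, Finset.mul_sum]
    refine Finset.sum_le_sum fun m _ => ?_
    by_cases hm : m = 0
    · simp [hm]
    · rw [qr_rec X hm]
  refine h1.trans (mul_le_mul_of_nonneg_left ?_ hX)
  refine (mf_sum_le iC_zero (fun e => (iC_pos e).le) (qr_nonneg hX) (fun i => by
    simpa [abs_of_nonneg (qr_nonneg hX i)] using summable_iC (qr X i)) (N + 1)).trans ?_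
  simp only [iC_tsum_eq]
  rw [Finset.prod_mul_distrib, ← Real.exp_sum]
  refine mul_le_mul ?_ ?_ (Finset.prod_nonneg fun p _ => Jr_nonneg (qr_nonneg hX _)) (Real.exp_pos _).le
  · rw [Real.exp_le_exp]; exact sum_primes_le (qr_nonneg hX) N
  · refine Finset.prod_le_prod_of_subset_of_le_one ?_ ?_ ?_
    · intro p hp
      exact Nat.mem_primesBelow.2 ⟨(Nat.lt_of_mem_primesBelow hp).trans_le hM, Nat.prime_of_mem_primesBelow hp⟩
    · intro p _; exact Jr_nonneg (qr_nonneg hX _)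
    · intro p _ _; exact Jr_le_one (qr_nonneg hX _)

def Rset : Set ℝ := {X | 0 ≤ X ∧ ∀ N, Tn X N ≤ 1}

noncomputable def rho : ℝ := sSup Rset

lemma Rset_bdd {X : ℝ} (h : X ∈ Rset) : X < 5 / 8 := by
  have := h.2 3
  simp [Tn, Finset.sum_range_succ, qr_one, qr_two] at this
  by_contra h2
  nlinarith [h.1]

lemma Rset_mem : Real.exp (-1) ∈ Rset := by
  refine ⟨(Real.exp_pos _).le, fun N => ?_⟩
  induction N with
  | zero => simp [Tn]
  | succ N ih =>
    refine (Tn_step (M := 0) (Real.exp_pos _).le (Nat.zero_le _)).trans ?_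
    simp only [Nat.primesBelow_zero, Finset.prod_empty, mul_one]
    rw [← Real.exp_add, Real.exp_le_one_iff]; linarith

lemma qr_cont (m : ℕ) : Continuous fun X => qr X m := by
  unfold qr; split_ifs <;> fun_prop

lemma Tn_cont (N : ℕ) : Continuous fun X => Tn X N := by
  unfold Tn; exact continuous_finsetSum _ fun m _ => qr_cont m

lemma Rset_closed : IsClosed Rset := by
  have : Rset = Set.Ici 0 ∩ ⋂ N, {X | Tn X N ≤ 1} := by ext X; simp [Rset]
  rw [this]
  exact isClosed_Ici.inter (isClosed_iInter fun N => isClosed_le (Tn_cont N) continuous_const)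

lemma bddAbove_Rset : BddAbove Rset := ⟨5 / 8, fun _ h => (Rset_bdd h).le⟩

lemma rho_mem : rho ∈ Rset := Rset_closed.csSup_mem ⟨_, Rset_mem⟩ bddAbove_Rset

lemma rho_pos : 0 < rho := (Real.exp_pos (-1)).trans_le (le_csSup bddAbove_Rset Rset_mem)

lemma rho_lt : rho < 5 / 8 := Rset_bdd rho_mem

lemma summable_qr_rho : Summable (qr rho) :=
  summable_of_sum_range_le (fun m => qr_nonneg rho_pos.le m) rho_mem.2

lemma tsum_qr_rho_le : ∑' m, qr rho m ≤ 1 := Real.tsum_le_of_sum_range_le (fun m => qr_nonneg rho_pos.le m) rho_mem.2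

lemma tsum_qr_rho : ∑' m, qr rho m = 1 := by
  by_contra hne
  set T := ∑' m, qr rho m with hT
  have hT1 : T < 1 := lt_of_le_of_ne tsum_qr_rho_le hne
  have hT0 : 0 ≤ T := tsum_nonneg fun m => qr_nonneg rho_pos.le m
  obtain ⟨w, hw, hw1⟩ := exists_between hT1
  have hmono : T * Real.exp (-T) < w * Real.exp (-w) := by
    have h1 : 1 - (w - T) < Real.exp (-(w - T)) := by
      linarith [Real.add_one_lt_exp (x := -(w - T)) (by linarith)]
    have h2 : Real.exp (-w) = Real.exp (-T) * Real.exp (-(w - T)) := by rw [← Real.exp_add]; ring_nf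
    rw [h2]
    have h3 : T < w * Real.exp (-(w - T)) := by nlinarith
    nlinarith [Real.exp_pos (-T)]
  have htd := tendsto_primes (qr_zero rho) summable_qr_rho.hasSum
  have htd2 : Filter.Tendsto (fun N : ℕ => T * Real.exp (-∑ p ∈ N.primesBelow, qr rho (idx p))) Filter.atTop
      (nhds (T * Real.exp (-T))) :=
    ((Real.continuous_exp.tendsto _).comp htd.neg).const_mul T
  obtain ⟨M, hM⟩ := (htd2.eventually (gt_mem_nhds hmono)).exists
  have hprod : rho * ∏ p ∈ M.primesBelow, Jr (qr rho (idx p)) < w * Real.exp (-w) := by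
    refine lt_of_le_of_lt ?_ hM
    have h1 := mf_prod_le iC_zero (fun e => (iC_pos e).le) (qr_nonneg rho_pos.le)
      (summable_mf_iC (qr_nonneg rho_pos.le) summable_qr_rho) M
    simp only [iC_tsum_eq] at h1
    rw [Finset.prod_mul_distrib, ← Real.exp_sum] at h1
    have h2 : T = rho * ∑' m, mf iC (qr rho) m := by
      rw [hT, ← tsum_mul_left]
      refine tsum_congr fun m => ?_
      by_cases hm : m = 0
      · simp [hm]
      · exact qr_rec rho hm
    have h3 := mul_le_mul_of_nonneg_left h1 rho_pos.le
    rw [← h2] at h3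
    have h4 := mul_le_mul_of_nonneg_right h3 (Real.exp_pos (-∑ p ∈ M.primesBelow, qr rho (idx p))).le
    refine le_trans (le_of_eq ?_) h4
    have h5 := Real.exp_ne_zero (∑ p ∈ M.primesBelow, qr rho (idx p))
    rw [Real.exp_neg]
    field_simp
  have hTM : Tn rho M < w := lt_of_le_of_lt (summable_qr_rho.sum_le_tsum _ fun m _ => qr_nonneg rho_pos.le m) hw
  have hc1 : Continuous fun X => X * ∏ p ∈ M.primesBelow, Jr (qr X (idx p)) :=
    continuous_id.mul (continuous_finsetProd _ fun p _ => Jr_cont.comp (qr_cont _))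
  have ev : ∀ᶠ X in nhds rho, X * (∏ p ∈ M.primesBelow, Jr (qr X (idx p))) < w * Real.exp (-w) ∧ Tn X M < w :=
    (hc1.continuousAt.eventually (gt_mem_nhds hprod)).and ((Tn_cont M).continuousAt.eventually (gt_mem_nhds hTM))
  obtain ⟨X, ⟨hX1, hX2⟩, hX⟩ := ((ev.filter_mono nhdsWithin_le_nhds).and
    (self_mem_nhdsWithin : ∀ᶠ X in nhdsWithin rho (Set.Ioi rho), X ∈ Set.Ioi rho)).exists
  have hX : rho < X := hX
  have hX0 : 0 ≤ X := rho_pos.le.trans hX.le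
  have hmonoN : ∀ {a b : ℕ}, a ≤ b → Tn X a ≤ Tn X b := fun {a b} hab =>
    Finset.sum_le_sum_of_subset_of_nonneg (Finset.range_mono hab) fun i _ _ => qr_nonneg hX0 i
  have hind : ∀ k, Tn X (M + k) ≤ w := by
    intro k
    induction k with
    | zero => exact hX2.le
    | succ k ih =>
      refine (Tn_step (M := M) hX0 (N := M + k) (by omega)).trans ?_
      have h1 : Real.exp (Tn X (M + k)) ≤ Real.exp w := Real.exp_le_exp.2 ih
      have h2 : 0 ≤ X * ∏ p ∈ M.primesBelow, Jr (qr X (idx p)) :=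
        mul_nonneg hX0 (Finset.prod_nonneg fun p _ => Jr_nonneg (qr_nonneg hX0 _))
      calc X * (Real.exp (Tn X (M + k)) * ∏ p ∈ M.primesBelow, Jr (qr X (idx p)))
          = Real.exp (Tn X (M + k)) * (X * ∏ p ∈ M.primesBelow, Jr (qr X (idx p))) := by ring
        _ ≤ Real.exp w * (w * Real.exp (-w)) := mul_le_mul h1 hX1.le h2 (Real.exp_pos _).le
        _ = w := by rw [mul_left_comm, ← Real.exp_add]; simp
  have hXm : X ∈ Rset := ⟨hX0, fun N => (hmonoN (Nat.le_add_left N M)).trans ((hind N).trans hw1.le)⟩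
  exact absurd (le_csSup bddAbove_Rset hXm) (not_le.2 hX)

end IsoCLT

open scoped Classical BigOperators ContDiff
open MeasureTheory ProbabilityTheory

namespace IsoCLT

lemma norm_fderiv_le_of_ball {E G : Type} [NormedAddCommGroup E] [NormedSpace ℂ E]
    [NormedAddCommGroup G] [NormedSpace ℂ G] {f : E → G} (hf : Differentiable ℂ f) {y : E} {r u : ℝ} (hr : 0 < r)
    (hu : ∀ z ∈ Metric.closedBall y r, ‖f z‖ ≤ u) : ‖fderiv ℂ f y‖ ≤ u / r := by
  have hu0 : 0 ≤ u := (norm_nonneg _).trans (hu y (Metric.mem_closedBall_self hr.le))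
  refine ContinuousLinearMap.opNorm_le_bound _ (by positivity) fun v => ?_
  by_cases hv : v = 0
  · simp [hv]
  have hv0 : 0 < ‖v‖ := norm_pos_iff.2 hv
  have hline : HasDerivAt (fun s : ℂ => y + s • v) v 0 := by
    simpa using ((hasDerivAt_id (0 : ℂ)).smul_const v).const_add y
  have hd : HasDerivAt (fun s : ℂ => f (y + s • v)) (fderiv ℂ f y v) 0 := by
    have h1 : HasFDerivAt f (fderiv ℂ f y) (y + (0 : ℂ) • v) := by
      simpa using (hf y).hasFDerivAt
    exact h1.comp_hasDerivAt (0 : ℂ) hline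
  have hdiff : Differentiable ℂ (fun s : ℂ => f (y + s • v)) := by fun_prop
  have := Complex.norm_deriv_le_of_forall_mem_sphere_norm_le (c := 0) (R := r / ‖v‖) (C := u)
    (f := fun s : ℂ => f (y + s • v)) (by positivity) hdiff.diffContOnCl (fun z hz => by
      apply hu
      rw [mem_closedBall_iff_norm]
      have : ‖z‖ = r / ‖v‖ := by simpa using hz
      simp only [add_sub_cancel_left, norm_smul, this]
      rw [div_mul_cancel₀ _ hv0.ne'])
  rw [hd.deriv] at this
  refine this.trans (le_of_eq ?_)
  field_simp

lemma contDiffOn_tsum_aux {E : Type} [NormedAddCommGroup E] [NormedSpace ℂ E] {ι : Type} (p : E) (k : ℕ) :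
    ∀ {G : Type} [NormedAddCommGroup G] [NormedSpace ℂ G] [CompleteSpace G] (f : ι → E → G)
    (_ : ∀ i, ContDiff ℂ ∞ (f i)) (u : ι → ℝ) (_ : Summable u) (R : ℝ) (_ : 0 < R)
    (_ : ∀ i, ∀ y ∈ Metric.ball p R, ‖f i y‖ ≤ u i),
    ContDiffOn ℂ k (fun y => ∑' i, f i y) (Metric.ball p (R / 2 ^ k)) := by
  induction k with
  | zero =>
    intro G _ _ _ f hf u hu R hR hb
    simp only [pow_zero, div_one, Nat.cast_zero, contDiffOn_zero]
    exact continuousOn_tsum (fun i => (hf i).continuous.continuousOn) hu fun i y hy => hb i y hy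
  | succ k ih =>
    intro G _ _ _ f hf u hu R hR hb
    have hsub : Metric.ball p (R / 2 ^ (k + 1)) ⊆ Metric.ball p (R / 2) := by
      apply Metric.ball_subset_ball
      rw [pow_succ]
      apply div_le_div_of_nonneg_left hR.le (by norm_num)
      have : (1 : ℝ) ≤ 2 ^ k := one_le_pow₀ (by norm_num)
      linarith
    have hbd : ∀ i, ∀ y ∈ Metric.ball p (R / 2), ‖fderiv ℂ (f i) y‖ ≤ u i / (R / 4) := by
      intro i y hy
      refine norm_fderiv_le_of_ball ((hf i).differentiable (by simp)) (by positivity) fun z hz => hb i z ?_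
      rw [Metric.mem_ball] at hy ⊢
      rw [Metric.mem_closedBall] at hz
      linarith [dist_triangle z y p]
    have hu' : Summable fun i => u i / (R / 4) := hu.div_const _
    have hder : ∀ y ∈ Metric.ball p (R / 2), HasFDerivAt (fun y => ∑' i, f i y) (∑' i, fderiv ℂ (f i) y) y := by
      intro y hy
      refine hasFDerivAt_tsum_of_isPreconnected hu' Metric.isOpen_ball
        ((convex_ball p (R / 2)).isPreconnected) (fun i z _ => (((hf i).differentiable (by simp)) z).hasFDerivAt)
        hbd (Metric.mem_ball_self (by positivity)) ?_ hy
      exact Summable.of_norm_bounded hu fun i => hb i p (Metric.mem_ball_self hR)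
    have hkey := ih (fun i => fderiv ℂ (f i)) (fun i => (hf i).fderiv_right (by simp)) _ hu' (R / 2) (by positivity) hbd
    have he : R / 2 / 2 ^ k = R / 2 ^ (k + 1) := by rw [pow_succ]; field_simp
    rw [he] at hkey
    have hcast : ((k + 1 : ℕ) : ℕ∞ω) = (k : ℕ∞ω) + 1 := by push_cast; rfl
    rw [hcast, contDiffOn_succ_iff_fderiv_of_isOpen Metric.isOpen_ball]
    refine ⟨fun y hy => (hder y (hsub hy)).differentiableAt.differentiableWithinAt, by simp, ?_⟩
    exact hkey.congr fun y hy => (hder y (hsub hy)).fderiv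

noncomputable def hr (X : ℝ) (m : ℕ) : ℝ := mf (fun e => |jC e|) (qr X) m

lemma hr_nonneg {X : ℝ} (hX : 0 ≤ X) (m : ℕ) : 0 ≤ hr X m := mf_nonneg (fun e => abs_nonneg _) (qr_nonneg hX) m

lemma hJ_le {c : ℕ → ℝ} {C : ℝ} (hc : ∀ j, |c j| ≤ C) (x t : ℂ) {X : ℝ} (hX : ‖x‖ * Real.exp (C * ‖t‖) ≤ X) (m : ℕ) :
    ‖hJ (q c x t) m‖ ≤ hr X m := by
  rw [norm_hJ]
  exact mf_mono (fun e => abs_nonneg _) (fun i => norm_nonneg _)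
    (fun i => (norm_q_le hc x t i).trans (qr_mono (by positivity) hX i)) m

noncomputable def X1 : ℝ := Real.sqrt rho

lemma X1_sq : X1 ^ 2 = rho := Real.sq_sqrt rho_pos.le
lemma X1_pos : 0 < X1 := Real.sqrt_pos.2 rho_pos
lemma X1_lt_one : X1 < 1 := by nlinarith [X1_sq, X1_pos, rho_lt]
lemma rho_lt_X1 : rho < X1 := by nlinarith [X1_sq, X1_pos, X1_lt_one]

lemma summable_hr {X : ℝ} (hX : 0 ≤ X) (hX1 : X ≤ X1) : Summable (hr X) := by
  refine summable_mf_jC (qr_nonneg hX) (qr_le_one hX (hX1.trans X1_lt_one.le)) ?_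
  refine Summable.of_nonneg_of_le (fun i => by positivity) (fun i => ?_) summable_qr_rho
  refine (qr_sq_le hX i).trans (qr_mono (by positivity) ?_ i)
  rw [← X1_sq]; exact pow_le_pow_left₀ hX hX1 2

def Om (C : ℝ) : Set (ℂ × ℂ × ℂ) := {p | ‖p.1‖ * Real.exp (C * ‖p.2.2‖) < X1}

noncomputable def St (c : ℕ → ℝ) (k : ℕ) (i : ℕ × ℕ) (p : ℂ × ℂ × ℂ) : ℂ :=
  p.2.1 ^ i.1 / (i.1.factorial : ℂ) * Complex.exp (p.2.2 * c (i.1 + k + om i.2)) * hJ (q c p.1 p.2.2) i.2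

lemma q_contDiff (c : ℕ → ℝ) (m : ℕ) : ContDiff ℂ ∞ fun p : ℂ × ℂ × ℂ => q c p.1 p.2.2 m := by
  unfold q; split_ifs
  · exact contDiff_const
  · fun_prop

lemma hJ_contDiff (c : ℕ → ℝ) (m : ℕ) : ContDiff ℂ ∞ fun p : ℂ × ℂ × ℂ => hJ (q c p.1 p.2.2) m := by
  unfold hJ mf; split_ifs
  · exact contDiff_const
  · unfold Finsupp.prod
    exact contDiff_prod fun p _ => contDiff_const.mul ((q_contDiff c _).pow _)

lemma St_contDiff (c : ℕ → ℝ) (k : ℕ) (i : ℕ × ℕ) : ContDiff ℂ ∞ (St c k i) := by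
  unfold St
  refine ContDiff.mul ?_ (hJ_contDiff c _)
  fun_prop

lemma St_le {c : ℕ → ℝ} {C : ℝ} (hc : ∀ j, |c j| ≤ C) (k : ℕ) (i : ℕ × ℕ) {p : ℂ × ℂ × ℂ} {W τ X : ℝ}
    (hW : ‖p.2.1‖ ≤ W) (hτ : ‖p.2.2‖ ≤ τ) (hX : ‖p.1‖ * Real.exp (C * ‖p.2.2‖) ≤ X) :
    ‖St c k i p‖ ≤ W ^ i.1 / (i.1.factorial : ℝ) * Real.exp (C * τ) * hr X i.2 := by
  have hC : 0 ≤ C := (abs_nonneg _).trans (hc 0)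
  have hX0 : 0 ≤ X := le_trans (by positivity) hX
  have hW0 : 0 ≤ W := (norm_nonneg _).trans hW
  unfold St
  rw [norm_mul, norm_mul, norm_div, norm_pow, Complex.norm_natCast]
  refine mul_le_mul (mul_le_mul ?_ ?_ (norm_nonneg _) (by positivity)) (hJ_le hc _ _ hX _) (norm_nonneg _) (by positivity)
  · gcongr
  · rw [Complex.norm_exp, Real.exp_le_exp]
    refine (Complex.re_le_norm _).trans ?_
    rw [norm_mul, Complex.norm_real, Real.norm_eq_abs, mul_comm]
    exact mul_le_mul (hc _) hτ (norm_nonneg _) hC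

lemma summable_St_bd {W τ X C : ℝ} (hW : 0 ≤ W) (hX : 0 ≤ X) (hX1 : X ≤ X1) :
    Summable fun i : ℕ × ℕ => W ^ i.1 / (i.1.factorial : ℝ) * Real.exp (C * τ) * hr X i.2 := by
  refine (((Real.summable_pow_div_factorial W).mul_right (Real.exp (C * τ))).mul_of_nonneg (summable_hr hX hX1)
    (fun _ => by positivity) (fun m => hr_nonneg hX m))

lemma Ssum_contDiffAt {c : ℕ → ℝ} {C : ℝ} (hc : ∀ j, |c j| ≤ C) (k n : ℕ) {p : ℂ × ℂ × ℂ} (hp : p ∈ Om C) :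
    ContDiffAt ℂ n (fun p : ℂ × ℂ × ℂ => Ssum c k p.1 p.2.1 p.2.2) p := by
  have hp' : ‖p.1‖ * Real.exp (C * ‖p.2.2‖) < X1 := hp
  obtain ⟨X, hX, hX1⟩ := exists_between hp'
  have hopen : IsOpen {p : ℂ × ℂ × ℂ | ‖p.1‖ * Real.exp (C * ‖p.2.2‖) < X} := isOpen_lt (by fun_prop) continuous_const
  obtain ⟨R, hR, hball⟩ := Metric.isOpen_iff.1 hopen p hX
  have hX0 : 0 ≤ X := le_trans (by positivity) hX.le
  have hcoord : ∀ y ∈ Metric.ball p R, ‖y.2.1‖ ≤ ‖p‖ + R ∧ ‖y.2.2‖ ≤ ‖p‖ + R := by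
    intro y hy
    have h1 : ‖y‖ ≤ ‖p‖ + R := by
      have h2 : ‖y - p‖ < R := mem_ball_iff_norm.1 hy
      calc ‖y‖ = ‖p + (y - p)‖ := by congr 1; abel
        _ ≤ ‖p‖ + ‖y - p‖ := norm_add_le _ _
        _ ≤ _ := by linarith
    exact ⟨((norm_fst_le y.2).trans (norm_snd_le y)).trans h1, ((norm_snd_le y.2).trans (norm_snd_le y)).trans h1⟩
  have := contDiffOn_tsum_aux p n (St c k) (St_contDiff c k) _ (summable_St_bd (C := C) (W := ‖p‖ + R) (τ := ‖p‖ + R)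
    (by positivity) hX0 hX1.le) R hR (fun i y hy => St_le hc k i (hcoord y hy).1 (hcoord y hy).2 (hball hy).le)
  exact this.contDiffAt (Metric.ball_mem_nhds _ (by positivity))

lemma Ssum_hasDerivAt_w {c : ℕ → ℝ} {C : ℝ} (hc : ∀ j, |c j| ≤ C) (k : ℕ) {x t : ℂ} (w : ℂ)
    (hp : ‖x‖ * Real.exp (C * ‖t‖) ≤ X1) :
    HasDerivAt (fun w => Ssum c k x w t) (Ssum c (k + 1) x w t) w := by
  have hX0 : 0 ≤ ‖x‖ * Real.exp (C * ‖t‖) := by positivity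
  have key := summable_St_bd (C := C) (τ := ‖t‖) (W := ‖w‖ + 1) (by positivity) hX0 hp
  have hd : ∀ (i : ℕ × ℕ) (w : ℂ), HasDerivAt (fun w => St c k i (x, w, t))
      ((i.1 : ℂ) * w ^ (i.1 - 1) / (i.1.factorial : ℂ) * Complex.exp (t * c (i.1 + k + om i.2)) * hJ (q c x t) i.2) w := by
    intro i w
    unfold St
    dsimp only
    generalize hJ (q c x t) i.2 = A
    generalize Complex.exp (t * c (i.1 + k + om i.2)) = B
    exact (((hasDerivAt_pow i.1 w).div_const _).mul_const _).mul_const _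
  -- reindex the derivative
  have hsh : ∀ (l m : ℕ) (w : ℂ), (((l + 1 : ℕ) : ℂ) * w ^ (l + 1 - 1) / ((l + 1).factorial : ℂ) *
      Complex.exp (t * c (l + 1 + k + om m)) * hJ (q c x t) m) = St c (k + 1) (l, m) (x, w, t) := by
    intro l m w
    unfold St
    have h1 : ((l + 1 : ℕ) : ℂ) ≠ 0 := by exact_mod_cast Nat.succ_ne_zero l
    have h2 : ((l + 1).factorial : ℂ) = ((l + 1 : ℕ) : ℂ) * (l.factorial : ℂ) := by
      rw [Nat.factorial_succ]; push_cast; ring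
    rw [h2, Nat.add_sub_cancel, mul_div_mul_left _ _ h1]
    simp only [show l + 1 + k + om m = l + (k + 1) + om m by ring]
  set u : ℕ × ℕ → ℝ := fun i => if i.1 = 0 then 0 else
    (‖w‖ + 1) ^ (i.1 - 1) / ((i.1 - 1).factorial : ℝ) * Real.exp (C * ‖t‖) * hr (‖x‖ * Real.exp (C * ‖t‖)) i.2 with hu
  have hinj : Function.Injective (fun i : ℕ × ℕ => (i.1 + 1, i.2)) := by
    rintro ⟨a, b⟩ ⟨a', b'⟩ h; simpa using h
  have hzero : ∀ i : ℕ × ℕ, i ∉ Set.range (fun i : ℕ × ℕ => (i.1 + 1, i.2)) → i.1 = 0 := by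
    rintro ⟨a, b⟩ h
    by_contra h0
    exact h ⟨(a - 1, b), by simp; have : a ≠ 0 := h0; omega⟩
  have hus : Summable u := by
    rw [← hinj.summable_iff (fun i hi => by simp [hu, hzero i hi])]
    refine key.congr fun i => ?_
    simp [hu]
  have hmain := hasDerivAt_tsum_of_isPreconnected (g := fun i w => St c k i (x, w, t))
    (g' := fun i w => ((i.1 : ℂ) * w ^ (i.1 - 1) / (i.1.factorial : ℂ) * Complex.exp (t * c (i.1 + k + om i.2)) * hJ (q c x t) i.2))
    (t := Metric.ball w 1) (y₀ := w) (y := w) hus Metric.isOpen_ball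
    (convex_ball w 1).isPreconnected (fun i y _ => hd i y) (fun i y hy => ?_) (Metric.mem_ball_self one_pos) ?_
    (Metric.mem_ball_self one_pos)
  · have hval : Ssum c (k + 1) x w t = ∑' i : ℕ × ℕ, ((i.1 : ℂ) * w ^ (i.1 - 1) / (i.1.factorial : ℂ) *
        Complex.exp (t * c (i.1 + k + om i.2)) * hJ (q c x t) i.2) := ?_
    · rw [hval]; exact hmain
    unfold Ssum
    symm
    rw [← hinj.tsum_eq (f := fun i : ℕ × ℕ => ((i.1 : ℂ) * w ^ (i.1 - 1) / (i.1.factorial : ℂ) *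
      Complex.exp (t * c (i.1 + k + om i.2)) * hJ (q c x t) i.2))]
    · exact tsum_congr fun i => hsh i.1 i.2 w
    · intro i hi
      by_contra h
      exact hi (by simp [hzero i h])
  · have hy' : ‖y‖ ≤ ‖w‖ + 1 := by
      have h2 : ‖y - w‖ < 1 := mem_ball_iff_norm.1 hy
      calc ‖y‖ = ‖w + (y - w)‖ := by congr 1; abel
        _ ≤ ‖w‖ + ‖y - w‖ := norm_add_le _ _
        _ ≤ _ := by linarith
    obtain ⟨l, m⟩ := i
    cases l with
    | zero => simp [hu]
    | succ l =>
      simp only [hu]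
      rw [if_neg (Nat.succ_ne_zero l), hsh l m y]
      simp only [Nat.add_sub_cancel]
      exact St_le hc (k + 1) (l, m) (p := (x, y, t)) hy' le_rfl le_rfl
  · refine Summable.of_norm_bounded key fun i => ?_
    exact St_le hc k i (p := (x, w, t)) (by simp) le_rfl le_rfl

noncomputable def FF (c : ℕ → ℝ) (x w t : ℂ) : ℂ := w - x * Ssum c 0 x w t
noncomputable def FW (c : ℕ → ℝ) (x w t : ℂ) : ℂ := 1 - x * Ssum c 1 x w t

lemma FF_contDiffAt {c : ℕ → ℝ} {C : ℝ} (hc : ∀ j, |c j| ≤ C) (n : ℕ) {p : ℂ × ℂ × ℂ} (hp : p ∈ Om C) :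
    ContDiffAt ℂ n (fun p : ℂ × ℂ × ℂ => FF c p.1 p.2.1 p.2.2) p := by
  unfold FF
  exact ContDiffAt.sub (by fun_prop) (ContDiffAt.mul (by fun_prop) (Ssum_contDiffAt hc 0 n hp))

lemma FW_contDiffAt {c : ℕ → ℝ} {C : ℝ} (hc : ∀ j, |c j| ≤ C) (n : ℕ) {p : ℂ × ℂ × ℂ} (hp : p ∈ Om C) :
    ContDiffAt ℂ n (fun p : ℂ × ℂ × ℂ => FW c p.1 p.2.1 p.2.2) p := by
  unfold FW
  exact ContDiffAt.sub (by fun_prop) (ContDiffAt.mul (by fun_prop) (Ssum_contDiffAt hc 1 n hp))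

lemma FF_hasDerivAt_w {c : ℕ → ℝ} {C : ℝ} (hc : ∀ j, |c j| ≤ C) {x t : ℂ} (w : ℂ)
    (hp : ‖x‖ * Real.exp (C * ‖t‖) ≤ X1) : HasDerivAt (fun w => FF c x w t) (FW c x w t) w :=
  (hasDerivAt_id w).sub ((Ssum_hasDerivAt_w hc 0 w hp).const_mul x)

lemma FW_hasDerivAt_w {c : ℕ → ℝ} {C : ℝ} (hc : ∀ j, |c j| ≤ C) {x t : ℂ} (w : ℂ)
    (hp : ‖x‖ * Real.exp (C * ‖t‖) ≤ X1) : HasDerivAt (fun w => FW c x w t) (-(x * Ssum c 2 x w t)) w :=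
  ((Ssum_hasDerivAt_w hc 1 w hp).const_mul x).const_sub 1

noncomputable def zet (x : ℂ) : ℂ := x * ∑' m, hJ (fun m => if m = 0 then 0 else (wt m : ℂ) * x ^ tsize m) m

lemma q_t0 (c : ℕ → ℝ) (x : ℂ) : q c x 0 = fun m => if m = 0 then 0 else (wt m : ℂ) * x ^ tsize m := by
  funext m; simp [q]

lemma Ssum_zero (c : ℕ → ℝ) (k : ℕ) {x : ℂ} (w : ℂ) (hx : ‖x‖ ≤ X1) : x * Ssum c k x w 0 = zet x * Complex.exp w := by
  unfold Ssum zet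
  rw [← q_t0 c x]
  have hs : Summable fun m => ‖hJ (q c x 0) m‖ := by
    by_cases h : ∀ j, |(fun _ : ℕ => (0:ℝ)) j| ≤ 0
    · have h2 : q c x 0 = q (fun _ => 0) x 0 := by rw [q_t0, q_t0]
      rw [h2]
      exact Summable.of_nonneg_of_le (fun _ => norm_nonneg _) (fun m => hJ_le h x 0 (X := ‖x‖) (by simp) m)
        (summable_hr (norm_nonneg _) hx)
    · simp at h
  have e3 : Complex.exp w * ∑' m, hJ (q c x 0) m =
      ∑' k : ℕ × ℕ, w ^ k.1 / (k.1.factorial : ℂ) * hJ (q c x 0) k.2 := by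
    rw [Complex.exp_eq_exp_ℂ, NormedSpace.exp_eq_tsum_div]
    exact tsum_mul_tsum_of_summable_norm (NormedSpace.norm_expSeries_div_summable _) hs
  rw [mul_assoc, mul_comm (∑' m, hJ (q c x 0) m), e3]
  congr 1
  refine tsum_congr fun i => ?_
  rw [zero_mul, Complex.exp_zero, mul_one]

lemma FF_zero (c : ℕ → ℝ) {x : ℂ} (w : ℂ) (hx : ‖x‖ ≤ X1) : FF c x w 0 = w - zet x * Complex.exp w := by
  rw [FF, Ssum_zero c 0 w hx]

lemma FW_zero (c : ℕ → ℝ) {x : ℂ} (w : ℂ) (hx : ‖x‖ ≤ X1) : FW c x w 0 = 1 - zet x * Complex.exp w := by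
  rw [FW, Ssum_zero c 1 w hx]

end IsoCLT

open scoped Classical BigOperators ContDiff
open MeasureTheory ProbabilityTheory

namespace IsoCLT

noncomputable def TT (z : ℂ) : ℂ := ∑' m, (qr rho m : ℂ) * z ^ tsize m

lemma TT_term_le {z : ℂ} (hz : ‖z‖ ≤ 1) (m : ℕ) : ‖(qr rho m : ℂ) * z ^ tsize m‖ ≤ qr rho m := by
  rw [norm_mul, norm_pow, Complex.norm_real, Real.norm_of_nonneg (qr_nonneg rho_pos.le m)]
  exact mul_le_of_le_one_right (qr_nonneg rho_pos.le m) (pow_le_one₀ (norm_nonneg _) hz)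

lemma TT_summable {z : ℂ} (hz : ‖z‖ ≤ 1) : Summable fun m => (qr rho m : ℂ) * z ^ tsize m :=
  Summable.of_norm_bounded summable_qr_rho (TT_term_le hz)

lemma norm_TT_le {z : ℂ} (hz : ‖z‖ ≤ 1) : ‖TT z‖ ≤ 1 := by
  rw [← tsum_qr_rho]
  exact tsum_of_norm_bounded summable_qr_rho.hasSum (TT_term_le hz)

lemma TT_one : TT 1 = 1 := by
  unfold TT
  simp only [one_pow, mul_one]
  rw [← Complex.ofReal_tsum, tsum_qr_rho, Complex.ofReal_one]

lemma TT_cont : ContinuousOn TT (Metric.closedBall 0 1) :=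
  continuousOn_tsum (fun m => by fun_prop) summable_qr_rho fun m z hz => TT_term_le (by simpa using hz) m

lemma TT_diff : DifferentiableOn ℂ TT (Metric.ball 0 1) :=
  Complex.differentiableOn_tsum_of_summable_norm summable_qr_rho (fun m => by fun_prop) Metric.isOpen_ball
    fun m z hz => TT_term_le (by simpa using (mem_ball_zero_iff.1 hz).le) m

lemma q_rho (c : ℕ → ℝ) (z : ℂ) (m : ℕ) : q c (rho * z) 0 m = (qr rho m : ℂ) * z ^ tsize m := by
  unfold q qr
  split_ifs
  · simp
  · simp only [zero_mul, Complex.exp_zero, mul_pow]; push_cast; ring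

lemma TT_q (c : ℕ → ℝ) (z : ℂ) : ∑' m, q c (rho * z) 0 m = TT z := tsum_congr fun m => q_rho c z m

lemma norm_rho_mul {z : ℂ} (hz : ‖z‖ ≤ 1) : ‖(rho : ℂ) * z‖ ≤ rho := by
  rw [norm_mul, Complex.norm_real, Real.norm_of_nonneg rho_pos.le]
  exact mul_le_of_le_one_right rho_pos.le hz

lemma TT_eq {z : ℂ} (hz : ‖z‖ ≤ 1) : TT z = zet (rho * z) * Complex.exp (TT z) := by
  have h := T_eq (c := fun _ => 0) (C := 0) (by simp) (rho * z) 0 (X := rho) (by simpa using norm_rho_mul hz)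
    (by linarith [rho_lt]) summable_qr_rho
  rw [TT_q] at h
  rw [Ssum_zero _ _ _ ((norm_rho_mul hz).trans rho_lt_X1.le)] at h
  exact h

lemma zet_rho : zet rho = Complex.exp (-1) := by
  have := TT_eq (z := 1) (by simp)
  rw [TT_one, mul_one] at this
  rw [Complex.exp_neg]
  exact eq_inv_of_mul_eq_one_left this.symm

lemma TT_eq_one {z : ℂ} (hz : ‖z‖ ≤ 1) (h : TT z = 1) : z = 1 := by
  have hre : z.re = 1 := by
    by_contra hne
    have hlt : z.re < 1 := lt_of_le_of_ne ((Complex.re_le_norm z).trans hz) hne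
    have hs := (Complex.hasSum_re (TT_summable hz).hasSum)
    have h1 : HasSum (fun m => ((qr rho m : ℂ) * z ^ tsize m).re) 1 := by
      have : (∑' m, (qr rho m : ℂ) * z ^ tsize m) = 1 := h
      rw [this] at hs
      simpa using hs
    have h2 : ∑' m, ((qr rho m : ℂ) * z ^ tsize m).re < ∑' m, qr rho m := by
      refine h1.summable.tsum_lt_tsum (i := 1) (fun m => (Complex.re_le_norm _).trans (TT_term_le hz m)) ?_ summable_qr_rho
      have : tsize 1 = 1 := by rw [tsize_eq]; simp
      rw [this, qr_one, pow_one, Complex.re_ofReal_mul]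
      nlinarith [rho_pos]
    rw [h1.tsum_eq, tsum_qr_rho] at h2
    exact lt_irrefl _ h2
  have him : z.im = 0 := by
    have : z.re ^ 2 + z.im ^ 2 ≤ 1 := by
      have h5 := Complex.sq_norm z
      rw [Complex.normSq_apply] at h5
      nlinarith [pow_le_one₀ (n := 2) (norm_nonneg _) hz]
    rw [hre] at this
    nlinarith
  exact Complex.ext (by simp [hre]) (by simp [him])

lemma Ifun_deriv {x : ℝ} (hx0 : 0 ≤ x) (hx : x < 2) : ∃ I', HasDerivAt (fun x : ℝ => ∑' e, iC e * x ^ e) I' x ∧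
    (∑' e, iC e * x ^ e) - I' ≤ x / 2 * ∑' e, iC e * x ^ e := by
  have hsucc : ∀ j : ℕ, iC (j + 1) * ((j + 1 : ℕ) : ℝ) = iC j / (j + 1) := by
    intro j; unfold iC
    rw [Nat.factorial_succ]; push_cast; field_simp
  have hus : Summable fun e : ℕ => iC e * (e * 2 ^ (e - 1)) := by
    rw [← summable_nat_add_iff 1]
    refine Summable.of_nonneg_of_le (fun e => mul_nonneg (iC_pos _).le (by positivity)) (fun e => ?_) (summable_iC 2)
    rw [← mul_assoc, hsucc, Nat.add_sub_cancel, abs_two]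
    refine mul_le_mul_of_nonneg_right (div_le_self (iC_pos e).le (by linarith [Nat.cast_nonneg (α := ℝ) e])) (by positivity)
  have hd := hasDerivAt_tsum_of_isPreconnected (g := fun e (x : ℝ) => iC e * x ^ e)
    (g' := fun e (x : ℝ) => iC e * (e * x ^ (e - 1))) (t := Metric.ball 0 2) (y₀ := 0) (y := x) hus Metric.isOpen_ball
    (convex_ball _ _).isPreconnected (fun e y _ => (hasDerivAt_pow e y).const_mul _) (fun e y hy => by
      rw [norm_mul, norm_mul, norm_pow, Real.norm_of_nonneg (iC_pos e).le, Real.norm_natCast]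
      have : ‖y‖ ≤ 2 := by simpa using (mem_ball_zero_iff.1 hy).le
      exact mul_le_mul_of_nonneg_left (mul_le_mul_of_nonneg_left (pow_le_pow_left₀ (norm_nonneg _) this _) (by positivity)) (iC_pos e).le)
    (by simp) (by
      have := summable_iC 0
      simpa using this) (by simp [abs_of_nonneg hx0, hx])
  refine ⟨_, hd, ?_⟩
  have hsI : Summable fun e => iC e * x ^ e := by simpa [abs_of_nonneg hx0] using summable_iC x
  have hsI' : Summable fun e : ℕ => iC e * (e * x ^ (e - 1)) := by
    refine Summable.of_nonneg_of_le (fun e => mul_nonneg (iC_pos e).le (by positivity)) (fun e => ?_) hus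
    exact mul_le_mul_of_nonneg_left (mul_le_mul_of_nonneg_left (pow_le_pow_left₀ hx0 hx.le _) (by positivity)) (iC_pos e).le
  have e1 : ∑' e : ℕ, iC e * (e * x ^ (e - 1)) = ∑' e : ℕ, iC e / (e + 1) * x ^ e := by
    rw [hsI'.tsum_eq_zero_add]
    simp only [Nat.cast_zero, zero_mul, mul_zero, zero_add]
    refine tsum_congr fun e => ?_
    rw [← mul_assoc, hsucc, Nat.add_sub_cancel]
  have hs2 : Summable fun e : ℕ => iC e / (e + 1) * x ^ e := by
    refine Summable.of_nonneg_of_le (fun e => mul_nonneg (div_nonneg (iC_pos _).le (by positivity)) (by positivity)) (fun e => ?_) hsI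
    refine mul_le_mul_of_nonneg_right (div_le_self (iC_pos e).le (by linarith [Nat.cast_nonneg (α := ℝ) e])) (by positivity)
  rw [e1, ← hsI.tsum_sub hs2, (hsI.sub hs2).tsum_eq_zero_add, ← tsum_mul_left]
  simp only [iC_zero, pow_zero, Nat.cast_zero, zero_add, div_one, sub_self, mul_one]
  refine ((summable_nat_add_iff 1).2 (hsI.sub hs2)).tsum_le_tsum (fun j => ?_) (hsI.mul_left _)
  have h1 := hsucc j
  have h2 : iC (j + 1) - iC (j + 1) / (((j + 1 : ℕ) : ℝ) + 1) = iC j / ((j + 1) * (j + 2)) := by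
    have h3 : iC (j + 1) = iC j / (j + 1) / (j + 1) := by
      rw [← h1]; push_cast; field_simp
    rw [h3]; push_cast; field_simp; ring
  have h4 : iC (j + 1) * x ^ (j + 1) - iC (j + 1) / (((j + 1 : ℕ) : ℝ) + 1) * x ^ (j + 1) =
      x * (iC j / ((j + 1) * (j + 2))) * x ^ j := by
    rw [← h2, pow_succ]; ring
  rw [h4]
  have h5 : iC j / ((j + 1) * (j + 2)) ≤ iC j / 2 := by
    apply div_le_div_of_nonneg_left (iC_pos j).le (by norm_num)
    nlinarith [Nat.cast_nonneg (α := ℝ) j]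
  calc x * (iC j / ((j + 1) * (j + 2))) * x ^ j ≤ x * (iC j / 2) * x ^ j := by gcongr
    _ = _ := by ring

lemma Jr_mono : MonotoneOn (fun x => Jr x * Real.exp (x ^ 2 / 4)) (Set.Icc 0 1) := by
  have hder : ∀ x ∈ Set.Icc (0 : ℝ) 1, ∃ D, HasDerivAt (fun x => Jr x * Real.exp (x ^ 2 / 4)) D x ∧ 0 ≤ D := by
    intro x hx
    obtain ⟨I', h1, h2⟩ := Ifun_deriv hx.1 (by linarith [hx.2])
    have h3 : HasDerivAt (fun x : ℝ => Real.exp (-x)) (Real.exp (-x) * (-1)) x := (hasDerivAt_id x).neg.exp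
    have h4 : HasDerivAt (fun x : ℝ => Real.exp (x ^ 2 / 4)) (Real.exp (x ^ 2 / 4) * (2 * x / 4)) x := by
      have := ((hasDerivAt_pow 2 x).div_const 4).exp
      simpa using this
    refine ⟨_, (h3.mul h1).mul h4, ?_⟩
    set I := ∑' e, iC e * x ^ e
    have : (Real.exp (-x) * -1 * I + Real.exp (-x) * I') * Real.exp (x ^ 2 / 4) +
        Real.exp (-x) * I * (Real.exp (x ^ 2 / 4) * (2 * x / 4)) =
        Real.exp (-x) * Real.exp (x ^ 2 / 4) * (x / 2 * I - (I - I')) := by ring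
    simp only [Pi.mul_apply]
    rw [this]
    have : 0 ≤ x / 2 * I - (I - I') := by linarith
    positivity
  refine monotoneOn_of_deriv_nonneg (convex_Icc 0 1) ?_ ?_ ?_
  · exact fun x hx => (hder x hx).choose_spec.1.continuousAt.continuousWithinAt
  · intro x hx
    exact (hder x (interior_subset hx)).choose_spec.1.differentiableAt.differentiableWithinAt
  · intro x hx
    have := (hder x (interior_subset hx)).choose_spec
    rw [this.1.deriv]; exact this.2

lemma zet_tendsto {X : ℝ} (hX0 : 0 ≤ X) (hX1 : X ≤ X1) :
    Filter.Tendsto (fun N : ℕ => ((X * ∏ p ∈ N.primesBelow, Jr (qr X (idx p)) : ℝ) : ℂ)) Filter.atTop (nhds (zet X)) := by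
  have hq : (fun m => if m = 0 then 0 else (wt m : ℂ) * (X : ℂ) ^ tsize m) = fun m => (qr X m : ℂ) := by
    funext m; unfold qr; split_ifs <;> simp
  have hs : Summable fun m => ‖hJ (fun m => (qr X m : ℂ)) m‖ := by
    refine (summable_hr hX0 hX1).congr fun m => ?_
    rw [norm_hJ, hr]
    congr 1
    funext i
    rw [Complex.norm_real, Real.norm_of_nonneg (qr_nonneg hX0 i)]
  have := (mf_euler (fun e => (jC e : ℂ)) (fun m => (qr X m : ℂ)) (by simp [jC_zero]) hs).const_mul (X : ℂ)
  unfold zet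
  rw [hq]
  refine this.congr fun N => ?_
  rw [Complex.ofReal_mul, Complex.ofReal_prod]
  congr 1
  refine Finset.prod_congr rfl fun p _ => ?_
  rw [jC_tsum, Jr]
  push_cast
  rfl

lemma tsize_qr_le (m : ℕ) : tsize m * qr rho m ≤ 1 := by
  have h : ∀ n : ℕ, (n : ℝ) * (5 / 8) ^ n ≤ 1 := by
    intro n
    rcases n with _ | _ | n
    · simp
    · norm_num
    · induction n with
      | zero => norm_num
      | succ n ih =>
        push_cast at ih ⊢
        rw [pow_succ]
        have : ((n : ℝ) + 1 + 1 + 1) * (5 / 8) ≤ n + 1 + 1 := by linarith [Nat.cast_nonneg (α := ℝ) n]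
        have h0 : (0 : ℝ) ≤ (5 / 8) ^ (n + 1 + 1) := by positivity
        nlinarith
  refine le_trans (mul_le_mul_of_nonneg_left ?_ (by positivity)) (h (tsize m))
  unfold qr; split_ifs
  · positivity
  · calc wt m * rho ^ tsize m ≤ 1 * (5 / 8) ^ tsize m :=
        mul_le_mul (wt_le_one m) (pow_le_pow_left₀ rho_pos.le rho_lt.le _) (by have := rho_pos; positivity) zero_le_one
      _ = _ := one_mul _

lemma qr_mul (r : ℝ) (m : ℕ) : qr (rho * r) m = qr rho m * r ^ tsize m := by
  unfold qr; split_ifs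
  · simp
  · rw [mul_pow]; ring

lemma zet_real_bound {r : ℝ} (h0 : 0 ≤ r) (h1 : r ≤ 1) :
    (zet (rho * r)).im = 0 ∧ Real.exp 1 * (zet (rho * r)).re ≤ 1 - (1 - r) / 4 := by
  have hX0 : 0 ≤ rho * r := mul_nonneg rho_pos.le h0
  have hX1 : rho * r ≤ X1 := (mul_le_of_le_one_right rho_pos.le h1).trans rho_lt_X1.le
  have ht := zet_tendsto hX0 hX1
  have ht1 := zet_tendsto rho_pos.le rho_lt_X1.le
  rw [Complex.ofReal_mul] at ht
  have him := (Complex.continuous_im.tendsto _).comp ht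
  have hre := (Complex.continuous_re.tendsto _).comp ht
  have hre1 := (Complex.continuous_re.tendsto _).comp ht1
  simp only [Function.comp_def, Complex.ofReal_im, Complex.ofReal_re] at him hre hre1
  refine ⟨(tendsto_nhds_unique him tendsto_const_nhds), ?_⟩
  have hle : ∀ N : ℕ, rho * r * ∏ p ∈ N.primesBelow, Jr (qr (rho * r) (idx p)) ≤
      (rho * ∏ p ∈ N.primesBelow, Jr (qr rho (idx p))) * (r * Real.exp ((1 - r) / 2)) := by
    intro N
    have hp : ∀ i, Jr (qr (rho * r) i) ≤ Jr (qr rho i) * Real.exp (qr rho i * ((1 - r) / 2)) := by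
      intro i
      have hq0 := qr_nonneg rho_pos.le i
      have hq1 := qr_le_one rho_pos.le (by linarith [rho_lt]) i
      have hqr0 := qr_nonneg hX0 i
      have hqr : qr (rho * r) i ≤ qr rho i := qr_mono hX0 (mul_le_of_le_one_right rho_pos.le h1) i
      have hm := Jr_mono ⟨hqr0, hqr.trans hq1⟩ ⟨hq0, hq1⟩ hqr
      simp only at hm
      have hb : 1 - tsize i * (1 - r) ≤ r ^ tsize i := by
        have := one_add_mul_le_pow (a := r - 1) (by linarith) (tsize i)
        rw [add_sub_cancel] at this; linarith
      have hn := tsize_qr_le i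
      have key : qr rho i ^ 2 / 4 - qr (rho * r) i ^ 2 / 4 ≤ qr rho i * ((1 - r) / 2) := by
        have e : qr (rho * r) i = qr rho i * r ^ tsize i := qr_mul r i
        have h2 : qr rho i - qr (rho * r) i ≤ 1 - r := by
          rw [e]; nlinarith
        nlinarith
      have e5 : Jr (qr (rho * r) i) = Jr (qr (rho * r) i) * Real.exp (qr (rho * r) i ^ 2 / 4) * Real.exp (-(qr (rho * r) i ^ 2 / 4)) := by
        rw [mul_assoc, ← Real.exp_add]; simp
      rw [e5]
      calc _ ≤ Jr (qr rho i) * Real.exp (qr rho i ^ 2 / 4) * Real.exp (-(qr (rho * r) i ^ 2 / 4)) := by gcongr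
        _ = Jr (qr rho i) * Real.exp (qr rho i ^ 2 / 4 - qr (rho * r) i ^ 2 / 4) := by
          rw [mul_assoc, ← Real.exp_add]; ring_nf
        _ ≤ _ := mul_le_mul_of_nonneg_left (Real.exp_le_exp.2 key) (Jr_nonneg hq0)
    have hprod : ∏ p ∈ N.primesBelow, Jr (qr (rho * r) (idx p)) ≤
        (∏ p ∈ N.primesBelow, Jr (qr rho (idx p))) * Real.exp ((1 - r) / 2) := by
      refine (Finset.prod_le_prod (fun p _ => Jr_nonneg (qr_nonneg hX0 _)) fun p _ => hp (idx p)).trans ?_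
      rw [Finset.prod_mul_distrib, ← Real.exp_sum, ← Finset.sum_mul]
      refine mul_le_mul_of_nonneg_left ?_ (Finset.prod_nonneg fun p _ => Jr_nonneg (qr_nonneg rho_pos.le _))
      rw [Real.exp_le_exp]
      have h7 : ∑ p ∈ N.primesBelow, qr rho (idx p) ≤ 1 := by
        have h8 := sum_primes_le (qr_nonneg rho_pos.le) N
        have h9 : ∑ p ∈ N.primesBelow, qr rho (idx p) ≤ ∑ p ∈ (N + 1).primesBelow, qr rho (idx p) := by
          refine Finset.sum_le_sum_of_subset_of_nonneg ?_ fun i _ _ => qr_nonneg rho_pos.le _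
          intro p hp
          exact Nat.mem_primesBelow.2 ⟨(Nat.lt_of_mem_primesBelow hp).trans (Nat.lt_succ_self _),
            Nat.prime_of_mem_primesBelow hp⟩
        exact h9.trans (h8.trans (rho_mem.2 N))
      nlinarith
    calc _ ≤ rho * r * ((∏ p ∈ N.primesBelow, Jr (qr rho (idx p))) * Real.exp ((1 - r) / 2)) :=
          mul_le_mul_of_nonneg_left hprod hX0
      _ = _ := by ring
  have hfin := le_of_tendsto_of_tendsto' hre (hre1.mul_const _) hle
  rw [zet_rho] at hfin
  have : (Complex.exp (-1)).re = Real.exp (-1) := by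
    rw [show (-1 : ℂ) = ((-1 : ℝ) : ℂ) by push_cast; rfl, Complex.exp_ofReal_re]
  rw [this] at hfin
  have h2 : Real.exp 1 * (zet (rho * r)).re ≤ r * Real.exp ((1 - r) / 2) := by
    calc _ ≤ Real.exp 1 * (Real.exp (-1) * (r * Real.exp ((1 - r) / 2))) := by gcongr
      _ = _ := by rw [← mul_assoc, ← Real.exp_add]; simp
  refine h2.trans ?_
  have h3 : r ≤ Real.exp (-(1 - r)) := by linarith [Real.add_one_le_exp (-(1 - r))]
  have h4 : r * Real.exp ((1 - r) / 2) ≤ Real.exp (-((1 - r) / 2)) := by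
    calc _ ≤ Real.exp (-(1 - r)) * Real.exp ((1 - r) / 2) := by gcongr
      _ = _ := by rw [← Real.exp_add]; ring_nf
  refine h4.trans ?_
  have h5 : Real.exp (-((1 - r) / 2)) * Real.exp ((1 - r) / 2) = 1 := by rw [← Real.exp_add]; simp
  nlinarith [Real.add_one_le_exp ((1 - r) / 2), Real.exp_pos (-((1 - r) / 2))]

end IsoCLT

open scoped Classical BigOperators ContDiff
open MeasureTheory ProbabilityTheory

namespace IsoCLT

lemma zet_eq {x : ℂ} (hx : ‖x‖ ≤ X1) : zet x = - FF (fun _ => 0) x 0 0 := by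
  rw [FF_zero _ _ hx]; simp

noncomputable def ZZ (z : ℂ) : ℂ := zet (rho * z)

lemma exists_R : ∃ R : ℝ, 1 < R ∧ ∀ z : ℂ, ‖z‖ < R → ‖(rho : ℂ) * z‖ < X1 := by
  refine ⟨X1 / rho, by rw [lt_div_iff₀ rho_pos, one_mul]; exact rho_lt_X1, fun z hz => ?_⟩
  rw [lt_div_iff₀ rho_pos] at hz
  rw [norm_mul, Complex.norm_real, Real.norm_of_nonneg rho_pos.le]; linarith

lemma ZZ_diff {R : ℝ} (hR : ∀ z : ℂ, ‖z‖ < R → ‖(rho : ℂ) * z‖ < X1) :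
    DifferentiableOn ℂ ZZ (Metric.ball 0 R) := by
  have h : ∀ z ∈ Metric.ball (0:ℂ) R, ZZ z = - FF (fun _ => 0) (rho * z) 0 0 := fun z hz =>
    zet_eq (hR z (by simpa using hz)).le
  refine DifferentiableOn.congr (fun z hz => ?_) h
  have := (FF_contDiffAt (c := fun _ => 0) (C := 0) (by simp) 1 (p := (rho * z, 0, 0))
    (by simpa [Om] using hR z (by simpa using hz))).differentiableAt (by simp)
  have h2 : DifferentiableAt ℂ (fun z : ℂ => ((rho : ℂ) * z, (0:ℂ), (0:ℂ))) z := by fun_prop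
  exact (DifferentiableAt.comp z this h2).neg.differentiableWithinAt

lemma ZZ_bounds : ∃ L : ℝ, 0 < L ∧ ∀ z : ℂ, ‖z‖ ≤ 1 → HasDerivAt ZZ (deriv ZZ z) z ∧
    HasDerivAt (deriv ZZ) (deriv (deriv ZZ) z) z ∧ ‖deriv ZZ z‖ ≤ L ∧ ‖deriv (deriv ZZ) z‖ ≤ L := by
  obtain ⟨R, hR1, hR⟩ := exists_R
  have h0 := ZZ_diff hR
  have h1 := h0.deriv Metric.isOpen_ball
  have h2 := h1.deriv Metric.isOpen_ball
  have hsub : Metric.closedBall (0:ℂ) 1 ⊆ Metric.ball 0 R := Metric.closedBall_subset_ball hR1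
  obtain ⟨L1, hL1⟩ := (isCompact_closedBall (0:ℂ) 1).exists_bound_of_continuousOn (h1.continuousOn.mono hsub)
  obtain ⟨L2, hL2⟩ := (isCompact_closedBall (0:ℂ) 1).exists_bound_of_continuousOn (h2.continuousOn.mono hsub)
  refine ⟨max (max L1 L2) 1, by positivity, fun z hz => ?_⟩
  have hz' : z ∈ Metric.closedBall (0:ℂ) 1 := by simpa using hz
  have hn := Metric.isOpen_ball.mem_nhds (hsub hz')
  exact ⟨(h0.differentiableAt hn).hasDerivAt, (h1.differentiableAt hn).hasDerivAt,
    (hL1 z hz').trans (by simp), (hL2 z hz').trans (by simp)⟩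

lemma ZZ_one : ZZ 1 = Complex.exp (-1) := by unfold ZZ; rw [mul_one, zet_rho]

lemma ZZ_deriv_one : ∃ y : ℝ, 1 / 4 ≤ y ∧ Complex.exp 1 * deriv ZZ 1 = y := by
  obtain ⟨L, _, hL⟩ := ZZ_bounds
  have h1 := (hL 1 (by simp)).1
  have h2 : HasDerivAt (fun r : ℝ => Complex.exp 1 * ZZ r) (Complex.exp 1 * deriv ZZ 1) 1 :=
    HasDerivAt.comp_ofReal (z := 1) (e := fun z => Complex.exp 1 * ZZ z) (by simpa using h1.const_mul _)
  have h3 := (hasDerivAt_iff_tendsto_slope.1 h2).mono_left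
    (nhdsWithin_mono (1:ℝ) (s := Set.Iio 1) (fun x hx => ne_of_lt hx))
  have hev : ∀ᶠ r : ℝ in nhdsWithin 1 (Set.Iio 1), (slope (fun r : ℝ => Complex.exp 1 * ZZ r) 1 r).im = 0 ∧
      1 / 4 ≤ (slope (fun r : ℝ => Complex.exp 1 * ZZ r) 1 r).re := by
    filter_upwards [Ioo_mem_nhdsLT (show (0:ℝ) < 1 by norm_num)] with r hr
    obtain ⟨hi, hre⟩ := zet_real_bound hr.1.le hr.2.le
    have e1 : Complex.exp 1 * ZZ 1 = 1 := by rw [ZZ_one, ← Complex.exp_add]; simp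
    have e2 : Complex.exp 1 = (Real.exp 1 : ℂ) := by simp
    rw [slope_def_module, Complex.ofReal_one, e1]
    have e3 : (Complex.exp 1 * ZZ r) = ((Real.exp 1 * (ZZ r).re : ℝ) : ℂ) := by
      rw [e2]; apply Complex.ext
      · rw [Complex.re_ofReal_mul, Complex.ofReal_re]
      · have : (ZZ r).im = 0 := hi
        simp [this]
    rw [e3]
    have e4 : (r - 1)⁻¹ • (((Real.exp 1 * (ZZ r).re : ℝ) : ℂ) - 1) = (((r - 1)⁻¹ * (Real.exp 1 * (ZZ r).re - 1) : ℝ) : ℂ) := by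
      simp
    rw [e4]
    refine ⟨Complex.ofReal_im _, ?_⟩
    rw [Complex.ofReal_re, inv_mul_eq_div, le_div_iff_of_neg (by linarith [hr.2])]
    have : Real.exp 1 * (ZZ r).re ≤ 1 - (1 - r) / 4 := hre
    linarith
  refine ⟨(Complex.exp 1 * deriv ZZ 1).re, ?_, ?_⟩
  · exact ge_of_tendsto ((Complex.continuous_re.tendsto _).comp h3) (hev.mono fun r h => h.2)
  · have : (Complex.exp 1 * deriv ZZ 1).im = 0 :=
      tendsto_nhds_unique ((Complex.continuous_im.tendsto _).comp h3)
        (tendsto_const_nhds.congr' (hev.mono fun r h => h.1.symm))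
    apply Complex.ext <;> simp [this]

lemma disc_lip {f f' : ℂ → ℂ} {L : ℝ} (h : ∀ z, ‖z‖ ≤ 1 → HasDerivAt f (f' z) z) (hL : ∀ z, ‖z‖ ≤ 1 → ‖f' z‖ ≤ L)
    {z w : ℂ} (hz : ‖z‖ ≤ 1) (hw : ‖w‖ ≤ 1) : ‖f w - f z‖ ≤ L * ‖w - z‖ :=
  (convex_closedBall (0:ℂ) 1).norm_image_sub_le_of_norm_hasDerivWithin_le
    (fun x hx => (h x (by simpa using hx)).hasDerivWithinAt) (fun x hx => hL x (by simpa using hx))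
    (by simpa using hz) (by simpa using hw)

lemma exp_taylor (d : ℂ) (hd : ‖d‖ ≤ 2) : ‖1 - (1 + d) * Complex.exp (-d) - d ^ 2 / 2‖ ≤ 30 * ‖d‖ ^ 3 := by
  have h := Complex.norm_exp_sub_sum_le_norm_mul_exp (-d) 3
  simp only [Finset.sum_range_succ, Finset.sum_range_zero, norm_neg] at h
  have he : Real.exp ‖d‖ ≤ 9 := by
    calc Real.exp ‖d‖ ≤ Real.exp 2 := Real.exp_le_exp.2 hd
      _ = Real.exp 1 ^ 2 := by rw [← Real.exp_nat_mul]; norm_num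
      _ ≤ 9 := by nlinarith [Real.exp_one_lt_d9, Real.exp_pos 1]
  set r := Complex.exp (-d) - (0 + (-d) ^ 0 / (Nat.factorial 0 : ℂ) + (-d) ^ 1 / (Nat.factorial 1 : ℂ) + (-d) ^ 2 / (Nat.factorial 2 : ℂ)) with hr
  have e : 1 - (1 + d) * Complex.exp (-d) - d ^ 2 / 2 = -((1 + d) * r) - d ^ 3 / 2 := by
    rw [hr]; simp [Nat.factorial]; ring
  rw [e]
  have h1 : ‖1 + d‖ ≤ 3 := (norm_add_le _ _).trans (by simp; linarith)
  have h3 : 0 ≤ ‖d‖ ^ 3 := by positivity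
  have h2 : ‖r‖ ≤ 9 * ‖d‖ ^ 3 := h.trans (by nlinarith)
  calc _ ≤ ‖1 + d‖ * ‖r‖ + ‖d‖ ^ 3 / 2 := by
        refine (norm_sub_le _ _).trans ?_
        rw [norm_neg, norm_mul]; simp
    _ ≤ 3 * (9 * ‖d‖ ^ 3) + ‖d‖ ^ 3 / 2 := by gcongr
    _ ≤ _ := by linarith

noncomputable def dd (z : ℂ) : ℂ := TT z - 1

lemma dd_le {z : ℂ} (hz : ‖z‖ ≤ 1) : ‖dd z‖ ≤ 2 := (norm_sub_le _ _).trans (by simpa using by linarith [norm_TT_le hz])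

lemma dd_main : ∃ y : ℝ, 1 / 4 ≤ y ∧ Complex.exp 1 * deriv ZZ 1 = y ∧ ∃ K : ℝ, 0 < K ∧ ∀ z : ℂ, ‖z‖ ≤ 1 →
    ‖dd z ^ 2 / 2 - y * (1 - z)‖ ≤ K * (‖dd z‖ ^ 3 + ‖1 - z‖ ^ 2) := by
  obtain ⟨y, hy, hy'⟩ := ZZ_deriv_one
  obtain ⟨L, hL0, hL⟩ := ZZ_bounds
  refine ⟨y, hy, hy', 30 + Real.exp 1 * L, by positivity, fun z hz => ?_⟩
  have hE : ZZ z * Complex.exp 1 = (1 + dd z) * Complex.exp (- dd z) := by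
    have := TT_eq hz
    have e1 : 1 + dd z = TT z := by simp [dd]
    have e2 : - dd z = 1 - TT z := by simp [dd]
    rw [e1, e2]; nth_rw 1 [this]; rw [mul_assoc, ← Complex.exp_add]; simp [ZZ]
  have h1 : ‖ZZ z - ZZ 1 - deriv ZZ 1 * (z - 1)‖ ≤ L * ‖1 - z‖ ^ 2 := by
    have hseg : ∀ w ∈ segment ℝ (1:ℂ) z, ‖w‖ ≤ 1 ∧ ‖w - 1‖ ≤ ‖1 - z‖ := by
      intro w hw
      refine ⟨?_, ?_⟩
      · have := (convex_closedBall (0:ℂ) 1).segment_subset (by simp) (by simpa using hz) hw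
        simpa using this
      · have := (convex_closedBall (1:ℂ) ‖1 - z‖).segment_subset (by simp) (by simp [dist_eq_norm, norm_sub_rev]) hw
        simpa [dist_eq_norm] using this
    have := (convex_segment (1:ℂ) z).norm_image_sub_le_of_norm_hasDerivWithin_le
      (f := fun w => ZZ w - deriv ZZ 1 * w) (f' := fun w => deriv ZZ w - deriv ZZ 1 * 1) (C := L * ‖1 - z‖)
      (fun w hw => ((hL w (hseg w hw).1).1.sub ((hasDerivAt_id w).const_mul _)).hasDerivWithinAt)
      (fun w hw => by
        rw [mul_one]
        refine (disc_lip (f := deriv ZZ) (fun z hz => (hL z hz).2.1) (fun z hz => (hL z hz).2.2.2) (z := 1) (by simp) (hseg w hw).1).trans ?_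
        exact mul_le_mul_of_nonneg_left (hseg w hw).2 hL0.le)
      (left_mem_segment ℝ (1:ℂ) z) (right_mem_segment ℝ (1:ℂ) z)
    calc _ = ‖ZZ z - deriv ZZ 1 * z - (ZZ 1 - deriv ZZ 1 * 1)‖ := by ring_nf
      _ ≤ L * ‖1 - z‖ * ‖z - 1‖ := this
      _ = _ := by rw [norm_sub_rev z]; ring
  have h2 := exp_taylor (dd z) (dd_le hz)
  have e1 : ZZ 1 * Complex.exp 1 = 1 := by rw [ZZ_one, ← Complex.exp_add]; simp
  have e : dd z ^ 2 / 2 - y * (1 - z) = -(1 - (1 + dd z) * Complex.exp (- dd z) - dd z ^ 2 / 2)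
      - Complex.exp 1 * (ZZ z - ZZ 1 - deriv ZZ 1 * (z - 1)) := by
    rw [← hE, ← hy']; linear_combination (-1) * e1
  rw [e]
  refine (norm_sub_le _ _).trans ?_
  rw [norm_neg, norm_mul]
  have e3 : ‖Complex.exp 1‖ = Real.exp 1 := by rw [Complex.norm_exp]; simp
  rw [e3]
  have : Real.exp 1 * ‖ZZ z - ZZ 1 - deriv ZZ 1 * (z - 1)‖ ≤ Real.exp 1 * (L * ‖1 - z‖ ^ 2) := by gcongr
  have p1 : 0 ≤ Real.exp 1 * L * ‖dd z‖ ^ 3 := by positivity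
  have p2 : 0 ≤ ‖1 - z‖ ^ 2 := by positivity
  nlinarith

lemma dd_cont : ContinuousOn dd (Metric.closedBall 0 1) := TT_cont.sub continuousOn_const

lemma dd_diff : DifferentiableOn ℂ dd (Metric.ball 0 1) := TT_diff.sub_const _

lemma dd_ne {z : ℂ} (hz : ‖z‖ ≤ 1) (h1 : z ≠ 1) : dd z ≠ 0 := fun h => h1 (TT_eq_one hz (sub_eq_zero.1 h))

lemma dd_two_sided : ∃ K : ℝ, 0 < K ∧ ∀ z : ℂ, ‖z‖ ≤ 1 → ‖1 - z‖ ≤ K * ‖dd z‖ ^ 2 ∧ ‖dd z‖ ^ 2 ≤ K * ‖1 - z‖ := by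
  obtain ⟨y, hy, -, K, hK, hm⟩ := dd_main
  -- small d and small 1-z near 1
  have hc := dd_cont 1 (by simp)
  have hd1 : dd 1 = 0 := by simp [dd, TT_one]
  rw [ContinuousWithinAt, hd1, Metric.tendsto_nhdsWithin_nhds] at hc
  obtain ⟨δ, hδ, hc⟩ := hc (1 / (4 * K)) (by positivity)
  set δ' := min δ (1 / (8 * K)) with hδ'
  have hδ'0 : 0 < δ' := by positivity
  -- away from 1
  have hcomp : IsCompact (Metric.closedBall (0:ℂ) 1 ∩ {z | δ' ≤ ‖1 - z‖}) :=
    (isCompact_closedBall _ _).inter_right (isClosed_le continuous_const (by fun_prop))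
  obtain ⟨B, hB⟩ := hcomp.exists_bound_of_continuousOn (f := fun z => (dd z)⁻¹) (by
    refine (dd_cont.mono Set.inter_subset_left).inv₀ fun z hz => dd_ne (by simpa using hz.1) ?_
    rintro rfl
    have := hz.2
    simp at this; linarith)
  refine ⟨max 6 (max (2 * (|B| + 1) ^ 2) (max (4 / δ') (4 * y + 1 ))) * (1 + K) , by positivity, fun z hz => ?_⟩
  set M := max 6 (max (2 * (|B| + 1) ^ 2) (max (4 / δ') (4 * y + 1 ))) with hM
  have m1 : 6 ≤ M := le_max_left _ _
  have m2 : 2 * (|B| + 1) ^ 2 ≤ M := (le_max_left _ _).trans (le_max_right _ _)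
  have m3 : 4 / δ' ≤ M := (le_max_left _ _).trans ((le_max_right _ _).trans (le_max_right _ _))
  have m4 : 4 * y + 1 ≤ M := (le_max_right _ _).trans ((le_max_right _ _).trans (le_max_right _ _))
  have n1 := norm_nonneg (1 - z)
  have n2 := norm_nonneg (dd z)
  have h2 := dd_le hz
  have h3 : ‖1 - z‖ ≤ 2 := (norm_sub_le _ _).trans (by simpa using by linarith)
  by_cases hz1 : ‖1 - z‖ < δ'
  · have hd : ‖dd z‖ < 1 / (4 * K) := by
      have := hc (x := z) (by simpa using hz) (by rw [dist_comm, dist_eq_norm]; exact hz1.trans_le (min_le_left _ _))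
      simpa using this
    have h8 : ‖1 - z‖ < 1 / (8 * K) := hz1.trans_le (min_le_right _ _)
    rw [lt_div_iff₀ (by positivity)] at hd h8
    have h := hm z hz
    have a1 : ‖dd z‖ ^ 2 / 2 ≤ y * ‖1 - z‖ + K * (‖dd z‖ ^ 3 + ‖1 - z‖ ^ 2) := by
      have := (norm_sub_norm_le (dd z ^ 2 / 2) (y * (1 - z))).trans h
      rw [norm_mul, Complex.norm_real, Real.norm_of_nonneg (by linarith), norm_div, norm_pow] at this
      simp at this; linarith
    have a2 : y * ‖1 - z‖ ≤ ‖dd z‖ ^ 2 / 2 + K * (‖dd z‖ ^ 3 + ‖1 - z‖ ^ 2) := by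
      have := (norm_sub_norm_le (y * (1 - z)) (dd z ^ 2 / 2))
      rw [norm_sub_rev] at this
      replace this := this.trans h
      rw [norm_mul, Complex.norm_real, Real.norm_of_nonneg (by linarith), norm_div, norm_pow] at this
      simp at this; linarith
    have b1 : K * ‖dd z‖ ^ 3 ≤ ‖dd z‖ ^ 2 / 4 := by nlinarith [sq_nonneg ‖dd z‖]
    have b2 : K * ‖1 - z‖ ^ 2 ≤ ‖1 - z‖ / 8 := by nlinarith
    have c1 : ‖1 - z‖ ≤ 6 * ‖dd z‖ ^ 2 := by nlinarith
    have c2 : ‖dd z‖ ^ 2 ≤ (4 * y + 1) * ‖1 - z‖ := by nlinarith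
    refine ⟨c1.trans ?_, c2.trans ?_⟩
    · gcongr; nlinarith
    · gcongr; nlinarith
  · rw [not_lt] at hz1
    have hne : dd z ≠ 0 := dd_ne hz (by rintro rfl; simp at hz1; linarith)
    have hb := hB z ⟨by simpa using hz, hz1⟩
    rw [norm_inv, inv_le_iff_one_le_mul₀ (norm_pos_iff.2 hne)] at hb
    have hb' : 1 ≤ (|B| + 1) * ‖dd z‖ := hb.trans (by gcongr; linarith [le_abs_self B])
    have hb2 : 1 ≤ (|B| + 1) ^ 2 * ‖dd z‖ ^ 2 := by rw [← mul_pow]; exact one_le_pow₀ hb'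
    have hM' : M ≤ M * (1 + K) := by nlinarith
    constructor
    · calc ‖1 - z‖ ≤ 2 * ((|B| + 1) ^ 2 * ‖dd z‖ ^ 2) := by linarith
        _ = 2 * (|B| + 1) ^ 2 * ‖dd z‖ ^ 2 := by ring
        _ ≤ _ := mul_le_mul_of_nonneg_right (by linarith) (by positivity)
    · calc ‖dd z‖ ^ 2 ≤ 4 / δ' * δ' := by rw [div_mul_cancel₀ _ hδ'0.ne']; nlinarith
        _ ≤ _ := mul_le_mul (by linarith) hz1 hδ'0.le (by positivity)

end IsoCLT

open scoped Classical BigOperators ContDiff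
open MeasureTheory ProbabilityTheory

namespace IsoCLT

lemma mem_Om_rho (C : ℝ) (w : ℂ) : ((rho : ℂ), w, (0:ℂ)) ∈ Om C := by
  simp only [Om, Set.mem_setOf_eq, norm_zero, mul_zero, Real.exp_zero, mul_one, Complex.norm_real,
    Real.norm_of_nonneg rho_pos.le]
  exact rho_lt_X1

lemma norm_rho_le : ‖(rho : ℂ)‖ ≤ X1 := by
  rw [Complex.norm_real, Real.norm_of_nonneg rho_pos.le]; exact rho_lt_X1.le

lemma FF_rho (c : ℕ → ℝ) : FF c rho 1 0 = 0 := by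
  rw [FF_zero c _ norm_rho_le, zet_rho, ← Complex.exp_add]; simp

lemma FW_rho (c : ℕ → ℝ) : FW c rho 1 0 = 0 := by
  rw [FW_zero c _ norm_rho_le, zet_rho, ← Complex.exp_add]; simp

lemma sing_exists {c : ℕ → ℝ} {C : ℝ} (hc : ∀ j, |c j| ≤ C) : ∃ (r τ : ℂ → ℂ) (ε : ℝ), 0 < ε ∧ r 0 = rho ∧ τ 0 = 1 ∧
    DifferentiableOn ℂ r (Metric.ball 0 ε) ∧ DifferentiableOn ℂ τ (Metric.ball 0 ε) ∧
    ∀ t, ‖t‖ < ε → FF c (r t) (τ t) t = 0 ∧ FW c (r t) (τ t) t = 0 := by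
  set p0 : ℂ × ℂ × ℂ := ((rho : ℂ), 1, 0) with hp0
  have hmem : p0 ∈ Om C := mem_Om_rho C 1
  set A : ℂ × ℂ × ℂ → ℂ := fun p => FF c p.1 p.2.1 p.2.2 with hA
  set B : ℂ × ℂ × ℂ → ℂ := fun p => FW c p.1 p.2.1 p.2.2 with hB
  have cA : ContDiffAt ℂ 1 A p0 := FF_contDiffAt hc 1 hmem
  have cB : ContDiffAt ℂ 1 B p0 := FW_contDiffAt hc 1 hmem
  have dA := (cA.differentiableAt (by simp)).hasFDerivAt
  have dB := (cB.differentiableAt (by simp)).hasFDerivAt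
  set Ph : ℂ × ℂ × ℂ → ℂ × ℂ × ℂ := fun p => (A p, B p, p.2.2) with hPh
  have cPh : ContDiffAt ℂ 1 Ph p0 := cA.prodMk (cB.prodMk (by fun_prop))
  set D : ℂ × ℂ × ℂ →L[ℂ] ℂ × ℂ × ℂ := (fderiv ℂ A p0).prod ((fderiv ℂ B p0).prod
    ((ContinuousLinearMap.snd ℂ ℂ ℂ).comp (ContinuousLinearMap.snd ℂ ℂ (ℂ × ℂ)))) with hD
  have dPh : HasFDerivAt Ph D p0 := dA.prodMk (dB.prodMk
    ((ContinuousLinearMap.snd ℂ ℂ ℂ).comp (ContinuousLinearMap.snd ℂ ℂ (ℂ × ℂ))).hasFDerivAt)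
  obtain ⟨y, hy, hy'⟩ := ZZ_deriv_one
  obtain ⟨L, _, hL⟩ := ZZ_bounds
  have hx0 : ‖(rho:ℂ)‖ * Real.exp (C * ‖(0:ℂ)‖) ≤ X1 := le_of_lt (mem_Om_rho C 1)
  have A1 : fderiv ℂ A p0 (rho, 0, 0) = - (y : ℂ) := by
    have h1 : HasDerivAt (fun z : ℂ => A ((rho : ℂ) * z, 1, 0)) (fderiv ℂ A p0 (rho, 0, 0)) 1 := by
      have h2 : HasDerivAt (fun z : ℂ => ((rho : ℂ) * z, (1:ℂ), (0:ℂ))) ((rho : ℂ), (0:ℂ), (0:ℂ)) 1 := by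
        refine HasDerivAt.prodMk (by simpa using (hasDerivAt_id (1:ℂ)).const_mul (rho : ℂ))
          ((hasDerivAt_const _ _).prodMk (hasDerivAt_const _ _))
      have e : p0 = ((rho : ℂ) * 1, (1:ℂ), (0:ℂ)) := by simp [hp0]
      rw [e] at dA ⊢
      exact dA.comp_hasDerivAt 1 h2
    have h3 : HasDerivAt (fun z : ℂ => 1 - ZZ z * Complex.exp 1) (- (y : ℂ)) 1 := by
      have := ((hL 1 (by simp)).1.mul_const (Complex.exp 1)).const_sub 1
      rwa [mul_comm, hy'] at this
    refine h1.unique (h3.congr_of_eventuallyEq ?_)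
    obtain ⟨R, hR1, hR⟩ := exists_R
    filter_upwards [Metric.isOpen_ball.mem_nhds (show (1:ℂ) ∈ Metric.ball 0 R by simpa using hR1)] with z hz
    simp only [hA]
    rw [FF_zero c _ (hR z (by simpa using hz)).le]; rfl
  have A2 : fderiv ℂ A p0 (0, 1, 0) = 0 := by
    have h2 : HasDerivAt (fun w : ℂ => ((rho : ℂ), w, (0:ℂ))) ((0 : ℂ), (1:ℂ), (0:ℂ)) 1 :=
        (hasDerivAt_const _ _).prodMk ((hasDerivAt_id _).prodMk (hasDerivAt_const _ _))
    have h1 := dA.comp_hasDerivAt 1 h2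
    have h3 := FF_hasDerivAt_w hc 1 hx0
    rw [FW_rho] at h3
    exact h1.unique h3
  have B2 : fderiv ℂ B p0 (0, 1, 0) = -1 := by
    have h2 : HasDerivAt (fun w : ℂ => ((rho : ℂ), w, (0:ℂ))) ((0 : ℂ), (1:ℂ), (0:ℂ)) 1 :=
        (hasDerivAt_const _ _).prodMk ((hasDerivAt_id _).prodMk (hasDerivAt_const _ _))
    have h1 := dB.comp_hasDerivAt 1 h2
    have h3 := FW_hasDerivAt_w hc 1 hx0
    rw [Ssum_zero c 2 _ norm_rho_le, zet_rho, ← Complex.exp_add] at h3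
    simpa using h1.unique h3
  have hinj : Function.Injective (D : ℂ × ℂ × ℂ →ₗ[ℂ] ℂ × ℂ × ℂ) := by
    rw [← LinearMap.ker_eq_bot, LinearMap.ker_eq_bot']
    rintro ⟨a, b, e⟩ h
    have h' : (fderiv ℂ A p0 (a, b, e), fderiv ℂ B p0 (a, b, e), e) = ((0:ℂ), (0:ℂ), (0:ℂ)) := h
    simp only [Prod.mk.injEq] at h'
    obtain ⟨ha, hb, rfl⟩ := h'
    have hrho : (rho : ℂ) ≠ 0 := by exact_mod_cast rho_pos.ne'
    have hyne : (y : ℂ) ≠ 0 := by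
      have : y ≠ 0 := by linarith
      exact_mod_cast this
    have e1 : ((a, b, 0) : ℂ × ℂ × ℂ) = (a / rho) • ((rho : ℂ), (0:ℂ), (0:ℂ)) + b • ((0:ℂ), (1:ℂ), (0:ℂ)) := by
      simp [div_mul_cancel₀ _ hrho]
    rw [e1, map_add, map_smul, map_smul, A1, A2] at ha
    have ha0 : a = 0 := by simpa [hrho, hyne] using ha
    rw [e1, map_add, map_smul, map_smul, B2, ha0] at hb
    have hb0 : b = 0 := by simpa using hb
    simp [ha0, hb0]
  set E : (ℂ × ℂ × ℂ) ≃L[ℂ] (ℂ × ℂ × ℂ) := (LinearEquiv.ofInjectiveEndo _ hinj).toContinuousLinearEquiv with hE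
  have hED : (E : ℂ × ℂ × ℂ →L[ℂ] ℂ × ℂ × ℂ) = D := by ext <;> rfl
  rw [← hED] at dPh
  set G := cPh.toOpenPartialHomeomorph Ph dPh one_ne_zero with hG
  have himg : Ph p0 = (0, 0, 0) := by
    simp only [hPh, hA, hB, hp0]; rw [FF_rho, FW_rho]
  have hinv := cPh.to_localInverse dPh one_ne_zero
  have hright := cPh.toOpenPartialHomeomorph_coe dPh one_ne_zero
  have htgt : (0, 0, 0) ∈ G.target := himg ▸ cPh.image_mem_toOpenPartialHomeomorph_target dPh one_ne_zero
  set I := cPh.localInverse dPh one_ne_zero with hI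
  have hI0 : I (0, 0, 0) = p0 := himg ▸ cPh.localInverse_apply_image dPh one_ne_zero
  rw [himg] at hinv
  have hev1 : ∀ᶠ t : ℂ in nhds 0, (0, 0, t) ∈ G.target :=
    (show Continuous fun t : ℂ => ((0:ℂ), (0:ℂ), t) by fun_prop).continuousAt.eventually
      (G.open_target.mem_nhds htgt)
  have hcd : ContDiffAt ℂ 1 (fun t : ℂ => I (0, 0, t)) 0 :=
    ContDiffAt.comp (0:ℂ) (g := I) (f := fun t : ℂ => ((0:ℂ), (0:ℂ), t)) hinv (by fun_prop)
  have hev2 := hcd.eventually (by simp)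
  obtain ⟨ε, hε, hball⟩ := Metric.eventually_nhds_iff_ball.1 (hev1.and hev2)
  refine ⟨fun t => (I (0, 0, t)).1, fun t => (I (0, 0, t)).2.1, ε, hε, by simp [hI0, hp0], by simp [hI0, hp0], ?_, ?_, ?_⟩
  · intro t ht
    exact (((hball t ht).2.differentiableAt (by simp)).fst).differentiableWithinAt
  · intro t ht
    exact (((hball t ht).2.differentiableAt (by simp)).snd.fst).differentiableWithinAt
  · intro t ht
    have h := G.right_inv (hball t (by simpa using ht)).1
    have h' : Ph (I (0, 0, t)) = (0, 0, t) := h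
    simp only [hPh, Prod.mk.injEq, hA, hB] at h'
    obtain ⟨h1, h2, h3⟩ := h'
    rw [h3] at h1 h2
    exact ⟨h1, h2⟩

end IsoCLT

open scoped Classical BigOperators ContDiff
open MeasureTheory ProbabilityTheory

namespace IsoCLT

structure Pkg (P : ℂ × ℂ × ℂ → ℂ) (ε L : ℝ) : Prop where
  ε_pos : 0 < ε
  L_pos : 0 < L
  cd : ∀ z v t : ℂ, ‖z‖ ≤ 1 → ‖v‖ ≤ 4 → ‖t‖ ≤ ε → ContDiffAt ℂ 3 P (z, v, t)
  b1 : ∀ z v t : ℂ, ‖z‖ ≤ 1 → ‖v‖ ≤ 4 → ‖t‖ ≤ ε → ‖fderiv ℂ P (z, v, t)‖ ≤ L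
  b2 : ∀ z v t : ℂ, ‖z‖ ≤ 1 → ‖v‖ ≤ 4 → ‖t‖ ≤ ε → ‖fderiv ℂ (fderiv ℂ P) (z, v, t)‖ ≤ L
  z0 : ∀ t : ℂ, ‖t‖ ≤ ε → P (1, 0, t) = 0
  z1 : ∀ t : ℂ, ‖t‖ ≤ ε → fderiv ℂ P (1, 0, t) (0, 1, 0) = 0
  at0 : ∀ z v : ℂ, ‖z‖ ≤ 1 → P (z, v, 0) = 1 + v - ZZ z * Complex.exp (1 + v)

lemma pkg_exists {c : ℕ → ℝ} {C : ℝ} (hc : ∀ j, |c j| ≤ C) : ∃ (r τ : ℂ → ℂ) (ε L : ℝ), r 0 = rho ∧ τ 0 = 1 ∧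
    DifferentiableOn ℂ r (Metric.ball 0 (2 * ε)) ∧ DifferentiableOn ℂ τ (Metric.ball 0 (2 * ε)) ∧
    (∀ t, ‖t‖ ≤ ε → r t ≠ 0 ∧ ‖r t‖ * Real.exp (C * ‖t‖) < X1) ∧
    Pkg (fun p => FF c (r p.2.2 * p.1) (τ p.2.2 + p.2.1) p.2.2) ε L := by
  obtain ⟨r, τ, ε0, hε0, hr0, hτ0, hr, hτ, hz⟩ := sing_exists hc
  have hrc : ContinuousAt r 0 := (hr.differentiableAt (Metric.ball_mem_nhds _ hε0)).continuousAt
  have hτc : ContinuousAt τ 0 := (hτ.differentiableAt (Metric.ball_mem_nhds _ hε0)).continuousAt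
  have hev : ∀ᶠ t in nhds (0:ℂ), r t ≠ 0 ∧ ‖r t‖ * Real.exp (C * ‖t‖) < X1 := by
    refine (hrc.eventually_ne (by rw [hr0]; exact_mod_cast rho_pos.ne')).and ?_
    have : ContinuousAt (fun t => ‖r t‖ * Real.exp (C * ‖t‖)) 0 := by fun_prop
    refine this.eventually_lt continuousAt_const ?_
    rw [hr0]; exact mem_Om_rho C 0
  obtain ⟨ε1, hε1, hball⟩ := Metric.eventually_nhds_iff_ball.1 hev
  set ε := min ε0 ε1 / 2 with hε
  have hεp : 0 < ε := by positivity
  have hεa : 2 * ε ≤ ε0 := by rw [hε]; linarith [min_le_left ε0 ε1]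
  have hεb : 2 * ε ≤ ε1 := by rw [hε]; linarith [min_le_right ε0 ε1]
  have hC : 0 ≤ C := (abs_nonneg _).trans (hc 0)
  set P : ℂ × ℂ × ℂ → ℂ := fun p => FF c (r p.2.2 * p.1) (τ p.2.2 + p.2.1) p.2.2 with hP
  have hX : ∀ t, ‖t‖ ≤ ε → r t ≠ 0 ∧ ‖r t‖ * Real.exp (C * ‖t‖) < X1 := fun t ht =>
    hball t (by simp; linarith)
  have hX' : ∀ z t : ℂ, ‖z‖ ≤ 1 → ‖t‖ ≤ ε → ‖r t * z‖ * Real.exp (C * ‖t‖) < X1 := fun z t hz ht => by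
    refine lt_of_le_of_lt ?_ (hX t ht).2
    rw [norm_mul]
    exact mul_le_mul_of_nonneg_right (mul_le_of_le_one_right (norm_nonneg _) hz) (Real.exp_nonneg _)
  have hanr : ∀ t : ℂ, ‖t‖ ≤ ε → ContDiffAt ℂ 3 r t := fun t ht =>
    ((hr.analyticAt (Metric.isOpen_ball.mem_nhds (show t ∈ Metric.ball 0 ε0 by simp; linarith))).contDiffAt)
  have hanτ : ∀ t : ℂ, ‖t‖ ≤ ε → ContDiffAt ℂ 3 τ t := fun t ht =>
    ((hτ.analyticAt (Metric.isOpen_ball.mem_nhds (show t ∈ Metric.ball 0 ε0 by simp; linarith))).contDiffAt)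
  have hcd : ∀ z v t : ℂ, ‖z‖ ≤ 1 → ‖t‖ ≤ ε → ContDiffAt ℂ 3 P (z, v, t) := by
    intro z v t hz ht
    have h1 : ContDiffAt ℂ 3 (fun p : ℂ × ℂ × ℂ => (r p.2.2 * p.1, τ p.2.2 + p.2.1, p.2.2)) (z, v, t) := by
      have s2 : ContDiffAt ℂ 3 (fun p : ℂ × ℂ × ℂ => p.2.2) (z, v, t) := by fun_prop
      have a1 : ContDiffAt ℂ 3 (fun p : ℂ × ℂ × ℂ => r p.2.2) (z, v, t) :=
        ContDiffAt.comp (z, v, t) (g := r) (f := fun p : ℂ × ℂ × ℂ => p.2.2) (hanr t ht) s2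
      have a2 : ContDiffAt ℂ 3 (fun p : ℂ × ℂ × ℂ => τ p.2.2) (z, v, t) :=
        ContDiffAt.comp (z, v, t) (g := τ) (f := fun p : ℂ × ℂ × ℂ => p.2.2) (hanτ t ht) s2
      exact (a1.mul (by fun_prop)).prodMk ((a2.add (by fun_prop)).prodMk s2)
    have h2 := FF_contDiffAt hc 3 (p := (r t * z, τ t + v, t)) (hX' z t hz ht)
    exact ContDiffAt.comp (z, v, t) (g := fun p : ℂ × ℂ × ℂ => FF c p.1 p.2.1 p.2.2)
      (f := fun p : ℂ × ℂ × ℂ => (r p.2.2 * p.1, τ p.2.2 + p.2.1, p.2.2)) h2 h1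
  have hcomp : IsCompact (Metric.closedBall (0:ℂ) 1 ×ˢ (Metric.closedBall (0:ℂ) 4 ×ˢ Metric.closedBall (0:ℂ) ε)) :=
    (isCompact_closedBall _ _).prod ((isCompact_closedBall _ _).prod (isCompact_closedBall _ _))
  have hcd1 : ∀ z v t : ℂ, ‖z‖ ≤ 1 → ‖t‖ ≤ ε → ContDiffAt ℂ 2 (fderiv ℂ P) (z, v, t) := fun z v t hz ht =>
    (hcd z v t hz ht).fderiv_right (by norm_num)
  have hcd2 : ∀ z v t : ℂ, ‖z‖ ≤ 1 → ‖t‖ ≤ ε → ContDiffAt ℂ 1 (fderiv ℂ (fderiv ℂ P)) (z, v, t) := fun z v t hz ht =>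
    (hcd1 z v t hz ht).fderiv_right (by norm_num)
  obtain ⟨L1, hL1⟩ := hcomp.exists_bound_of_continuousOn (f := fderiv ℂ P) (by
    rintro ⟨z, v, t⟩ ⟨h1, h2, h3⟩
    exact (hcd1 z v t (by simpa using h1) (by simpa using h3)).continuousAt.continuousWithinAt)
  obtain ⟨L2, hL2⟩ := hcomp.exists_bound_of_continuousOn (f := fderiv ℂ (fderiv ℂ P)) (by
    rintro ⟨z, v, t⟩ ⟨h1, h2, h3⟩
    exact (hcd2 z v t (by simpa using h1) (by simpa using h3)).continuousAt.continuousWithinAt)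
  refine ⟨r, τ, ε, max (max L1 L2) 1, hr0, hτ0, hr.mono (Metric.ball_subset_ball hεa),
    hτ.mono (Metric.ball_subset_ball hεa), hX, hεp, by positivity, fun z v t h1 _ h3 => hcd z v t h1 h3, ?_, ?_, ?_, ?_, ?_⟩
  · intro z v t h1 h2 h3
    exact (hL1 (z, v, t) ⟨by simpa using h1, by simpa using h2, by simpa using h3⟩).trans (by simp)
  · intro z v t h1 h2 h3
    exact (hL2 (z, v, t) ⟨by simpa using h1, by simpa using h2, by simpa using h3⟩).trans (by simp)
  · intro t ht
    simpa using (hz t (by linarith)).1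
  · intro t ht
    have h1 := ((hcd 1 0 t (by simp) ht).differentiableAt (by simp)).hasFDerivAt
    have h2 : HasDerivAt (fun w : ℂ => ((1 : ℂ), w, t)) ((0 : ℂ), (1:ℂ), (0:ℂ)) 0 :=
        (hasDerivAt_const _ _).prodMk ((hasDerivAt_id _).prodMk (hasDerivAt_const _ _))
    have h3 := h1.comp_hasDerivAt 0 h2
    have h4 := FF_hasDerivAt_w hc (τ t + 0) (hX' 1 t (by simp) ht).le
    have h5 := h4.comp 0 ((hasDerivAt_id (0:ℂ)).const_add (τ t))
    have h6 := h3.unique h5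
    rw [h6]
    simpa using (hz t (by linarith)).2
  · intro z v hz
    simp only [hP, hr0, hτ0]
    rw [FF_zero c _ (by simpa [hr0] using (hX' z 0 hz (by simpa using hεp.le)).le)]
    rfl

end IsoCLT

open scoped Classical BigOperators ContDiff
open MeasureTheory ProbabilityTheory

namespace IsoCLT

lemma schwarz {f : ℂ → ℂ} {ε M : ℝ} (hf : DifferentiableOn ℂ f (Metric.ball 0 ε))
    (hM : ∀ t, ‖t‖ < ε → ‖f t‖ ≤ M) {t : ℂ} (ht : ‖t‖ < ε) : ‖f t - f 0‖ ≤ (2 * M) / ε * ‖t‖ := by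
  have hε : 0 < ε := (norm_nonneg _).trans_lt ht
  have h0 := hM 0 (by simpa using hε)
  have := Complex.dist_le_div_mul_dist_of_mapsTo_ball (f := f) (c := 0) (R₁ := ε) (R₂ := 2 * M) (z := t) hf (by
    intro s hs
    have := hM s (by simpa using hs)
    rw [Metric.mem_closedBall, dist_eq_norm]
    exact (norm_sub_le _ _).trans (by linarith)) (by simpa using ht)
  simpa [dist_eq_norm] using this

noncomputable def Pv (P : ℂ × ℂ × ℂ → ℂ) (z v t : ℂ) : ℂ := fderiv ℂ P (z, v, t) (0, 1, 0)
noncomputable def Pz (P : ℂ × ℂ × ℂ → ℂ) (z v t : ℂ) : ℂ := fderiv ℂ P (z, v, t) (1, 0, 0)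

variable {P : ℂ × ℂ × ℂ → ℂ} {ε L : ℝ}

lemma Pkg.hasF (pk : Pkg P ε L) {z v t : ℂ} (hz : ‖z‖ ≤ 1) (hv : ‖v‖ ≤ 4) (ht : ‖t‖ ≤ ε) :
    HasFDerivAt P (fderiv ℂ P (z, v, t)) (z, v, t) :=
  ((pk.cd z v t hz hv ht).differentiableAt (by simp)).hasFDerivAt

lemma Pkg.hasF2 (pk : Pkg P ε L) {z v t : ℂ} (hz : ‖z‖ ≤ 1) (hv : ‖v‖ ≤ 4) (ht : ‖t‖ ≤ ε) :
    HasFDerivAt (fderiv ℂ P) (fderiv ℂ (fderiv ℂ P) (z, v, t)) (z, v, t) :=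
  (((pk.cd z v t hz hv ht).fderiv_right (m := 1) (by norm_num)).differentiableAt (by simp)).hasFDerivAt

lemma Pkg.hasDerivAt_v (pk : Pkg P ε L) {z v t : ℂ} (hz : ‖z‖ ≤ 1) (hv : ‖v‖ ≤ 4) (ht : ‖t‖ ≤ ε) :
    HasDerivAt (fun v => P (z, v, t)) (Pv P z v t) v :=
  (pk.hasF hz hv ht).comp_hasDerivAt v
    ((hasDerivAt_const v z).prodMk ((hasDerivAt_id v).prodMk (hasDerivAt_const v t)))

lemma Pkg.lip (pk : Pkg P ε L) {E : Type} [NormedAddCommGroup E] [NormedSpace ℂ E] {f : ℂ × ℂ × ℂ → E}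
    (hf : ∀ z v t : ℂ, ‖z‖ ≤ 1 → ‖v‖ ≤ 4 → ‖t‖ ≤ ε → HasFDerivAt f (fderiv ℂ f (z, v, t)) (z, v, t))
    (hb : ∀ z v t : ℂ, ‖z‖ ≤ 1 → ‖v‖ ≤ 4 → ‖t‖ ≤ ε → ‖fderiv ℂ f (z, v, t)‖ ≤ L)
    {z v t : ℂ} (hz : ‖z‖ ≤ 1) (hv : ‖v‖ ≤ 4) (ht : ‖t‖ ≤ ε) :
    ‖f (z, v, t) - f (1, 0, t)‖ ≤ L * (‖1 - z‖ + ‖v‖) := by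
  have hconv : Convex ℝ (Metric.closedBall (0:ℂ) 1 ×ˢ (Metric.closedBall (0:ℂ) 4 ×ˢ Metric.closedBall (0:ℂ) ε)) :=
    (convex_closedBall _ _).prod ((convex_closedBall _ _).prod (convex_closedBall _ _))
  have h := hconv.norm_image_sub_le_of_norm_hasFDerivWithin_le (𝕜 := ℂ) (f := f) (f' := fun p => fderiv ℂ f p) (C := L)
    (x := (1, 0, t)) (y := (z, v, t))
    (by rintro ⟨z, v, t⟩ ⟨h1, h2, h3⟩
        exact (hf z v t (by simpa using h1) (by simpa using h2) (by simpa using h3)).hasFDerivWithinAt)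
    (by rintro ⟨z, v, t⟩ ⟨h1, h2, h3⟩
        exact hb z v t (by simpa using h1) (by simpa using h2) (by simpa using h3))
    (by simp [ht]) (by simp [hz, hv, ht])
  refine h.trans ?_
  refine mul_le_mul_of_nonneg_left ?_ pk.L_pos.le
  have : ((z, v, t) : ℂ × ℂ × ℂ) - (1, 0, t) = (z - 1, v, 0) := by simp
  rw [this, Prod.norm_def, Prod.norm_def, norm_sub_rev]
  simp

lemma Pkg.pv_le (pk : Pkg P ε L) {z v t : ℂ} (hz : ‖z‖ ≤ 1) (hv : ‖v‖ ≤ 4) (ht : ‖t‖ ≤ ε) :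
    ‖Pv P z v t‖ ≤ L * (‖1 - z‖ + ‖v‖) := by
  have h := pk.lip (f := fderiv ℂ P) (fun z v t a b c => pk.hasF2 a b c) pk.b2 hz hv ht
  have e : Pv P z v t = (fderiv ℂ P (z, v, t) - fderiv ℂ P (1, 0, t)) (0, 1, 0) := by
    rw [sub_apply, pk.z1 t ht, sub_zero]; rfl
  rw [e]
  refine ((ContinuousLinearMap.le_opNorm _ _).trans ?_).trans h
  have : ‖((0:ℂ), (1:ℂ), (0:ℂ))‖ = 1 := by simp [Prod.norm_def]
  rw [this, mul_one]

lemma Pkg.p_le (pk : Pkg P ε L) {z v t : ℂ} (hz : ‖z‖ ≤ 1) (hv : ‖v‖ ≤ 4) (ht : ‖t‖ ≤ ε) :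
    ‖P (z, v, t)‖ ≤ L * ‖1 - z‖ + L * (‖1 - z‖ + ‖v‖) * ‖v‖ := by
  have h0 := pk.lip (f := P) (fun z v t a b c => pk.hasF a b c) pk.b1 hz (v := 0) (by simp) ht
  rw [pk.z0 t ht, sub_zero, norm_zero, add_zero] at h0
  have h1 := (convex_closedBall (0:ℂ) ‖v‖).norm_image_sub_le_of_norm_hasDerivWithin_le
    (f := fun v => P (z, v, t)) (f' := fun v => Pv P z v t) (C := L * (‖1 - z‖ + ‖v‖)) (x := 0) (y := v)
    (fun w hw => (pk.hasDerivAt_v hz ((by simpa using hw : ‖w‖ ≤ ‖v‖).trans hv) ht).hasDerivWithinAt)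
    (fun w hw => by
      have hw' : ‖w‖ ≤ ‖v‖ := by simpa using hw
      refine (pk.pv_le hz (hw'.trans hv) ht).trans ?_
      have := pk.L_pos
      gcongr) (by simp) (by simp)
  rw [sub_zero] at h1
  calc ‖P (z, v, t)‖ = ‖P (z, 0, t) + (P (z, v, t) - P (z, 0, t))‖ := by ring_nf
    _ ≤ _ := (norm_add_le _ _).trans (add_le_add h0 h1)

lemma TT_ZZ {z : ℂ} (hz : ‖z‖ ≤ 1) : TT z = ZZ z * Complex.exp (TT z) := TT_eq hz

lemma Pkg.p_at0 (pk : Pkg P ε L) {z : ℂ} (hz : ‖z‖ ≤ 1) : P (z, dd z, 0) = 0 := by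
  rw [pk.at0 z _ hz]
  have : 1 + dd z = TT z := by simp [dd]
  rw [this, ← TT_ZZ hz, sub_self]

lemma Pkg.pv_at0 (pk : Pkg P ε L) {z v : ℂ} (hz : ‖z‖ ≤ 1) (hv : ‖v‖ ≤ 4) :
    Pv P z v 0 = 1 - ZZ z * Complex.exp (1 + v) := by
  have h1 := pk.hasDerivAt_v (t := 0) hz hv (by simpa using pk.ε_pos.le)
  have e : (fun v => P (z, v, 0)) = fun v => 1 + v - ZZ z * Complex.exp (1 + v) := by
    funext v; exact pk.at0 z v hz
  rw [e] at h1
  have h2 : HasDerivAt (fun v => 1 + v - ZZ z * Complex.exp (1 + v)) (1 - ZZ z * (Complex.exp (1 + v) * 1)) v :=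
    ((hasDerivAt_id v).const_add 1).sub ((((hasDerivAt_id v).const_add 1).cexp).const_mul _)
  rw [mul_one] at h2
  exact h1.unique h2

lemma dd_mul_le {z u : ℂ} (hz : ‖z‖ ≤ 1) (hu : ‖u - 1‖ ≤ 1 / 16) : ‖dd z * u‖ ≤ 4 ∧ ‖dd z * u‖ ≤ 2 * ‖dd z‖ := by
  have : ‖u‖ ≤ 2 := by
    have := norm_add_le (u - 1) 1
    simp at this; linarith
  have h := dd_le hz
  have h0 := norm_nonneg (dd z)
  rw [norm_mul]
  constructor <;> nlinarith [norm_nonneg u]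

lemma Pkg.pv_near (pk : Pkg P ε L) {z u : ℂ} (hz : ‖z‖ < 1) (hu : ‖u - 1‖ ≤ 1 / 16) :
    ‖Pv P z (dd z * u) 0 / dd z + 1‖ ≤ 1 / 8 := by
  have hne : dd z ≠ 0 := dd_ne hz.le (by rintro rfl; simp at hz)
  rw [pk.pv_at0 hz.le (dd_mul_le hz.le hu).1]
  have e1 : 1 + dd z * u = TT z + dd z * (u - 1) := by simp [dd]; ring
  have hx : ‖dd z * (u - 1)‖ ≤ 2 * ‖u - 1‖ := by
    rw [norm_mul]; exact mul_le_mul_of_nonneg_right (dd_le hz.le) (norm_nonneg _)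
  rw [e1, Complex.exp_add, ← mul_assoc, ← TT_ZZ hz.le]
  have e2 : (1 - TT z * Complex.exp (dd z * (u - 1))) / dd z + 1
      = - (TT z * (Complex.exp (dd z * (u - 1)) - 1) / dd z) := by
    field_simp
    simp [dd]; ring
  rw [e2, norm_neg, norm_div, norm_mul, div_le_iff₀ (norm_pos_iff.2 hne)]
  have h1 := Complex.norm_exp_sub_one_le (x := dd z * (u - 1)) (by linarith)
  have h2 := norm_TT_le hz.le
  calc _ ≤ 1 * (2 * ‖dd z * (u - 1)‖) := by gcongr
    _ = 2 * ‖u - 1‖ * ‖dd z‖ := by rw [norm_mul]; ring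
    _ ≤ 1 / 8 * ‖dd z‖ := by gcongr; linarith

lemma Pkg.t_bounds (pk : Pkg P ε L) : ∃ M : ℝ, 0 < M ∧ ∀ z u t : ℂ, ‖z‖ < 1 → ‖u - 1‖ ≤ 1 / 16 → ‖t‖ < ε →
    ‖P (z, dd z * u, t) / dd z ^ 2 - P (z, dd z * u, 0) / dd z ^ 2‖ ≤ M * ‖t‖ ∧
    ‖Pv P z (dd z * u) t / dd z - Pv P z (dd z * u) 0 / dd z‖ ≤ M * ‖t‖ := by
  obtain ⟨K, hK, h2⟩ := dd_two_sided
  have hL := pk.L_pos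
  have hε := pk.ε_pos
  refine ⟨2 * (L * (5 * K + 4)) / ε, by positivity, fun z u t hz hu ht => ?_⟩
  have hne : dd z ≠ 0 := dd_ne hz.le (by rintro rfl; simp at hz)
  have hpos := norm_pos_iff.2 hne
  have hv := dd_mul_le hz.le hu
  have hk := (h2 z hz.le).1
  have hd2 := dd_le hz.le
  have hd : ‖1 - z‖ ≤ 2 * K * ‖dd z‖ := hk.trans (by nlinarith [mul_pos hK hpos])
  have hpath : ∀ s : ℂ, ‖s‖ < ε → DifferentiableAt ℂ (fun s : ℂ => ((z, dd z * u, s) : ℂ × ℂ × ℂ)) s := fun s _ => by fun_prop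
  constructor
  · refine schwarz (f := fun s => P (z, dd z * u, s) / dd z ^ 2) (M := L * (5 * K + 4)) ?_ ?_ ht
    · intro s hs
      have hs' : ‖s‖ < ε := by simpa using hs
      have := (pk.hasF hz.le hv.1 hs'.le).differentiableAt
      exact ((DifferentiableAt.comp s this (hpath s hs')).div_const _).differentiableWithinAt
    · intro s hs
      have h1 := pk.p_le hz.le hv.1 hs.le
      rw [norm_div, norm_pow, div_le_iff₀ (by positivity)]
      refine h1.trans ?_
      calc _ ≤ L * (K * ‖dd z‖ ^ 2) + L * (2 * K * ‖dd z‖ + 2 * ‖dd z‖) * (2 * ‖dd z‖) := by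
            have := hv.2
            gcongr
        _ = _ := by ring
  · refine schwarz (f := fun s => Pv P z (dd z * u) s / dd z) (M := L * (5 * K + 4)) ?_ ?_ ht
    · intro s hs
      have hs' : ‖s‖ < ε := by simpa using hs
      have h1 := (pk.hasF2 hz.le hv.1 hs'.le).differentiableAt
      have h2 : DifferentiableAt ℂ (fun s => fderiv ℂ P (z, dd z * u, s)) s := DifferentiableAt.comp s h1 (hpath s hs')
      exact ((h2.clm_apply (differentiableAt_const _)).div_const _).differentiableWithinAt
    · intro s hs
      have h1 := pk.pv_le hz.le hv.1 hs.le
      rw [norm_div, div_le_iff₀ (by positivity)]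
      refine h1.trans ?_
      calc _ ≤ L * (2 * K * ‖dd z‖ + 2 * ‖dd z‖) := by
            have := hv.2
            gcongr
        _ = L * (2 * K + 2) * ‖dd z‖ := by ring
        _ ≤ _ := by gcongr <;> linarith

lemma Pkg.newton (pk : Pkg P ε L) : ∃ ε' : ℝ, 0 < ε' ∧ ε' ≤ ε ∧ ∀ t : ℂ, ‖t‖ < ε' → ∃ u : ℂ → ℂ,
    DifferentiableOn ℂ u (Metric.ball 0 1) ∧ ∀ z : ℂ, ‖z‖ < 1 → ‖u z - 1‖ ≤ 1 / 16 ∧ P (z, dd z * u z, t) = 0 ∧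
      ‖dd z‖ / 2 ≤ ‖Pv P z (dd z * u z) t‖ ∧
      ∀ w, ‖w - 1‖ ≤ 1 / 16 → P (z, dd z * w, t) = 0 → w = u z := by
  obtain ⟨M, hM, hb⟩ := pk.t_bounds
  refine ⟨min ε (1 / (32 * M)), lt_min pk.ε_pos (by positivity), min_le_left _ _, fun t ht => ?_⟩
  have htε : ‖t‖ < ε := ht.trans_le (min_le_left _ _)
  have htM : M * ‖t‖ ≤ 1 / 32 := by
    have := ht.trans_le (min_le_right _ _)
    rw [lt_div_iff₀ (by positivity)] at this; linarith
  have hne : ∀ z : ℂ, ‖z‖ < 1 → dd z ≠ 0 := fun z hz => dd_ne hz.le (by rintro rfl; simp at hz)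
  set Θ : ℂ → ℂ → ℂ := fun z u => u + P (z, dd z * u, t) / dd z ^ 2 with hΘ
  have hpv : ∀ z u : ℂ, ‖z‖ < 1 → ‖u - 1‖ ≤ 1 / 16 → ‖1 + Pv P z (dd z * u) t / dd z‖ ≤ 1 / 4 := by
    intro z u hz hu
    have h1 := (hb z u t hz hu htε).2
    have h2 := pk.pv_near hz hu
    calc _ = ‖(Pv P z (dd z * u) t / dd z - Pv P z (dd z * u) 0 / dd z) + (Pv P z (dd z * u) 0 / dd z + 1)‖ := by ring_nf
      _ ≤ _ := (norm_add_le _ _).trans (by linarith)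
  have hlip : ∀ z u w : ℂ, ‖z‖ < 1 → ‖u - 1‖ ≤ 1 / 16 → ‖w - 1‖ ≤ 1 / 16 → ‖Θ z w - Θ z u‖ ≤ 1 / 4 * ‖w - u‖ := by
    intro z u w hz hu hw
    refine (convex_closedBall (1:ℂ) (1 / 16)).norm_image_sub_le_of_norm_hasDerivWithin_le (f := Θ z)
      (f' := fun u => 1 + Pv P z (dd z * u) t / dd z) (fun x hx => ?_) (fun x hx => ?_)
      (by simpa [dist_eq_norm] using hu) (by simpa [dist_eq_norm] using hw)
    · have hx' : ‖x - 1‖ ≤ 1 / 16 := by simpa [dist_eq_norm] using hx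
      have h1 := (pk.hasDerivAt_v hz.le (dd_mul_le hz.le hx').1 htε.le).comp x ((hasDerivAt_id x).const_mul (dd z))
      have h2 := ((hasDerivAt_id x).add (h1.div_const (dd z ^ 2))).hasDerivWithinAt (s := Metric.closedBall (1:ℂ) (1 / 16))
      have e : 1 + Pv P z (dd z * x) t / dd z = 1 + Pv P z (dd z * x) t * (dd z * 1) / dd z ^ 2 := by
        have := hne z hz
        field_simp
      rw [e]; exact h2
    · exact hpv z x hz (by simpa [dist_eq_norm] using hx)
  have h1 : ∀ z : ℂ, ‖z‖ < 1 → ‖Θ z 1 - 1‖ ≤ 1 / 32 := by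
    intro z hz
    have := (hb z 1 t hz (by simp) htε).1
    rw [mul_one, pk.p_at0 hz.le, zero_div, sub_zero] at this
    simpa [hΘ] using this.trans htM
  have hmaps : ∀ z u : ℂ, ‖z‖ < 1 → ‖u - 1‖ ≤ 1 / 16 → ‖Θ z u - 1‖ ≤ 1 / 16 := by
    intro z u hz hu
    have h2 := hlip z 1 u hz (by simp) hu
    calc _ = ‖(Θ z u - Θ z 1) + (Θ z 1 - 1)‖ := by ring_nf
      _ ≤ _ := (norm_add_le _ _).trans (by linarith [h1 z hz])
  set U : ℕ → ℂ → ℂ := fun k => Nat.rec (fun _ => 1) (fun _ f z => Θ z (f z)) k with hU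
  have hU0 : ∀ z, U 0 z = 1 := fun z => rfl
  have hUs : ∀ k z, U (k + 1) z = Θ z (U k z) := fun k z => rfl
  have hUb : ∀ k z, ‖z‖ < 1 → ‖U k z - 1‖ ≤ 1 / 16 := by
    intro k z hz
    induction k with
    | zero => simp [hU0]
    | succ k ih => rw [hUs]; exact hmaps z _ hz ih
  have hUd : ∀ k, DifferentiableOn ℂ (U k) (Metric.ball 0 1) := by
    intro k
    induction k with
    | zero => exact differentiableOn_const 1
    | succ k ih =>
      intro z hz
      have hz' : ‖z‖ < 1 := by simpa using hz
      have hd := dd_diff.differentiableAt (Metric.isOpen_ball.mem_nhds hz)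
      have hu := ih.differentiableAt (Metric.isOpen_ball.mem_nhds hz)
      have hP := (pk.hasF hz'.le (dd_mul_le hz'.le (hUb k z hz')).1 htε.le).differentiableAt
      have hpath : DifferentiableAt ℂ (fun z : ℂ => ((z, dd z * U k z, t) : ℂ × ℂ × ℂ)) z :=
        differentiableAt_id.prodMk ((hd.mul hu).prodMk (differentiableAt_const _))
      exact (hu.add ((DifferentiableAt.comp z hP hpath).div (hd.pow 2) (pow_ne_zero 2 (hne z hz')))).differentiableWithinAt
  have hstep : ∀ z, ‖z‖ < 1 → ∀ k, dist (U k z) (U (k + 1) z) ≤ 1 / 32 * (1 / 4) ^ k := by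
    intro z hz k
    rw [dist_comm, dist_eq_norm]
    induction k with
    | zero => simpa [hUs, hU0] using h1 z hz
    | succ k ih =>
      have h := hlip z (U k z) (U (k + 1) z) hz (hUb k z hz) (hUb (k + 1) z hz)
      rw [← hUs k, ← hUs (k + 1)] at h
      rw [pow_succ]; linarith
  have hcau : ∀ z, ‖z‖ < 1 → ∃ u, Filter.Tendsto (fun k => U k z) Filter.atTop (nhds u) := fun z hz =>
    cauchySeq_tendsto_of_complete (cauchySeq_of_le_geometric _ _ (by norm_num) (hstep z hz))
  choose! u hu using hcau
  have hdist : ∀ z, ‖z‖ < 1 → ∀ k, dist (U k z) (u z) ≤ 1 / 32 * (1 / 4) ^ k / (1 - 1 / 4) := fun z hz k =>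
    dist_le_of_le_geometric_of_tendsto _ _ (by norm_num) (hstep z hz) (hu z hz) k
  have hgeo : Filter.Tendsto (fun k : ℕ => 1 / 32 * (1 / 4 : ℝ) ^ k / (1 - 1 / 4)) Filter.atTop (nhds 0) := by
    have := ((tendsto_pow_atTop_nhds_zero_of_lt_one (r := (1 / 4 : ℝ)) (by norm_num) (by norm_num)).const_mul (1 / 32)).div_const (1 - 1 / 4)
    simpa using this
  have hunif : TendstoUniformlyOn U u Filter.atTop (Metric.ball 0 1) := by
    rw [Metric.tendstoUniformlyOn_iff]
    intro e he
    filter_upwards [hgeo.eventually_lt_const he] with k hk z hz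
    rw [dist_comm]
    exact (hdist z (by simpa using hz) k).trans_lt hk
  have hub : ∀ z, ‖z‖ < 1 → ‖u z - 1‖ ≤ 1 / 16 := fun z hz =>
    le_of_tendsto ((hu z hz).sub_const 1).norm (Filter.Eventually.of_forall fun k => hUb k z hz)
  refine ⟨u, hunif.tendstoLocallyUniformlyOn.differentiableOn (Filter.Eventually.of_forall hUd) Metric.isOpen_ball,
    fun z hz => ?_⟩
  have hfix : Θ z (u z) = u z := by
    have ha : Filter.Tendsto (fun k => Θ z (U k z)) Filter.atTop (nhds (Θ z (u z))) := by
      rw [tendsto_iff_norm_sub_tendsto_zero]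
      refine squeeze_zero (fun _ => norm_nonneg _) (fun k => hlip z _ _ hz (hub z hz) (hUb k z hz)) ?_
      have h4 := (tendsto_iff_norm_sub_tendsto_zero.1 (hu z hz)).const_mul (1 / 4)
      rwa [mul_zero] at h4
    exact tendsto_nhds_unique ha ((hu z hz).comp (Filter.tendsto_add_atTop_nat 1))
  have hzero : ∀ w, P (z, dd z * w, t) = 0 ↔ Θ z w = w := by
    intro w
    simp only [hΘ]
    rw [add_eq_left, div_eq_zero_iff]
    simp [hne z hz]
  refine ⟨hub z hz, (hzero _).2 hfix, ?_, fun w hw hw0 => ?_⟩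
  · have := hpv z (u z) hz (hub z hz)
    have hp := norm_pos_iff.2 (hne z hz)
    have h3 : 1 / 2 ≤ ‖Pv P z (dd z * u z) t / dd z‖ := by
      have := norm_sub_norm_le (1:ℂ) (-(Pv P z (dd z * u z) t / dd z))
      rw [sub_neg_eq_add, norm_neg, norm_one] at this; linarith
    rw [norm_div, le_div_iff₀ hp] at h3
    linarith
  · have h3 := hlip z (u z) w hz (hub z hz) hw
    rw [(hzero w).1 hw0, hfix] at h3
    have : ‖w - u z‖ = 0 := le_antisymm (by linarith) (norm_nonneg _)
    exact sub_eq_zero.1 (norm_eq_zero.1 this)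

end IsoCLT

open scoped Classical BigOperators ContDiff
open MeasureTheory ProbabilityTheory

namespace IsoCLT

variable {P : ℂ × ℂ × ℂ → ℂ} {ε L : ℝ}

lemma Pkg.second (pk : Pkg P ε L) {t : ℂ} (ht : ‖t‖ ≤ ε) {V : ℂ → ℂ} (hV : DifferentiableOn ℂ V (Metric.ball 0 1))
    (h4 : ∀ z, ‖z‖ < 1 → ‖V z‖ ≤ 4) (h0 : ∀ z, ‖z‖ < 1 → P (z, V z, t) = 0)
    (hlow : ∀ z, ‖z‖ < 1 → ‖dd z‖ / 2 ≤ ‖Pv P z (V z) t‖) {z : ℂ} (hz : ‖z‖ < 1) :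
    ‖deriv (deriv V) z‖ ≤ 16 * L ^ 2 * (1 + L) / ‖dd z‖ ^ 3 := by
  have hne : ∀ z : ℂ, ‖z‖ < 1 → dd z ≠ 0 := fun z hz => dd_ne hz.le (by rintro rfl; simp at hz)
  have hBne : ∀ z, ‖z‖ < 1 → Pv P z (V z) t ≠ 0 := fun z hz h => by
    have h1 := hlow z hz
    rw [h, norm_zero] at h1
    linarith [norm_pos_iff.2 (hne z hz)]
  have hVd : ∀ z, ‖z‖ < 1 → HasDerivAt V (deriv V z) z := fun z hz =>
    (hV.differentiableAt (Metric.isOpen_ball.mem_nhds (by simpa using hz))).hasDerivAt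
  have hpath : ∀ z, ‖z‖ < 1 → HasDerivAt (fun z : ℂ => ((z, V z, t) : ℂ × ℂ × ℂ)) ((1:ℂ), deriv V z, (0:ℂ)) z := fun z hz =>
    (hasDerivAt_id z).prodMk ((hVd z hz).prodMk (hasDerivAt_const z t))
  have hV1 : ∀ z, ‖z‖ < 1 → deriv V z = - (Pz P z (V z) t / Pv P z (V z) t) := by
    intro z hz
    have h1 := (pk.hasF hz.le (h4 z hz) ht).comp_hasDerivAt z (hpath z hz)
    have h2 : HasDerivAt (P ∘ fun z : ℂ => ((z, V z, t) : ℂ × ℂ × ℂ)) 0 z := by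
      refine (hasDerivAt_const z (0:ℂ)).congr_of_eventuallyEq ?_
      filter_upwards [Metric.isOpen_ball.mem_nhds (show z ∈ Metric.ball (0:ℂ) 1 by simpa using hz)] with w hw
      exact h0 w (by simpa using hw)
    have h3 := h1.unique h2
    have e : (((1:ℂ), deriv V z, (0:ℂ)) : ℂ × ℂ × ℂ) = (1, 0, 0) + deriv V z • (0, 1, 0) := by simp
    rw [e, map_add, map_smul, smul_eq_mul] at h3
    have h5 : Pz P z (V z) t + deriv V z * Pv P z (V z) t = 0 := h3
    have := hBne z hz
    field_simp
    linear_combination h5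
  have hn1 : ‖((1:ℂ), (0:ℂ), (0:ℂ))‖ = 1 := by simp [Prod.norm_def]
  have hn2 : ‖((0:ℂ), (1:ℂ), (0:ℂ))‖ = 1 := by simp [Prod.norm_def]
  have hA : ‖Pz P z (V z) t‖ ≤ L := by
    have := (ContinuousLinearMap.le_opNorm (fderiv ℂ P (z, V z, t)) (1, 0, 0)).trans_eq (by rw [hn1, mul_one])
    exact this.trans (pk.b1 z _ t hz.le (h4 z hz) ht)
  have hB : ‖Pv P z (V z) t‖ ≤ L := by
    have := (ContinuousLinearMap.le_opNorm (fderiv ℂ P (z, V z, t)) (0, 1, 0)).trans_eq (by rw [hn2, mul_one])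
    exact this.trans (pk.b1 z _ t hz.le (h4 z hz) ht)
  have hd := norm_pos_iff.2 (hne z hz)
  have hd2 := dd_le hz.le
  have hL := pk.L_pos
  have hlow' := hlow z hz
  have hBpos : 0 < ‖Pv P z (V z) t‖ := norm_pos_iff.2 (hBne z hz)
  have hV1n : ‖deriv V z‖ ≤ 2 * L / ‖dd z‖ := by
    rw [hV1 z hz, norm_neg, norm_div, div_le_div_iff₀ hBpos hd]
    nlinarith
  set F := fderiv ℂ (fderiv ℂ P) (z, V z, t) ((1:ℂ), deriv V z, (0:ℂ)) with hF
  have hFd : HasDerivAt (fun z => fderiv ℂ P (z, V z, t)) F z :=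
    (pk.hasF2 hz.le (h4 z hz) ht).comp_hasDerivAt z (hpath z hz)
  have hFn : ‖F‖ ≤ L * ((2 + 2 * L) / ‖dd z‖) := by
    refine (ContinuousLinearMap.le_opNorm _ _).trans ?_
    refine mul_le_mul (pk.b2 z _ t hz.le (h4 z hz) ht) ?_ (norm_nonneg _) hL.le
    have h1 : 1 ≤ 2 / ‖dd z‖ := by rw [le_div_iff₀ hd]; linarith
    have h2 : 0 ≤ 2 * L / ‖dd z‖ := by positivity
    rw [add_div, Prod.norm_def, Prod.norm_def]
    simp only [norm_one, norm_zero]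
    refine max_le (by linarith) (max_le (by linarith) (by linarith))
  have hA' : HasDerivAt (fun z => Pz P z (V z) t) (F (1, 0, 0)) z := by
    have := hFd.clm_apply (hasDerivAt_const z ((1:ℂ), (0:ℂ), (0:ℂ)))
    rw [map_zero, add_zero] at this; exact this
  have hB' : HasDerivAt (fun z => Pv P z (V z) t) (F (0, 1, 0)) z := by
    have := hFd.clm_apply (hasDerivAt_const z ((0:ℂ), (1:ℂ), (0:ℂ)))
    rw [map_zero, add_zero] at this; exact this
  have hA'n : ‖F (1, 0, 0)‖ ≤ L * ((2 + 2 * L) / ‖dd z‖) :=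
    ((ContinuousLinearMap.le_opNorm F _).trans_eq (by rw [hn1, mul_one])).trans hFn
  have hB'n : ‖F (0, 1, 0)‖ ≤ L * ((2 + 2 * L) / ‖dd z‖) :=
    ((ContinuousLinearMap.le_opNorm F _).trans_eq (by rw [hn2, mul_one])).trans hFn
  have h2 : deriv (deriv V) z = - ((F (1, 0, 0) * Pv P z (V z) t - Pz P z (V z) t * F (0, 1, 0)) / Pv P z (V z) t ^ 2) := by
    refine HasDerivAt.deriv ?_
    refine ((hA'.div hB' (hBne z hz)).neg).congr_of_eventuallyEq ?_
    filter_upwards [Metric.isOpen_ball.mem_nhds (show z ∈ Metric.ball (0:ℂ) 1 by simpa using hz)] with w hw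
    exact hV1 w (by simpa using hw)
  rw [h2, norm_neg, norm_div, norm_pow, div_le_div_iff₀ (by positivity) (by positivity)]
  have hnum : ‖F (1, 0, 0) * Pv P z (V z) t - Pz P z (V z) t * F (0, 1, 0)‖ ≤ 4 * L ^ 2 * (1 + L) / ‖dd z‖ := by
    refine (norm_sub_le _ _).trans ?_
    rw [norm_mul, norm_mul]
    calc _ ≤ L * ((2 + 2 * L) / ‖dd z‖) * L + L * (L * ((2 + 2 * L) / ‖dd z‖)) := by gcongr
      _ = _ := by ring
  calc _ ≤ 4 * L ^ 2 * (1 + L) / ‖dd z‖ * ‖dd z‖ ^ 3 := by gcongr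
    _ = 16 * L ^ 2 * (1 + L) * (‖dd z‖ / 2) ^ 2 := by field_simp; ring
    _ ≤ _ := by gcongr

noncomputable def sq (z : ℂ) : ℂ := Complex.exp (Complex.log (1 - z) / 2)

lemma sq_sq {z : ℂ} (hz : ‖z‖ < 1) : sq z ^ 2 = 1 - z := by
  have hne : 1 - z ≠ 0 := sub_ne_zero.2 (by rintro rfl; simp at hz)
  rw [sq, ← Complex.exp_nat_mul, Nat.cast_ofNat, mul_div_cancel₀ _ (by norm_num), Complex.exp_log hne]

lemma sq_ne (z : ℂ) : sq z ≠ 0 := Complex.exp_ne_zero _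

lemma sq_re {z : ℂ} (hz : ‖z‖ < 1) : ‖sq z‖ / 2 ≤ (sq z).re := by
  have h0 : 0 ≤ (sq z).re := by
    rw [sq, Complex.exp_re]
    refine mul_nonneg (Real.exp_nonneg _) (Real.cos_nonneg_of_mem_Icc ?_)
    have : (Complex.log (1 - z) / 2).im = Complex.arg (1 - z) / 2 := by
      rw [show Complex.log (1 - z) / 2 = Complex.log (1 - z) / (2 : ℝ) by simp, Complex.div_ofReal_im, Complex.log_im]
    rw [this]
    constructor
    · linarith [Complex.neg_pi_lt_arg (1 - z)]
    · linarith [Complex.arg_le_pi (1 - z)]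
  have h1 : (sq z ^ 2).re = (1 - z).re := by rw [sq_sq hz]
  have h2 : 0 ≤ (1 - z).re := by
    have := Complex.re_le_norm z
    simp; linarith
  have h3 := Complex.sq_norm (sq z)
  rw [Complex.normSq_apply] at h3
  rw [pow_two, Complex.mul_re] at h1
  have h4 : ‖sq z‖ ^ 2 ≤ (2 * (sq z).re) ^ 2 := by nlinarith
  have := abs_le_of_sq_le_sq' h4 (by positivity)
  linarith [this.2]

end IsoCLT

open scoped Classical BigOperators ContDiff
open MeasureTheory ProbabilityTheory

namespace IsoCLT

lemma ball_nhds {z : ℂ} (hz : ‖z‖ < 1) : ∀ᶠ w in nhds z, ‖w‖ < 1 := by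
  filter_upwards [Metric.isOpen_ball.mem_nhds (mem_ball_zero_iff.2 hz)] with w hw
  exact mem_ball_zero_iff.1 hw

lemma dd_deriv2 {z : ℂ} (hz : ‖z‖ < 1) : deriv (deriv dd) z =
    - (deriv (deriv ZZ) z * Complex.exp (TT z)) * (dd z)⁻¹ + (deriv ZZ z * Complex.exp (TT z)) ^ 2 * (dd z)⁻¹ ^ 2
      - (deriv ZZ z * Complex.exp (TT z)) ^ 2 * (dd z)⁻¹ ^ 3 := by
  obtain ⟨L, -, hL⟩ := ZZ_bounds
  have hne : ∀ z : ℂ, ‖z‖ < 1 → dd z ≠ 0 := fun z hz => dd_ne hz.le (by rintro rfl; simp at hz)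
  have hdd : ∀ z, ‖z‖ < 1 → HasDerivAt dd (deriv dd z) z := fun z hz =>
    (dd_diff.differentiableAt (Metric.isOpen_ball.mem_nhds (mem_ball_zero_iff.2 hz))).hasDerivAt
  have hT : ∀ z, ‖z‖ < 1 → HasDerivAt TT (deriv dd z) z := fun z hz => by
    have := (hdd z hz).add_const 1
    refine this.congr_of_eventuallyEq (Filter.Eventually.of_forall fun w => by simp [dd])
  have h1 : ∀ z, ‖z‖ < 1 → deriv dd z = - (deriv ZZ z * Complex.exp (TT z) / dd z) := by
    intro z hz
    have h2 := ((hL z hz.le).1.mul (hT z hz).cexp).congr_of_eventuallyEq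
      (f₁ := TT) ((ball_nhds hz).mono fun w hw => TT_ZZ hw.le)
    have h3 := (hT z hz).unique h2
    have e := TT_ZZ hz.le
    have := hne z hz
    have e2 : TT z = dd z + 1 := by simp [dd]
    field_simp
    rw [mul_comm (Complex.exp _) (deriv dd z), ← mul_assoc, mul_comm (ZZ z), mul_assoc, ← e] at h3
    rw [show deriv dd z * TT z = deriv dd z * (dd z + 1) by rw [← e2]] at h3
    linear_combination -h3
  have h4 := (((hL z hz.le).2.1.mul (hT z hz).cexp).div (hdd z hz) (hne z hz)).neg.congr_of_eventuallyEq
      (f₁ := deriv dd) ((ball_nhds hz).mono fun w hw => h1 w hw)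
  rw [h4.deriv, h1 z hz]
  have := hne z hz
  simp only [Pi.mul_apply]
  field_simp
  ring

open Asymptotics Filter in
lemma dd2_asymp : ∃ b K : ℝ, 0 < b ∧ 0 < K ∧ ∀ z : ℂ, ‖z‖ < 1 →
    ‖deriv (deriv dd) z - b * Complex.exp (-(3 / 2 : ℝ) * Complex.log (1 - z))‖ ≤ K / ‖1 - z‖ := by
  obtain ⟨y, hy, hy', K, hK, hm⟩ := dd_main
  obtain ⟨K2, hK2, h2s⟩ := dd_two_sided
  obtain ⟨L, hL0, hL⟩ := ZZ_bounds
  set k : ℝ := √(2 * y) with hk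
  have hk0 : 0 < k := Real.sqrt_pos.2 (by linarith)
  have hk2 : (k:ℂ) ^ 2 = 2 * y := by
    rw [← Complex.ofReal_pow, hk, Real.sq_sqrt (by linarith)]; push_cast; ring
  have hkc : (k:ℂ) ≠ 0 := by exact_mod_cast hk0.ne'
  set l : Filter ℂ := 𝓟 (Metric.ball 0 1) with hl
  have hev : ∀ᶠ z : ℂ in l, ‖z‖ < 1 := eventually_principal.2 fun z hz => mem_ball_zero_iff.1 hz
  have hne : ∀ z : ℂ, ‖z‖ < 1 → dd z ≠ 0 := fun z hz => dd_ne hz.le (by rintro rfl; simp at hz)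
  have hss : ∀ z : ℂ, ‖z‖ < 1 → ‖sq z‖ ^ 2 = ‖1 - z‖ := fun z hz => by rw [← norm_pow, sq_sq hz]
  have A0 : (fun _ => (1:ℂ)) =O[l] fun z => (sq z)⁻¹ := IsBigO.of_bound 2 <| hev.mono fun z hz => by
    have h1 := hss z hz
    have h2 : ‖1 - z‖ ≤ 2 := (norm_sub_le _ _).trans (by simpa using by linarith)
    have h3 := norm_pos_iff.2 (sq_ne z)
    rw [norm_inv, norm_one, ← div_eq_mul_inv, le_div_iff₀ h3]
    nlinarith
  have A0' : (sq : ℂ → ℂ) =O[l] fun _ => (1:ℂ) := by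
    have := A0.mul (isBigO_refl sq l)
    refine (this.congr_left fun z => one_mul _).congr_right fun z => inv_mul_cancel₀ (sq_ne z)
  have A1 : dd =O[l] sq := by
    refine IsBigO.of_pow (n := 2) two_ne_zero (IsBigO.of_bound K2 <| hev.mono fun z hz => ?_)
    simp only [Pi.pow_apply, norm_pow]; rw [hss z hz]; exact (h2s z hz.le).2
  have A1' : (fun z => (dd z)⁻¹) =O[l] fun z => (sq z)⁻¹ := by
    have : (sq : ℂ → ℂ) =O[l] dd := by
      refine IsBigO.of_pow (n := 2) two_ne_zero (IsBigO.of_bound K2 <| hev.mono fun z hz => ?_)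
      simp only [Pi.pow_apply, norm_pow]; rw [hss z hz]; exact (h2s z hz.le).1
    exact this.inv_rev (Eventually.of_forall fun z h => absurd h (sq_ne z))
  have hE : (fun z => Complex.exp (TT z)) =O[l] fun _ => (1:ℂ) := IsBigO.of_bound (Real.exp 1) <| hev.mono fun z hz => by
    rw [norm_one, mul_one, Complex.norm_exp]
    exact Real.exp_le_exp.2 ((Complex.re_le_norm _).trans (norm_TT_le hz.le))
  have hZ1 : (deriv ZZ) =O[l] fun _ => (1:ℂ) := IsBigO.of_bound L <| hev.mono fun z hz => by
    rw [norm_one, mul_one]; exact (hL z hz.le).2.2.1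
  have hZ2 : (deriv (deriv ZZ)) =O[l] fun _ => (1:ℂ) := IsBigO.of_bound L <| hev.mono fun z hz => by
    rw [norm_one, mul_one]; exact (hL z hz.le).2.2.2
  have hW : (fun z => deriv ZZ z * Complex.exp (TT z)) =O[l] fun _ => (1:ℂ) := by simpa using hZ1.mul hE
  have hs2 : (fun z : ℂ => z - 1) =O[l] sq := by
    have := A0'.mul (isBigO_refl sq l)
    refine IsBigO.trans (IsBigO.of_bound 1 <| hev.mono fun z hz => ?_) (this.congr_right fun z => one_mul _)
    rw [norm_sub_rev, one_mul, ← hss z hz, norm_mul, pow_two]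
  have A3 : (fun z => deriv ZZ z * Complex.exp (TT z) - y) =O[l] sq := by
    have h1 : (fun z => deriv ZZ z - deriv ZZ 1) =O[l] sq :=
      IsBigO.trans (IsBigO.of_bound L <| hev.mono fun z hz =>
        disc_lip (f := deriv ZZ) (fun z hz => (hL z hz).2.1) (fun z hz => (hL z hz).2.2.2) (z := 1) (by simp) hz.le) hs2
    have h2 : (fun z => Complex.exp (dd z) - 1) =O[l] sq :=
      IsBigO.trans (IsBigO.of_bound (Real.exp 2) <| hev.mono fun z hz => by
        have := Complex.norm_exp_sub_sum_le_norm_mul_exp (dd z) 1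
        simp only [Finset.sum_range_one, pow_zero, Nat.factorial_zero, Nat.cast_one, div_one, pow_one] at this
        rw [mul_comm]
        exact this.trans (by gcongr; exact dd_le hz.le)) A1
    have h3 := ((h1.mul hE).congr_right fun z => mul_one _).add (h2.const_mul_left (deriv ZZ 1 * Complex.exp 1))
    refine h3.congr_left fun z => ?_
    have e : Complex.exp (TT z) = Complex.exp 1 * Complex.exp (dd z) := by rw [← Complex.exp_add]; simp [dd]
    rw [← hy', e]; ring
  have A4 : (fun z => dd z ^ 2 - k ^ 2 * sq z ^ 2) =O[l] fun z => sq z ^ 3 := by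
    have h1 : (fun z => ‖dd z‖ ^ 3 + ‖sq z‖ ^ 4) =O[l] fun z => sq z ^ 3 := by
      refine (A1.norm_left.pow 3).add ?_
      have := A0'.norm_left.mul ((isBigO_refl sq l).norm_left.pow 3)
      exact (this.congr_left fun z => by ring).congr_right fun z => one_mul _
    refine IsBigO.trans (IsBigO.of_bound (2 * K) <| hev.mono fun z hz => ?_) h1
    have := hm z hz.le
    rw [← hss z hz, ← sq_sq hz] at this
    rw [Real.norm_of_nonneg (by positivity), show dd z ^ 2 - (k:ℂ) ^ 2 * sq z ^ 2 = 2 * (dd z ^ 2 / 2 - y * sq z ^ 2) by rw [hk2]; ring,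
      norm_mul, Complex.norm_ofNat]
    calc _ ≤ 2 * (K * (‖dd z‖ ^ 3 + (‖sq z‖ ^ 2) ^ 2)) := by gcongr
      _ = _ := by ring
  have hre : ∀ z, ‖z‖ < 1 → k / 2 * ‖sq z‖ ≤ ‖dd z - k * sq z‖ := fun z hz => by
    rw [norm_sub_rev]
    refine le_trans ?_ (Complex.re_le_norm _)
    have h1 := sq_re hz
    have h2 : (dd z).re ≤ 0 := by
      have := (Complex.re_le_norm _).trans (norm_TT_le hz.le)
      simp [dd]; linarith
    rw [Complex.sub_re, Complex.re_ofReal_mul]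
    nlinarith
  have A5i : (fun z => (dd z - k * sq z)⁻¹) =O[l] fun z => (sq z)⁻¹ := by
    have : (sq : ℂ → ℂ) =O[l] fun z => dd z - k * sq z := IsBigO.of_bound (2 / k) <| hev.mono fun z hz => by
      have := hre z hz
      rw [div_mul_eq_mul_div, le_div_iff₀ hk0]; linarith
    exact this.inv_rev (Eventually.of_forall fun z h => absurd h (sq_ne z))
  have A5 : (fun z => dd z + k * sq z) =O[l] fun z => sq z ^ 2 := by
    refine ((A4.mul A5i).congr' ?_ (Eventually.of_forall fun z => ?_))
    · filter_upwards [hev] with z hz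
      have : dd z - k * sq z ≠ 0 := norm_pos_iff.1 (lt_of_lt_of_le
        (mul_pos (by positivity) (norm_pos_iff.2 (sq_ne z))) (hre z hz))
      field_simp; ring
    · have := sq_ne z
      field_simp
  have hki : (fun z => ((k:ℂ) * sq z)⁻¹) =O[l] fun z => (sq z)⁻¹ :=
    ((isBigO_refl (fun z => (sq z)⁻¹) l).const_mul_left (k:ℂ)⁻¹).congr_left fun z => by rw [mul_inv]
  have A6 : (fun z => (dd z)⁻¹ + (k * sq z)⁻¹) =O[l] fun _ => (1:ℂ) := by
    refine (((A5.mul A1').mul hki).congr' ?_ (Eventually.of_forall fun z => ?_))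
    · filter_upwards [hev] with z hz
      have := sq_ne z
      have := hne z hz
      field_simp; ring
    · have := sq_ne z
      field_simp
  have A7 : (fun z => ((dd z)⁻¹ + (k * sq z)⁻¹) * ((dd z)⁻¹ ^ 2 - (dd z)⁻¹ * (k * sq z)⁻¹ + (k * sq z)⁻¹ ^ 2))
      =O[l] fun z => (sq z)⁻¹ ^ 2 := by
    refine (A6.mul (((A1'.pow 2).sub ((A1'.mul hki).congr_right fun z => (pow_two _).symm)).add (hki.pow 2))).congr_right fun z => one_mul _
  have B1 : (fun z => (deriv (deriv ZZ) z * Complex.exp (TT z)) * (dd z)⁻¹) =O[l] fun z => (sq z)⁻¹ ^ 2 := by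
    refine (((hZ2.mul hE).mul A1').congr_right fun z => by rw [one_mul, one_mul]).trans ?_
    exact (A0.mul (isBigO_refl (fun z => (sq z)⁻¹) l)).congr (fun z => one_mul _) fun z => (pow_two _).symm
  have B2 : (fun z => (deriv ZZ z * Complex.exp (TT z)) ^ 2 * (dd z)⁻¹ ^ 2) =O[l] fun z => (sq z)⁻¹ ^ 2 :=
    ((hW.pow 2).mul (A1'.pow 2)).congr_right fun z => by ring
  have B3 : (fun z => (deriv ZZ z * Complex.exp (TT z) - y) * (deriv ZZ z * Complex.exp (TT z) + y) * (dd z)⁻¹ ^ 3)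
      =O[l] fun z => (sq z)⁻¹ ^ 2 := by
    refine ((A3.mul (hW.add (isBigO_const_const (y:ℂ) one_ne_zero l))).mul (A1'.pow 3)).congr_right fun z => ?_
    have := sq_ne z
    field_simp
  obtain ⟨K3, hK3⟩ := isBigO_principal.1 ((B2.sub B1).sub B3 |>.sub (A7.const_mul_left ((y:ℂ) ^ 2)))
  refine ⟨y ^ 2 / k ^ 3, max K3 1, by positivity, by positivity, fun z hz => ?_⟩
  have h := hK3 z (mem_ball_zero_iff.2 hz)
  have e : Complex.exp (-(3 / 2 : ℝ) * Complex.log (1 - z)) = (sq z)⁻¹ ^ 3 := by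
    rw [sq, ← Complex.exp_neg, ← Complex.exp_nat_mul]; congr 1; push_cast; ring
  rw [e, dd_deriv2 hz, div_eq_mul_inv]
  rw [show ‖(sq z)⁻¹ ^ 2‖ = ‖1 - z‖⁻¹ by rw [norm_pow, norm_inv, inv_pow, hss z hz]] at h
  refine le_trans (le_of_eq ?_) (h.trans (mul_le_mul_of_nonneg_right (le_max_left _ _) (by positivity)))
  congr 1
  push_cast
  rw [mul_inv]
  have := sq_ne z
  have := hne z hz
  field_simp
  ring

end IsoCLT

open scoped Classical BigOperators ContDiff
open MeasureTheory ProbabilityTheory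

namespace IsoCLT

noncomputable def co (f : ℂ → ℂ) (n : ℕ) : ℂ := iteratedDeriv n f 0 / (n.factorial : ℂ)

lemma co_of_series {f : ℂ → ℂ} {p : FormalMultilinearSeries ℂ ℂ ℂ} (h : HasFPowerSeriesAt f p 0) (n : ℕ) :
    co f n = p.coeff n := by
  obtain ⟨r, hr⟩ := h
  have h1 := hr.factorial_smul (y := 1) n
  rw [iteratedFDeriv_apply_eq_iteratedDeriv_mul_prod, Finset.prod_const_one, one_smul, nsmul_eq_mul] at h1
  have h2 : (n.factorial : ℂ) ≠ 0 := by exact_mod_cast n.factorial_ne_zero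
  rw [co, ← h1, mul_div_cancel_left₀ _ h2]; rfl

lemma co_of_hasSum {f : ℂ → ℂ} {a : ℕ → ℂ} (h : ∀ᶠ z in nhds (0:ℂ), HasSum (fun n => a n * z ^ n) (f z)) (n : ℕ) :
    co f n = a n := by
  have : HasFPowerSeriesAt f (FormalMultilinearSeries.ofScalars ℂ a) 0 := by
    rw [hasFPowerSeriesAt_iff]
    filter_upwards [h] with z hz
    simpa [FormalMultilinearSeries.coeff_ofScalars, mul_comm] using hz
  rw [co_of_series this, FormalMultilinearSeries.coeff_ofScalars]

lemma co_deriv2 (f : ℂ → ℂ) (n : ℕ) : co (deriv (deriv f)) n = (n + 2) * (n + 1) * co f (n + 2) := by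
  unfold co
  have h2 : (n.factorial : ℂ) ≠ 0 := by exact_mod_cast n.factorial_ne_zero
  have h3 : (n:ℂ) + 1 ≠ 0 := by exact_mod_cast n.succ_ne_zero
  have h4 : (n:ℂ) + 2 ≠ 0 := by exact_mod_cast (n + 1).succ_ne_zero
  rw [← iteratedDeriv_succ', ← iteratedDeriv_succ', Nat.factorial_succ, Nat.factorial_succ]
  push_cast
  rw [show (n:ℂ) + 1 + 1 = n + 2 by ring]
  field_simp

lemma circle_low {r : ℝ} (hr : 1 / 2 ≤ r) (hr1 : r < 1) {θ : ℝ} (hθ : |θ| ≤ Real.pi) :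
    (1 - r) ^ 2 / 5 * (1 + ‖θ / (1 - r)‖ ^ 2) ≤ ‖1 - circleMap 0 r θ‖ ^ 2 := by
  have h1 : ‖1 - circleMap 0 r θ‖ ^ 2 = (1 - r) ^ 2 + 2 * r * (1 - Real.cos θ) := by
    rw [Complex.sq_norm, Complex.normSq_apply]
    simp only [circleMap_zero, Complex.sub_re, Complex.one_re, Complex.sub_im, Complex.one_im, Complex.re_ofReal_mul,
      Complex.im_ofReal_mul, Complex.exp_ofReal_mul_I_re, Complex.exp_ofReal_mul_I_im]
    nlinarith [Real.sin_sq_add_cos_sq θ]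
  have h2 := Real.cos_le_one_sub_mul_cos_sq hθ
  have h3 : 1 / 5 * θ ^ 2 ≤ 2 / Real.pi ^ 2 * θ ^ 2 := by
    refine mul_le_mul_of_nonneg_right ?_ (by positivity)
    rw [div_le_div_iff₀ (by norm_num) (by positivity)]
    nlinarith [Real.pi_lt_d2, Real.pi_pos]
  have h4 : (1 - r) ≠ 0 := by linarith
  have h5 : (1 - r) ^ 2 / 5 * (1 + ‖θ / (1 - r)‖ ^ 2) = (1 - r) ^ 2 / 5 + θ ^ 2 / 5 := by
    rw [Real.norm_eq_abs, sq_abs]; field_simp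
  rw [h1, h5]
  nlinarith [sq_nonneg (1 - r), sq_nonneg θ]

lemma co_bound {β : ℝ} (hβ : 1 < β) : ∃ A : ℝ, 0 < A ∧ ∀ (f : ℂ → ℂ) (K : ℝ), 0 ≤ K →
    DifferentiableOn ℂ f (Metric.ball 0 1) → (∀ z, ‖z‖ < 1 → ‖f z‖ ≤ K * ‖1 - z‖ ^ (-β)) →
    ∀ n : ℕ, ‖co f n‖ ≤ A * K * ((n:ℝ) + 2) ^ (β - 1) := by
  have hint : Integrable (fun x : ℝ => ((1:ℝ) + ‖x‖ ^ 2) ^ (-β / 2)) := integrable_rpow_neg_one_add_norm_sq (by simpa using hβ)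
  set J := ∫ x : ℝ, ((1:ℝ) + ‖x‖ ^ 2) ^ (-β / 2) with hJ
  have hJ0 : 0 ≤ J := integral_nonneg fun x => by positivity
  refine ⟨(5:ℝ) ^ (β / 2) * (J + 1) * Real.exp 1, by positivity, fun f K hK hf hb n => ?_⟩
  set δ : ℝ := 1 / (n + 2) with hδ
  have hn2 : (0:ℝ) < n + 2 := by positivity
  have hδ0 : 0 < δ := by positivity
  have hδ1 : δ ≤ 1 / 2 := one_div_le_one_div_of_le (by norm_num) (by linarith [(n.cast_nonneg : (0:ℝ) ≤ n)])
  set r : ℝ := 1 - δ with hr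
  have hr1 : r < 1 := by linarith
  have hr2 : 1 / 2 ≤ r := by linarith
  have hdr : 1 - r = δ := by rw [hr]; ring
  have hcl : ∀ θ, ‖circleMap 0 r θ‖ = r := fun θ => by simp [abs_of_nonneg (show 0 ≤ r by linarith)]
  have hps : HasFPowerSeriesAt f (cauchyPowerSeries f 0 r) 0 := by
    have : DifferentiableOn ℂ f (Metric.closedBall 0 (⟨r, by linarith⟩ : NNReal)) :=
      hf.mono (Metric.closedBall_subset_ball hr1)
    exact (this.hasFPowerSeriesOnBall (show (0:NNReal) < ⟨r, by linarith⟩ from (by exact_mod_cast (by linarith : 0 < r)))).hasFPowerSeriesAt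
  have h1 : ‖co f n‖ ≤ ((2 * Real.pi)⁻¹ * ∫ θ : ℝ in 0..2 * Real.pi, ‖f (circleMap 0 r θ)‖) * |r|⁻¹ ^ n := by
    rw [co_of_series hps]
    refine le_trans ?_ (norm_cauchyPowerSeries_le f 0 r n)
    simpa using (cauchyPowerSeries f 0 r n).le_opNorm (fun _ => 1)
  have h2 : ∫ θ : ℝ in 0..2 * Real.pi, ‖f (circleMap 0 r θ)‖ = ∫ θ : ℝ in (-Real.pi)..Real.pi, ‖f (circleMap 0 r θ)‖ := by
    have hp : Function.Periodic (fun θ : ℝ => ‖f (circleMap 0 r θ)‖) (2 * Real.pi) := fun θ => by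
      simp only [periodic_circleMap 0 r θ]
    have := hp.intervalIntegral_add_eq 0 (-Real.pi)
    rw [zero_add] at this
    rw [this]; congr 1; ring
  have hfc : Continuous fun θ : ℝ => ‖f (circleMap 0 r θ)‖ :=
    (hf.continuousOn.comp_continuous (continuous_circleMap 0 r) fun θ => by
      rw [mem_ball_zero_iff, hcl]; exact hr1).norm
  have hgi : ∀ a b : ℝ, IntervalIntegrable (fun x : ℝ => ((1:ℝ) + ‖x‖ ^ 2) ^ (-β / 2)) volume a b := fun a b => hint.intervalIntegrable
  have h3 : ∫ θ : ℝ in (-Real.pi)..Real.pi, ‖f (circleMap 0 r θ)‖ ≤ K * (δ ^ 2 / 5) ^ (-β / 2) * (δ * J) := by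
    have hg : Continuous fun θ : ℝ => ((1:ℝ) + ‖θ / δ‖ ^ 2) ^ (-β / 2) :=
      Continuous.rpow_const (by fun_prop) fun θ => Or.inl (by positivity)
    calc _ ≤ ∫ θ : ℝ in (-Real.pi)..Real.pi, K * (δ ^ 2 / 5) ^ (-β / 2) * (1 + ‖θ / δ‖ ^ 2) ^ (-β / 2) := by
          refine intervalIntegral.integral_mono_on (by linarith [Real.pi_pos]) (hfc.intervalIntegrable _ _)
            ((hg.const_mul _).intervalIntegrable _ _) fun θ hθ => ?_
          have hl := circle_low hr2 hr1 (abs_le.2 ⟨hθ.1, hθ.2⟩)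
          rw [hdr] at hl
          refine (hb _ (by rw [hcl]; exact hr1)).trans ?_
          rw [mul_assoc, ← Real.mul_rpow (by positivity) (by positivity)]
          refine mul_le_mul_of_nonneg_left ?_ hK
          have e : ‖1 - circleMap 0 r θ‖ ^ (-β) = (‖1 - circleMap 0 r θ‖ ^ 2) ^ (-β / 2) := by
            rw [← Real.rpow_natCast, ← Real.rpow_mul (norm_nonneg _)]; congr 1; push_cast; ring
          rw [e]
          exact Real.rpow_le_rpow_of_nonpos (by positivity) hl (by linarith)
      _ = K * (δ ^ 2 / 5) ^ (-β / 2) * (δ * ∫ x in (-Real.pi) / δ..Real.pi / δ, ((1:ℝ) + ‖x‖ ^ 2) ^ (-β / 2)) := by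
          rw [intervalIntegral.integral_const_mul, intervalIntegral.integral_comp_div
            (f := fun x : ℝ => ((1:ℝ) + ‖x‖ ^ 2) ^ (-β / 2)) hδ0.ne', smul_eq_mul]
      _ ≤ _ := by
          refine mul_le_mul_of_nonneg_left (mul_le_mul_of_nonneg_left ?_ hδ0.le) (by positivity)
          rw [intervalIntegral.integral_of_le (by gcongr; linarith [Real.pi_pos])]
          exact setIntegral_le_integral hint (Filter.Eventually.of_forall fun x => by positivity)
  have h4 : |r|⁻¹ ^ n ≤ Real.exp 1 := by
    have e : |r|⁻¹ = 1 + 1 / ((n:ℝ) + 1) := by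
      rw [abs_of_nonneg (by linarith), hr, hδ]
      have : (n:ℝ) + 1 ≠ 0 := by positivity
      rw [inv_eq_iff_eq_inv]
      field_simp; ring
    rw [e]
    calc _ ≤ Real.exp (1 / ((n:ℝ) + 1)) ^ n := by
          gcongr; rw [add_comm]; exact Real.add_one_le_exp _
      _ = Real.exp (n * (1 / ((n:ℝ) + 1))) := by rw [Real.exp_nat_mul]
      _ ≤ _ := Real.exp_le_exp.2 (by rw [mul_one_div, div_le_one (by positivity)]; linarith)
  have h5 : (δ ^ 2 / 5) ^ (-β / 2) * δ = (5:ℝ) ^ (β / 2) * ((n:ℝ) + 2) ^ (β - 1) := by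
    rw [Real.div_rpow (by positivity) (by positivity), ← Real.rpow_natCast, ← Real.rpow_mul hδ0.le, neg_div,
      Real.rpow_neg (by norm_num : (0:ℝ) ≤ 5), div_inv_eq_mul, mul_right_comm, mul_comm]
    congr 1
    rw [show ((2:ℕ):ℝ) * -(β / 2) = 1 - β - 1 by push_cast; ring, Real.rpow_sub_one hδ0.ne', div_mul_cancel₀ _ hδ0.ne', hδ,
      Real.div_rpow zero_le_one (by positivity), Real.one_rpow, one_div, ← Real.rpow_neg (by positivity)]
    congr 1; ring
  rw [h2] at h1
  have hpi : (2 * Real.pi)⁻¹ ≤ 1 := inv_le_one_of_one_le₀ (by linarith [Real.pi_gt_three])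
  calc ‖co f n‖ ≤ (1 * (K * (δ ^ 2 / 5) ^ (-β / 2) * (δ * J))) * Real.exp 1 := by
        refine h1.trans ?_
        refine mul_le_mul (mul_le_mul hpi h3 ?_ zero_le_one) h4 (by positivity) (by positivity)
        exact intervalIntegral.integral_nonneg (by linarith [Real.pi_pos]) fun _ _ => norm_nonneg _
    _ = (5:ℝ) ^ (β / 2) * J * Real.exp 1 * K * ((n:ℝ) + 2) ^ (β - 1) := by
        linear_combination (K * J * Real.exp 1) * h5
    _ ≤ _ := by gcongr; linarith

lemma co_pow (n : ℕ) (a : ℝ) : iteratedDeriv n (fun z : ℂ => Complex.exp (-a * Complex.log (1 - z))) 0 =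
    ∏ k ∈ Finset.range n, ((a:ℂ) + k) := by
  induction n generalizing a with
  | zero => simp
  | succ n ih =>
    rw [iteratedDeriv_succ']
    have h : deriv (fun z : ℂ => Complex.exp (-a * Complex.log (1 - z))) =ᶠ[nhds 0]
        fun z => (a:ℂ) * Complex.exp (-((a + 1 : ℝ)) * Complex.log (1 - z)) := by
      filter_upwards [ball_nhds (z := 0) (by simp)] with z hz
      have hs : 1 - z ∈ Complex.slitPlane := Or.inl (by
        have := Complex.re_le_norm z
        simp; linarith)
      have hne : 1 - z ≠ 0 := Complex.slitPlane_ne_zero hs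
      have h1 := ((((hasDerivAt_id z).const_sub 1).clog hs).const_mul (-(a:ℂ))).cexp
      simp only [id] at h1
      rw [h1.deriv]
      push_cast
      rw [neg_add, add_mul, Complex.exp_add, neg_one_mul, Complex.exp_neg (Complex.log _), Complex.exp_log hne]
      field_simp
    rw [h.iteratedDeriv_eq, iteratedDeriv_const_mul_field, ih, Finset.prod_range_succ']
    push_cast
    simp only [add_zero, add_assoc, add_comm (1:ℂ)]
    ring

lemma pow_low (n : ℕ) : √((n:ℝ) + 1) ≤ (∏ k ∈ Finset.range n, ((3 / 2 : ℝ) + k)) / n.factorial := by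
  induction n with
  | zero => simp
  | succ n ih =>
    have e : (∏ k ∈ Finset.range (n + 1), ((3 / 2 : ℝ) + k)) / (n + 1).factorial =
        (∏ k ∈ Finset.range n, ((3 / 2 : ℝ) + k)) / n.factorial * ((3 / 2 + n) / (n + 1)) := by
      rw [Finset.prod_range_succ, Nat.factorial_succ]; push_cast
      have : (n.factorial : ℝ) ≠ 0 := by exact_mod_cast n.factorial_ne_zero
      field_simp
    rw [e]
    refine le_trans ?_ (mul_le_mul_of_nonneg_right ih (by positivity))
    rw [Real.sqrt_le_left (by positivity), mul_pow, Real.sq_sqrt (by positivity), div_pow, mul_div, le_div_iff₀ (by positivity)]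
    push_cast
    nlinarith [(n.cast_nonneg : (0:ℝ) ≤ n)]

end IsoCLT

open scoped Classical BigOperators ContDiff
open MeasureTheory ProbabilityTheory

namespace IsoCLT

noncomputable def yn (c : ℕ → ℝ) (n : ℕ) (t : ℂ) : ℂ := ∑ m ∈ codes n, q c 1 t m

lemma q_hasSum {c : ℕ → ℝ} {x t : ℂ} (hs : Summable (q c x t)) :
    HasSum (fun n => yn c n t * x ^ n) (∑' m, q c x t m) := by
  have h1 := (Equiv.sigmaFiberEquiv tsize).hasSum_iff.2 hs.hasSum
  refine h1.sigma fun n => ?_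
  have h2 : HasSum (Set.indicator {m | tsize m = n} (q c x t)) (∑ m ∈ codes n, Set.indicator {m | tsize m = n} (q c x t) m) :=
    hasSum_sum_of_ne_finset_zero fun m hm => by
      by_cases h : m = 0
      · rw [h, Set.indicator_apply]; simp
      · exact Set.indicator_of_notMem (s := {m | tsize m = n}) (fun h' => hm (mem_codes.2 ⟨h, h'⟩)) (q c x t)
  have e : ∑ m ∈ codes n, Set.indicator {m | tsize m = n} (q c x t) m = yn c n t * x ^ n := by
    rw [yn, Finset.sum_mul]
    refine Finset.sum_congr rfl fun m hm => ?_
    obtain ⟨h0, h⟩ := mem_codes.1 hm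
    rw [Set.indicator_of_mem (by exact h)]
    simp only [q, if_neg h0, one_pow, h]; ring
  rw [e] at h2
  exact hasSum_subtype_iff_indicator.2 h2

lemma co_dd2 (c : ℕ → ℝ) (n : ℕ) : co (deriv (deriv dd)) n = (n + 2) * (n + 1) * (yn c (n + 2) 0 * rho ^ (n + 2)) := by
  have e : deriv dd = deriv TT := by funext z; exact deriv_sub_const 1
  rw [e, co_deriv2, co_of_hasSum (a := fun n => yn c n 0 * rho ^ n)]
  filter_upwards [ball_nhds (z := 0) (by simp)] with z hz
  have hs : Summable (q c (rho * z) 0) := (TT_summable hz.le).congr fun m => (q_rho c z m).symm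
  have := q_hasSum hs
  rw [TT_q] at this
  simpa only [mul_pow, ← mul_assoc] using this

lemma low_bound : ∃ b : ℝ, 0 < b ∧ ∀ᶠ n : ℕ in Filter.atTop, b * ((n:ℝ) + 2) ^ (1 / 2 : ℝ) ≤ ‖co (deriv (deriv dd)) n‖ := by
  obtain ⟨b, K, hb, hK, h⟩ := dd2_asymp
  obtain ⟨A, hA, hco⟩ := co_bound (β := 5 / 4) (by norm_num)
  set g : ℂ → ℂ := fun z => Complex.exp (-(3 / 2 : ℝ) * Complex.log (1 - z)) with hg
  have hgd : DifferentiableOn ℂ g (Metric.ball 0 1) := fun z hz => by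
    have hz' := mem_ball_zero_iff.1 hz
    have hs : 1 - z ∈ Complex.slitPlane := Or.inl (by
      have := Complex.re_le_norm z
      simp; linarith)
    exact ((((differentiableAt_id.const_sub 1).clog hs).const_mul _).cexp).differentiableWithinAt
  have hdd : DifferentiableOn ℂ (deriv (deriv dd)) (Metric.ball 0 1) :=
    (dd_diff.deriv Metric.isOpen_ball).deriv Metric.isOpen_ball
  have h0 : (0:ℂ) ∈ Metric.ball (0:ℂ) 1 := by simp
  have han : ∀ {f : ℂ → ℂ}, DifferentiableOn ℂ f (Metric.ball 0 1) → ∀ n : ℕ, ContDiffAt ℂ n f 0 := fun hf n =>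
    (hf.analyticAt (Metric.isOpen_ball.mem_nhds h0)).contDiffAt
  have h1 : ∀ n, ‖co (deriv (deriv dd) - fun z => (b:ℂ) * g z) n‖ ≤ A * (2 * K) * ((n:ℝ) + 2) ^ (1 / 4 : ℝ) := by
    intro n
    have := hco (deriv (deriv dd) - fun z => (b:ℂ) * g z) (2 * K) (by positivity) (hdd.sub (hgd.const_mul _)) (fun z hz => ?_) n
    · norm_num at this ⊢; exact this
    · refine (h z hz).trans ?_
      have hp : 0 < ‖1 - z‖ := norm_pos_iff.2 (sub_ne_zero.2 (by rintro rfl; simp at hz))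
      have h2 : ‖1 - z‖ ≤ 2 := (norm_sub_le _ _).trans (by simpa using by linarith)
      have e : ‖1 - z‖ ^ (-(5 / 4) : ℝ) = ‖1 - z‖ ^ (-(1 / 4) : ℝ) / ‖1 - z‖ := by
        rw [← Real.rpow_sub_one hp.ne']; norm_num
      rw [e, mul_div_assoc', mul_comm 2 K, mul_assoc]
      refine div_le_div_of_nonneg_right (le_mul_of_one_le_right hK.le ?_) hp.le
      have h3 : (2:ℝ) ^ (-(1 / 4) : ℝ) ≤ ‖1 - z‖ ^ (-(1 / 4) : ℝ) := Real.rpow_le_rpow_of_nonpos hp h2 (by norm_num)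
      have h4 : (2:ℝ) ^ (-1 : ℝ) ≤ (2:ℝ) ^ (-(1 / 4) : ℝ) := Real.rpow_le_rpow_of_exponent_le (by norm_num) (by norm_num)
      rw [Real.rpow_neg_one] at h4
      linarith
  have h2 : ∀ n : ℕ, √((n:ℝ) + 1) ≤ ‖co g n‖ := fun n => by
    refine (pow_low n).trans (le_of_eq ?_)
    rw [co, hg, co_pow, show (∏ k ∈ Finset.range n, (((3 / 2 : ℝ) : ℂ) + k)) / (n.factorial : ℂ) =
      (((∏ k ∈ Finset.range n, ((3 / 2 : ℝ) + k)) / n.factorial : ℝ) : ℂ) by push_cast; rfl, Complex.norm_real,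
      Real.norm_of_nonneg (by positivity)]
  refine ⟨b / 4, by positivity, ?_⟩
  have ht : Filter.Tendsto (fun n : ℕ => ((n:ℝ) + 2) ^ (1 / 4 : ℝ)) Filter.atTop Filter.atTop :=
    (tendsto_rpow_atTop (by norm_num)).comp
      (Filter.tendsto_atTop_add_const_right _ _ tendsto_natCast_atTop_atTop)
  filter_upwards [ht.eventually_ge_atTop (A * (2 * K) * 4 / b)] with n hn
  have e1 : co (deriv (deriv dd) - fun z => (b:ℂ) * g z) n = co (deriv (deriv dd)) n - b * co g n := by
    unfold co
    rw [iteratedDeriv_sub (han hdd n) (han (hgd.const_mul _) n), iteratedDeriv_const_mul_field]; ring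
  have h3 := h1 n
  rw [e1] at h3
  have h4 := norm_sub_norm_le ((b:ℂ) * co g n) (co (deriv (deriv dd)) n)
  rw [norm_sub_rev, norm_mul, Complex.norm_real, Real.norm_of_nonneg hb.le] at h4
  have h5 : ((n:ℝ) + 2) ^ (1 / 2 : ℝ) ≤ 2 * √((n:ℝ) + 1) := by
    rw [← Real.sqrt_eq_rpow, show (2:ℝ) = √4 by rw [show (4:ℝ) = 2 ^ 2 by norm_num]; simp, ← Real.sqrt_mul (by norm_num)]
    refine Real.sqrt_le_sqrt ?_
    rw [show √(4:ℝ) = 2 by rw [show (4:ℝ) = 2 ^ 2 by norm_num]; simp]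
    linarith [(n.cast_nonneg : (0:ℝ) ≤ n)]
  have h6 : ((n:ℝ) + 2) ^ (1 / 2 : ℝ) = ((n:ℝ) + 2) ^ (1 / 4 : ℝ) * ((n:ℝ) + 2) ^ (1 / 4 : ℝ) := by
    rw [← Real.rpow_add (by positivity)]; norm_num
  rw [div_le_iff₀ hb] at hn
  have h7 : A * (2 * K) * ((n:ℝ) + 2) ^ (1 / 4 : ℝ) ≤ b / 4 * ((n:ℝ) + 2) ^ (1 / 2 : ℝ) := by
    rw [h6]
    have : 0 < ((n:ℝ) + 2) ^ (1 / 4 : ℝ) := by positivity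
    nlinarith
  have h8 := mul_le_mul_of_nonneg_left (h2 n) hb.le
  nlinarith

lemma rho_ge : 1 / 4 ≤ rho := by
  refine le_trans ?_ (le_csSup bddAbove_Rset Rset_mem)
  rw [Real.exp_neg, one_div]
  exact inv_anti₀ (Real.exp_pos 1) (by linarith [Real.exp_one_lt_d9])

lemma thmB {c : ℕ → ℝ} {C : ℝ} (hc : ∀ j, |c j| ≤ C) : ∃ (ε B : ℝ) (lam : ℂ → ℂ), 0 < ε ∧
    DifferentiableOn ℂ lam (Metric.ball 0 ε) ∧ lam 0 = 0 ∧ ∀ᶠ n : ℕ in Filter.atTop, yn c n 0 ≠ 0 ∧ ∀ t : ℂ, ‖t‖ < ε →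
      ‖yn c n t * Complex.exp (-(n * lam t))‖ ≤ B * ‖yn c n 0‖ := by
  obtain ⟨r, τ, ε, L, hr0, hτ0, hr, hτ, hrt, pk⟩ := pkg_exists hc
  obtain ⟨ε1, hε1, hε1', hN⟩ := pk.newton
  have hε := pk.ε_pos
  obtain ⟨b, hb, hlow⟩ := low_bound
  obtain ⟨A, hA, hco⟩ := co_bound (β := 3 / 2) (by norm_num)
  obtain ⟨K, hK, h2s⟩ := dd_two_sided
  have hrho : (rho : ℂ) ≠ 0 := by exact_mod_cast rho_pos.ne'
  have hrc : ContinuousAt r 0 := (hr.differentiableAt (Metric.ball_mem_nhds _ (by positivity))).continuousAt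
  have hτc : ContinuousAt τ 0 := (hτ.differentiableAt (Metric.ball_mem_nhds _ (by positivity))).continuousAt
  set η : ℝ := √(3 / (4 * K)) with hη
  have hη0 : 0 < η := Real.sqrt_pos.2 (by positivity)
  have hηd : ∀ z : ℂ, ‖z‖ < 1 / 4 → η ≤ ‖dd z‖ := fun z hz => by
    refine (Real.sqrt_le_left (norm_nonneg _)).2 ?_
    have h1 := (h2s z (by linarith)).1
    have h2 := norm_sub_norm_le 1 z
    rw [norm_one] at h2
    rw [div_le_iff₀ (by positivity)]; nlinarith
  have hev : ∀ᶠ t in nhds (0:ℂ), ‖t‖ < ε1 ∧ ‖t‖ < ε ∧ ‖τ t - 1‖ < η / 32 ∧ 2 * 1 / ε * ‖t‖ < η / 32 ∧ r t / rho ∈ Complex.slitPlane := by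
    have hn : Filter.Tendsto (fun t : ℂ => ‖t‖) (nhds 0) (nhds 0) := by simpa using (continuous_norm (E := ℂ)).tendsto 0
    refine (hn.eventually_lt_const hε1).and ((hn.eventually_lt_const hε).and (Filter.Eventually.and ?_ (Filter.Eventually.and ?_ ?_)))
    · have : Filter.Tendsto (fun t => ‖τ t - 1‖) (nhds 0) (nhds 0) := by
        simpa [hτ0] using (hτc.sub_const 1).norm
      exact this.eventually_lt_const (by positivity)
    · have := hn.const_mul (2 * 1 / ε)
      rw [mul_zero] at this
      exact this.eventually_lt_const (by positivity)
    · refine (hrc.div_const (rho : ℂ)).eventually (Complex.isOpen_slitPlane.mem_nhds ?_)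
      show r 0 / (rho : ℂ) ∈ Complex.slitPlane
      rw [hr0, div_self hrho]; exact Complex.one_mem_slitPlane
  obtain ⟨ε2, hε2, hball⟩ := Metric.eventually_nhds_iff_ball.1 hev
  refine ⟨ε2, A * (16 * L ^ 2 * (1 + L) * K ^ (3 / 2 : ℝ)) / b, fun t => - Complex.log (r t / rho), hε2, ?_, ?_, ?_⟩
  · intro t ht
    obtain ⟨-, h2, -, -, h5⟩ := hball t ht
    exact ((((hr.differentiableAt (Metric.isOpen_ball.mem_nhds (mem_ball_zero_iff.2 (by linarith)))).div_const _).clog h5).neg).differentiableWithinAt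
  · simp [hr0, hrho]
  have key : ∀ t, ‖t‖ < ε2 → ∀ n : ℕ, ‖((n:ℂ) + 2) * (n + 1) * (yn c (n + 2) t * r t ^ (n + 2))‖ ≤
      A * (16 * L ^ 2 * (1 + L) * K ^ (3 / 2 : ℝ)) * ((n:ℝ) + 2) ^ (1 / 2 : ℝ) := by
    intro t ht n
    obtain ⟨h1, h2, h3, h4, -⟩ := hball t (mem_ball_zero_iff.2 ht)
    obtain ⟨u, hu, hu'⟩ := hN t h1
    have hVd : DifferentiableOn ℂ (fun z => dd z * u z) (Metric.ball 0 1) := dd_diff.mul hu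
    have hV'' : ∀ z, ‖z‖ < 1 → ‖deriv (deriv fun z => dd z * u z) z‖ ≤ (16 * L ^ 2 * (1 + L) * K ^ (3 / 2 : ℝ)) * ‖1 - z‖ ^ (-(3 / 2) : ℝ) := by
      intro z hz
      refine (pk.second h2.le hVd (fun z hz => (dd_mul_le hz.le (hu' z hz).1).1) (fun z hz => (hu' z hz).2.1)
        (fun z hz => (hu' z hz).2.2.1) hz).trans ?_
      have hL := pk.L_pos
      rw [div_eq_mul_inv, mul_assoc _ (K ^ (3 / 2 : ℝ))]
      refine mul_le_mul_of_nonneg_left ?_ (by positivity)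
      have hp : 0 < ‖1 - z‖ := norm_pos_iff.2 (sub_ne_zero.2 (by rintro rfl; simp at hz))
      have hd : 0 < ‖dd z‖ := norm_pos_iff.2 (dd_ne hz.le (by rintro rfl; simp at hz))
      have h6 := Real.rpow_le_rpow hp.le (h2s z hz.le).1 (show (0:ℝ) ≤ 3 / 2 by norm_num)
      rw [Real.mul_rpow hK.le (by positivity), ← Real.rpow_natCast ‖dd z‖ 2, ← Real.rpow_mul (norm_nonneg _),
        show ((2:ℕ):ℝ) * (3 / 2) = (3:ℕ) by norm_num, Real.rpow_natCast] at h6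
      rw [Real.rpow_neg hp.le, inv_le_iff_one_le_mul₀ (by positivity), mul_right_comm, ← div_eq_mul_inv, one_le_div (by positivity)]
      exact h6
    have hb1 := hco _ _ (by have := pk.L_pos; positivity) ((hVd.deriv Metric.isOpen_ball).deriv Metric.isOpen_ball) hV'' n
    have e : deriv (fun z => dd z * u z) = deriv (fun z => τ t + dd z * u z) := by funext z; exact (deriv_const_add _).symm
    rw [e, co_deriv2, co_of_hasSum (a := fun n => yn c n t * r t ^ n)] at hb1
    · norm_num at hb1 ⊢; exact hb1
    have hb4 : ∀ᶠ z in nhds (0:ℂ), ‖z‖ < 1 / 4 := by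
      filter_upwards [Metric.ball_mem_nhds (0:ℂ) (show (0:ℝ) < 1 / 4 by norm_num)] with z hz using mem_ball_zero_iff.1 hz
    filter_upwards [hb4] with z hz
    have hz1 : ‖z‖ < 1 := by linarith
    have hX : ∀ s, ‖s‖ < ε → ‖r s * z‖ * Real.exp (C * ‖s‖) ≤ rho := fun s hs => by
      rw [norm_mul, mul_right_comm]
      have := (hrt s hs.le).2.trans X1_lt_one
      have h0 : 0 ≤ ‖r s‖ * Real.exp (C * ‖s‖) := by positivity
      nlinarith [rho_ge, norm_nonneg z]
    have hqn : ∀ s, ‖s‖ < ε → ∀ m, ‖q c (r s * z) s m‖ ≤ qr rho m := fun s hs m =>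
      (norm_q_le hc _ s m).trans (qr_mono (by positivity) (hX s hs) m)
    have hSd : DifferentiableOn ℂ (fun s => ∑' m, q c (r s * z) s m) (Metric.ball 0 ε) := by
      refine Complex.differentiableOn_tsum_of_summable_norm summable_qr_rho (fun m => ?_) Metric.isOpen_ball
        fun m s hs => hqn s (mem_ball_zero_iff.1 hs) m
      have hr' := hr.mono (Metric.ball_subset_ball (show ε ≤ 2 * ε by linarith))
      unfold q
      split_ifs
      · fun_prop
      · fun_prop
    have hS1 := schwarz (M := 1) hSd (fun s hs =>
      (tsum_of_norm_bounded summable_qr_rho.hasSum (hqn s hs)).trans_eq tsum_qr_rho) h2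
    rw [hr0, TT_q] at hS1
    set S := ∑' m, q c (r t * z) t m with hS
    have hsum : HasSum (fun n => yn c n t * r t ^ n * z ^ n) S := by
      have := q_hasSum (Summable.of_norm_bounded summable_qr_rho (hqn t h2))
      simpa only [mul_pow, ← mul_assoc] using this
    have hd : dd z ≠ 0 := dd_ne hz1.le (by rintro rfl; simp at hz1)
    have hw : (S - τ t) / dd z = u z := by
      refine (hu' z hz1).2.2.2 _ ?_ ?_
      · rw [div_sub_one hd, norm_div, div_le_iff₀ (norm_pos_iff.2 hd)]
        have : S - τ t - dd z = (S - TT z) - (τ t - 1) := by simp [dd]; ring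
        rw [this]
        have := hηd z hz
        linarith [norm_sub_le (S - TT z) (τ t - 1)]
      · rw [mul_div_cancel₀ _ hd]
        show FF c (r t * z) (τ t + (S - τ t)) t = 0
        rw [add_sub_cancel, FF, hS, ← T_eq hc _ _ (hX t h2) (by linarith [rho_lt]) summable_qr_rho, sub_self]
    have : τ t + dd z * u z = S := by rw [← hw, mul_div_cancel₀ _ hd]; ring
    rw [this]; exact hsum
  obtain ⟨N, hN⟩ := Filter.eventually_atTop.1 hlow
  filter_upwards [Filter.eventually_ge_atTop (N + 2)] with n' hn'
  obtain ⟨n, rfl⟩ := Nat.exists_eq_add_of_le' (show 2 ≤ n' by omega)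
  have h1 := hN n (by omega)
  rw [co_dd2 c] at h1
  have hp : 0 < ((n:ℝ) + 2) ^ (1 / 2 : ℝ) := by positivity
  refine ⟨fun h => ?_, fun t ht => ?_⟩
  · rw [h, zero_mul, mul_zero, norm_zero] at h1
    nlinarith
  have h2 := key t ht n
  rw [norm_mul] at h1 h2
  set D := ‖((n:ℂ) + 2) * (n + 1)‖ with hD
  have hD0 : 0 < D := norm_pos_iff.2 (mul_ne_zero (by exact_mod_cast (n + 1).succ_ne_zero) (by exact_mod_cast n.succ_ne_zero))
  obtain ⟨-, h3, -, -, -⟩ := hball t (mem_ball_zero_iff.2 ht)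
  have hrne := (hrt t h3.le).1
  have e : Complex.exp (-(((n + 2 : ℕ) : ℂ) * -Complex.log (r t / rho))) = r t ^ (n + 2) / rho ^ (n + 2) := by
    rw [mul_neg, neg_neg, Complex.exp_nat_mul, Complex.exp_log (div_ne_zero hrne hrho), div_pow]
  rw [e, mul_div_assoc', norm_div, div_le_iff₀ (norm_pos_iff.2 (pow_ne_zero _ hrho)), mul_assoc, ← norm_mul, div_mul_eq_mul_div, le_div_iff₀ hb]
  set Y := ‖yn c (n + 2) t * r t ^ (n + 2)‖
  set Y0 := ‖yn c (n + 2) 0 * (rho:ℂ) ^ (n + 2)‖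
  set M := A * (16 * L ^ 2 * (1 + L) * K ^ (3 / 2 : ℝ)) with hM
  have hM0 : 0 < M := by have := pk.L_pos; positivity
  have h4 : D * (Y * b) ≤ D * (M * Y0) := by
    calc D * (Y * b) = D * Y * b := by ring
      _ ≤ M * ((n:ℝ) + 2) ^ (1 / 2 : ℝ) * b := by gcongr
      _ = M * (b * ((n:ℝ) + 2) ^ (1 / 2 : ℝ)) := by ring
      _ ≤ M * (D * Y0) := by gcongr
      _ = _ := by ring
  exact le_of_mul_le_mul_left h4 hD0

end IsoCLT

open scoped Classical BigOperators ContDiff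
open MeasureTheory ProbabilityTheory

namespace IsoCLT

noncomputable def XX {n : ℕ} (c : ℕ → ℝ) (p : IsoPair n) : ℝ := ∑ v, c (p.1.1.outdeg v)

lemma link (c : ℕ → ℝ) (n : ℕ) (t : ℂ) :
    ∑ p : IsoPair n, Complex.exp (t * XX c p) = (n.factorial : ℂ) ^ 2 * yn c n t := by
  have h := comb_main n (fun k => Complex.exp (t * c k)) (fun k => Complex.exp_ne_zero _)
  simp only [← Complex.exp_sum, ← Finset.mul_sum, ← Complex.ofReal_sum] at h
  rw [show ∑ p : IsoPair n, Complex.exp (t * XX c p) = _ from h, yn]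
  congr 1
  refine Finset.sum_congr rfl fun m hm => ?_
  simp only [q, if_neg (mem_codes.1 hm).1, one_pow, mul_one]
  let g : Multiplicative ℝ →* ℂ :=
    { toFun := fun a => Complex.exp (t * (Multiplicative.toAdd a : ℝ))
      map_one' := by simp
      map_mul' := fun a b => by simp [mul_add, Complex.exp_add] }
  have e1 : Complex.exp (t * gam c m) = fold (fun m => Complex.exp (t * c (om m))) m :=
    fold_map g (fun m => Multiplicative.ofAdd (c (om m))) m
  have e2 : (wt m : ℂ) = fold (fun m => 1 / (mfac m : ℂ) ^ 2) m := by
    have := fold_map (Complex.ofRealHom : ℝ →* ℂ) (fun m => 1 / (mfac m : ℝ) ^ 2) m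
    rw [wt]
    refine this.trans ?_
    congr 1; funext m; simp
  rw [e1, e2, mul_comm, ← fold_mul]
  congr 1; funext m; rw [mul_one_div]

noncomputable def av {Ω : Type} [Fintype Ω] {E : Type} [NormedAddCommGroup E] [NormedSpace ℝ E] (f : Ω → E) : E :=
  (Fintype.card Ω : ℝ)⁻¹ • ∑ p, f p

lemma taylor2 {lam : ℂ → ℂ} {ε : ℝ} (hε : 0 < ε) (hl : DifferentiableOn ℂ lam (Metric.ball 0 ε)) (h0 : lam 0 = 0) :
    ∃ K δ, 0 < δ ∧ ∀ t, ‖t‖ < δ → ‖lam t - deriv lam 0 * t - deriv (deriv lam) 0 * t ^ 2 / 2‖ ≤ K * ‖t‖ ^ 3 := by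
  have ha := hl.analyticAt (Metric.ball_mem_nhds 0 hε)
  have h := ha.hasFPowerSeriesAt.isBigO_sub_partialSum_pow 3
  obtain ⟨K, hK⟩ := h.bound
  obtain ⟨δ, hδ, H⟩ := Metric.eventually_nhds_iff_ball.1 hK
  refine ⟨K, δ, hδ, fun t ht => ?_⟩
  have := H t (mem_ball_zero_iff.2 ht)
  simp only [FormalMultilinearSeries.partialSum, Finset.sum_range_succ, Finset.sum_range_zero, FormalMultilinearSeries.ofScalars_apply_eq, zero_add, iteratedDeriv_zero, h0, iteratedDeriv_succ] at this
  rw [norm_pow, norm_norm] at this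
  refine le_of_eq_of_le (congrArg _ ?_) this
  simp [Nat.factorial]; ring

lemma clt_real (Ω : ℕ → Type) [∀ n, Fintype (Ω n)] (X : ∀ n, Ω n → ℝ) {ε B : ℝ} {lam : ℂ → ℂ} (hε : 0 < ε)
    (hl : DifferentiableOn ℂ lam (Metric.ball 0 ε)) (h0 : lam 0 = 0)
    (h : ∀ᶠ n : ℕ in Filter.atTop, Fintype.card (Ω n) ≠ 0 ∧ ∀ t : ℂ, ‖t‖ < ε →
      ‖av (fun p => Complex.exp (t * X n p)) * Complex.exp (-(n * lam t))‖ ≤ B) :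
    ∃ μ σ K : ℝ, (∀ᶠ n : ℕ in Filter.atTop, |av (X n) - n * μ| ≤ K ∧ |av (fun p => (X n p - av (X n)) ^ 2) - n * σ| ≤ K) ∧
      Filter.Tendsto (fun n : ℕ => av (fun p => Complex.exp (Complex.I * ((X n p - av (X n)) / Real.sqrt n : ℝ))))
        Filter.atTop (nhds (Complex.exp (-(σ / 2 : ℝ)))) := by
  set a := deriv lam 0 with hadef
  set b := deriv (deriv lam) 0 with hbdef
  set M : ℕ → ℂ → ℂ := fun n t => av (fun p => Complex.exp (t * X n p)) with hM
  set G : ℕ → ℂ → ℂ := fun n t => M n t * Complex.exp (-(n * lam t)) with hG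
  have hMd : ∀ n t, HasDerivAt (M n) (av (fun p => X n p * Complex.exp (t * X n p))) t := by
    intro n t
    simp only [hM, av]
    refine HasDerivAt.const_smul _ (HasDerivAt.fun_sum fun p _ => ?_)
    have := ((hasDerivAt_id t).mul_const (X n p : ℂ)).cexp
    simpa [mul_comm] using this
  have hMd2 : ∀ n t, HasDerivAt (fun t => av (fun p => (X n p : ℂ) * Complex.exp (t * X n p))) (av (fun p => (X n p : ℂ) ^ 2 * Complex.exp (t * X n p))) t := by
    intro n t
    simp only [av]
    refine HasDerivAt.const_smul _ (HasDerivAt.fun_sum fun p _ => ?_)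
    have := (((hasDerivAt_id t).mul_const (X n p : ℂ)).cexp).const_mul (X n p : ℂ)
    refine this.congr_deriv ?_
    simp; ring
  have hlD : ∀ t, ‖t‖ < ε → HasDerivAt lam (deriv lam t) t := fun t ht =>
    (hl.differentiableAt (Metric.isOpen_ball.mem_nhds (mem_ball_zero_iff.2 ht))).hasDerivAt
  have hGd : ∀ n t, ‖t‖ < ε → HasDerivAt (G n) ((av (fun p => (X n p : ℂ) * Complex.exp (t * X n p)) - n * deriv lam t * M n t) * Complex.exp (-(n * lam t))) t := by
    intro n t ht
    have := (hMd n t).mul (((hlD t ht).const_mul (n : ℂ)).neg.cexp)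
    refine this.congr_deriv ?_
    simp only [Pi.neg_apply]
    ring
  have hGD : ∀ n, DifferentiableOn ℂ (G n) (Metric.ball 0 ε) := fun n t ht =>
    (hGd n t (mem_ball_zero_iff.1 ht)).differentiableAt.differentiableWithinAt
  have hav : ∀ n (f : Ω n → ℝ), ((av f : ℝ) : ℂ) = av (fun p => (f p : ℂ)) := by
    intro n f; simp [av]
  have hG1 : ∀ n, Fintype.card (Ω n) ≠ 0 → deriv (G n) 0 = (av (X n) : ℝ) - n * a ∧
      deriv (deriv (G n)) 0 = (av (fun p => (X n p - av (X n)) ^ 2) : ℝ) + ((av (X n) : ℝ) - n * a) ^ 2 - n * b ∧ G n 0 = 1 := by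
    intro n hn
    have hn' : (Fintype.card (Ω n) : ℂ) ≠ 0 := by exact_mod_cast hn
    have hM0 : M n 0 = 1 := by simp [hM, av, hn']
    refine ⟨?_, ?_, ?_⟩
    · rw [(hGd n 0 (by simpa)).deriv, h0, hM0, hav, ← hadef]; simp
    · have e : deriv (G n) =ᶠ[nhds 0] fun t => (av (fun p => (X n p : ℂ) * Complex.exp (t * X n p)) - n * deriv lam t * M n t) * Complex.exp (-(n * lam t)) := by
        filter_upwards [Metric.ball_mem_nhds 0 hε] with t ht
        exact (hGd n t (mem_ball_zero_iff.1 ht)).deriv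
      rw [e.deriv_eq]
      have hl2 : HasDerivAt (deriv lam) b 0 :=
        ((hl.deriv Metric.isOpen_ball).differentiableAt (Metric.ball_mem_nhds 0 hε)).hasDerivAt
      have := ((hMd2 n 0).sub ((hl2.const_mul (n : ℂ)).mul (hMd n 0))).mul (((hlD 0 (by simpa)).const_mul (n : ℂ)).neg.cexp)
      refine (this.deriv).trans ?_
      have hv : av (fun p => (X n p - av (X n)) ^ 2) = av (fun p => X n p ^ 2) - av (X n) ^ 2 := by
        have hn'' : (Fintype.card (Ω n) : ℝ) ≠ 0 := by exact_mod_cast hn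
        simp only [av, smul_eq_mul, sub_sq, Finset.sum_add_distrib, Finset.sum_sub_distrib, ← Finset.sum_mul, ← Finset.mul_sum, Finset.sum_const, Finset.card_univ, nsmul_eq_mul]
        field_simp
        ring
      rw [hv]
      push_cast
      rw [hav, hav]
      simp only [Pi.neg_apply, Pi.mul_apply, Pi.sub_apply, h0, hM0, zero_mul, mul_zero, neg_zero, Complex.exp_zero, mul_one, Complex.ofReal_pow]
      simp only [← hadef]
      ring
    · simp [hG, hM0, h0]
  set e' := ε / 2 with he'
  have he0 : 0 < e' := by positivity
  set K1 := B / e' with hK1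
  set K2 := K1 / (e' / 2) with hK2
  have hE : ∀ n, Fintype.card (Ω n) ≠ 0 → (∀ t : ℂ, ‖t‖ < ε → ‖G n t‖ ≤ B) →
      ‖((av (X n) : ℝ) : ℂ) - n * a‖ ≤ K1 ∧ ‖((av (fun p => (X n p - av (X n)) ^ 2) : ℝ) : ℂ) - n * b‖ ≤ K2 + K1 ^ 2 := by
    intro n hn hB
    obtain ⟨g1, g2, -⟩ := hG1 n hn
    have hd : ∀ z, ‖z‖ ≤ e' / 2 → ‖deriv (G n) z‖ ≤ K1 := by
      intro z hz
      have hw : ∀ w ∈ Metric.closedBall z e', ‖w‖ < ε := fun w hw => by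
        have := mem_closedBall_iff_norm.1 hw
        have := norm_le_norm_add_norm_sub' w z
        linarith
      refine Complex.norm_deriv_le_of_forall_mem_sphere_norm_le he0 ?_ fun w h' => hB w (hw w (Metric.sphere_subset_closedBall h'))
      exact ((hGD n).mono fun w h' => mem_ball_zero_iff.2 (hw w h')).diffContOnCl_ball subset_rfl
    have hd2 : ‖deriv (deriv (G n)) 0‖ ≤ K2 := by
      refine Complex.norm_deriv_le_of_forall_mem_sphere_norm_le (half_pos he0) ?_ fun w h' => hd w (mem_sphere_zero_iff_norm.1 h').le
      exact (((hGD n).deriv Metric.isOpen_ball).mono (Metric.closedBall_subset_ball (by linarith))).diffContOnCl_ball subset_rfl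
    have hd1 := hd 0 (by simp; positivity)
    rw [g1] at hd1
    refine ⟨hd1, ?_⟩
    have : ((av (fun p => (X n p - av (X n)) ^ 2) : ℝ) : ℂ) - n * b = deriv (deriv (G n)) 0 - ((av (X n) : ℝ) - n * a) ^ 2 := by
      rw [g2]; ring
    rw [this]
    refine (norm_sub_le _ _).trans (add_le_add hd2 ?_)
    rw [norm_pow]
    gcongr
  have hEv : ∀ᶠ n : ℕ in Filter.atTop, ‖((av (X n) : ℝ) : ℂ) - n * a‖ ≤ K1 ∧ ‖((av (fun p => (X n p - av (X n)) ^ 2) : ℝ) : ℂ) - n * b‖ ≤ K2 + K1 ^ 2 :=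
    h.mono fun n hn => hE n hn.1 hn.2
  have him : ∀ (w : ℂ) (K : ℝ) (x : ℕ → ℝ), (∀ᶠ n : ℕ in Filter.atTop, ‖(x n : ℂ) - n * w‖ ≤ K) → w = (w.re : ℂ) := by
    intro w K x hx
    suffices w.im = 0 by apply Complex.ext <;> simp [this]
    by_contra hw
    have h1 : Filter.Tendsto (fun n : ℕ => (n : ℝ) * |w.im|) Filter.atTop Filter.atTop :=
      tendsto_natCast_atTop_atTop.atTop_mul_const (abs_pos.2 hw)
    obtain ⟨n, h2, h3⟩ := ((h1.eventually_gt_atTop K).and hx).exists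
    have := (Complex.abs_im_le_norm _).trans h3
    simp [abs_mul] at this
    linarith
  have ha := him a K1 _ (hEv.mono fun n hn => hn.1)
  have hb := him b _ _ (hEv.mono fun n hn => hn.2)
  refine ⟨a.re, b.re, max K1 (K2 + K1 ^ 2), hEv.mono fun n hn => ?_, ?_⟩
  · rw [ha, hb] at hn
    obtain ⟨h1, h2⟩ := hn
    rw [← Real.norm_eq_abs, ← Real.norm_eq_abs, ← Complex.norm_real, ← Complex.norm_real]
    push_cast at h1 h2 ⊢
    exact ⟨h1.trans (le_max_left _ _), h2.trans (le_max_right _ _)⟩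
  obtain ⟨K, δ, hδ, hT⟩ := taylor2 hε hl h0
  set T : ℕ → ℂ := fun n => Complex.I / (Real.sqrt n : ℂ) with hTdef
  have hTn : ∀ n, ‖T n‖ = (Real.sqrt n)⁻¹ := by
    intro n; simp [hTdef, abs_of_nonneg (Real.sqrt_nonneg _)]
  have hsq : Filter.Tendsto (fun n : ℕ => ‖T n‖) Filter.atTop (nhds 0) := by
    simp only [hTn]
    exact (Real.tendsto_sqrt_atTop.comp tendsto_natCast_atTop_atTop).inv_tendsto_atTop
  have hGl : Filter.Tendsto (fun n : ℕ => G n (T n)) Filter.atTop (nhds 1) := by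
    rw [tendsto_iff_norm_sub_tendsto_zero]
    have := hsq.const_mul (2 * B / ε)
    rw [mul_zero] at this
    refine squeeze_zero' (Filter.Eventually.of_forall fun n => norm_nonneg _) ?_ this
    filter_upwards [h, hsq.eventually_lt_const hε] with n hn hn2
    rw [← (hG1 n hn.1).2.2]
    exact schwarz (hGD n) hn.2 hn2
  have hEx : Filter.Tendsto (fun n : ℕ => (n : ℂ) * lam (T n) - T n * (av (X n) : ℝ)) Filter.atTop (nhds (-(b.re / 2 : ℝ))) := by
    rw [tendsto_iff_norm_sub_tendsto_zero]
    have := hsq.const_mul (K + K1)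
    rw [mul_zero] at this
    refine squeeze_zero' (Filter.Eventually.of_forall fun n => norm_nonneg _) ?_ this
    filter_upwards [hEv, hsq.eventually_lt_const hδ, Filter.eventually_gt_atTop 0] with n hn hn2 hn3
    have hs0 : (Real.sqrt n : ℂ) ^ 2 = n := by
      rw [← Complex.ofReal_pow, Real.sq_sqrt (Nat.cast_nonneg n)]; simp
    have hn4 : (n : ℂ) ≠ 0 := by exact_mod_cast hn3.ne'
    have hT2 : (n : ℂ) * T n ^ 2 = -1 := by
      rw [hTdef]; simp only [div_pow, hs0, Complex.I_sq]; field_simp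
    have hTn2 : (n : ℝ) * ‖T n‖ ^ 2 = 1 := by
      have := congrArg norm hT2
      simpa using this
    have e : (n : ℂ) * lam (T n) - T n * (av (X n) : ℝ) - (-(b.re / 2 : ℝ)) =
        n * (lam (T n) - a * T n - b * T n ^ 2 / 2) - T n * ((av (X n) : ℝ) - n * a) := by
      push_cast
      rw [← hb]
      linear_combination (b / 2) * hT2
    rw [e]
    refine (norm_sub_le _ _).trans ?_
    rw [norm_mul, norm_mul, Complex.norm_natCast]
    have h1 := mul_le_mul_of_nonneg_left (hT _ hn2) (Nat.cast_nonneg (α := ℝ) n)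
    have h2 := mul_le_mul_of_nonneg_left hn.1 (norm_nonneg (T n))
    have h3 : (n : ℝ) * (K * ‖T n‖ ^ 3) = K * ‖T n‖ := by linear_combination K * ‖T n‖ * hTn2
    linarith
  have := hGl.mul (Complex.continuous_exp.continuousAt.tendsto.comp hEx)
  rw [one_mul] at this
  refine this.congr fun n => ?_
  simp only [Function.comp, hG, hM, mul_assoc, ← Complex.exp_add]
  simp only [av, smul_mul_assoc, Finset.sum_mul, ← Complex.exp_add]
  congr 1
  refine Finset.sum_congr rfl fun p _ => ?_
  congr 1
  simp only [hTdef]; push_cast; ring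
end IsoCLT

open scoped Classical BigOperators ContDiff
open MeasureTheory ProbabilityTheory

namespace IsoCLT

lemma card_yn (c : ℕ → ℝ) (n : ℕ) : (Fintype.card (IsoPair n) : ℂ) = (n.factorial : ℂ) ^ 2 * yn c n 0 := by
  rw [← link]; simp

lemma dim1 {k : ℕ} (d : Fin k → ℕ) (s : Fin k → ℝ) : ∃ μ σ K : ℝ,
    (∀ᶠ n : ℕ in Filter.atTop, Fintype.card (IsoPair n) ≠ 0 ∧ |∑ i, s i * degMean n (d i) - n * μ| ≤ K ∧
      |∑ i, ∑ j, s i * s j * degCov n (d i) (d j) - n * σ| ≤ K) ∧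
    (∀ n, 0 ≤ ∑ i, ∑ j, s i * s j * degCov n (d i) (d j)) ∧
    Filter.Tendsto (fun n : ℕ => av (fun p : IsoPair n => Complex.exp (Complex.I *
      (∑ i, s i * (((degCount p (d i) : ℝ) - degMean n (d i)) / Real.sqrt n) : ℝ))))
        Filter.atTop (nhds (Complex.exp (-(σ / 2 : ℝ)))) := by
  set c : ℕ → ℝ := fun j => ∑ i, if j = d i then s i else 0 with hc
  have hX : ∀ n (p : IsoPair n), XX c p = ∑ i, s i * degCount p (d i) := by
    intro n p
    simp only [XX, hc]
    rw [Finset.sum_comm]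
    refine Finset.sum_congr rfl fun i _ => ?_
    rw [← Finset.sum_filter, Finset.sum_const, nsmul_eq_mul, mul_comm]; rfl
  have hE : ∀ n, av (fun p : IsoPair n => XX c p) = ∑ i, s i * degMean n (d i) := by
    intro n
    simp only [av, hX, degMean, Nat.card_eq_fintype_card, smul_eq_mul]
    rw [Finset.sum_comm, Finset.mul_sum]
    refine Finset.sum_congr rfl fun i _ => ?_
    rw [← Finset.mul_sum]; ring
  have hdif : ∀ n (p : IsoPair n), XX c p - av (fun p : IsoPair n => XX c p) = ∑ i, s i * ((degCount p (d i) : ℝ) - degMean n (d i)) := by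
    intro n p
    rw [hX, hE, ← Finset.sum_sub_distrib]; simp only [mul_sub]
  have hV : ∀ n, av (fun p : IsoPair n => (XX c p - av (fun p : IsoPair n => XX c p)) ^ 2) = ∑ i, ∑ j, s i * s j * degCov n (d i) (d j) := by
    intro n
    simp only [hdif, pow_two, Finset.sum_mul_sum]
    simp only [av, degCov, Nat.card_eq_fintype_card, smul_eq_mul]
    rw [Finset.sum_comm, Finset.mul_sum]
    refine Finset.sum_congr rfl fun i _ => ?_
    rw [Finset.sum_comm, Finset.mul_sum]
    refine Finset.sum_congr rfl fun j _ => ?_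
    rw [← mul_div_assoc, inv_mul_eq_div, Finset.mul_sum]
    congr 1
    refine Finset.sum_congr rfl fun p _ => ?_
    ring
  have hcb : ∀ j, |c j| ≤ ∑ i, |s i| := fun j =>
    (Finset.abs_sum_le_sum_abs _ _).trans (Finset.sum_le_sum fun i _ => by split_ifs <;> simp)
  obtain ⟨ε, B, lam, hε, hl, h0, hev⟩ := thmB hcb
  have hcard : ∀ n, yn c n 0 ≠ 0 → Fintype.card (IsoPair n) ≠ 0 := fun n hn h => by
    have := card_yn c n
    rw [h, Nat.cast_zero, eq_comm, mul_eq_zero] at this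
    rcases this with h | h
    · exact pow_ne_zero 2 (Nat.cast_ne_zero.2 n.factorial_ne_zero) h
    · exact hn h
  obtain ⟨μ, σ, K, h1, h2⟩ := clt_real IsoPair (fun n p => XX c p) hε hl h0 (B := B) (by
    filter_upwards [hev] with n hn
    refine ⟨hcard n hn.1, fun t ht => ?_⟩
    have hf : (n.factorial : ℂ) ≠ 0 := by exact_mod_cast n.factorial_ne_zero
    have e : av (fun p : IsoPair n => Complex.exp (t * XX c p)) = yn c n t / yn c n 0 := by
      simp only [av, link, Complex.real_smul]
      push_cast
      rw [card_yn c n]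
      field_simp [hn.1]
    rw [e, div_mul_eq_mul_div, norm_div, div_le_iff₀ (norm_pos_iff.2 hn.1)]
    exact hn.2 t ht)
  refine ⟨μ, σ, K, ?_, fun n => ?_, ?_⟩
  · filter_upwards [hev, h1] with n hn h1
    rw [hV, hE] at h1
    exact ⟨hcard n hn.1, h1⟩
  · rw [← hV, av]
    exact smul_nonneg (by positivity) (Finset.sum_nonneg fun p _ => sq_nonneg _)
  · simp only [hdif, Finset.sum_div, mul_div_assoc] at h2
    exact h2

lemma gauss_cf {k : ℕ} (A : Matrix (Fin k) (Fin k) ℝ) (t : EuclideanSpace ℝ (Fin k)) :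
    charFun (Measure.map (fun x => WithLp.toLp 2 (A.mulVec x)) (Measure.pi fun _ : Fin k => gaussianReal 0 1)) t =
      Complex.exp (-((∑ i, ∑ j, t i * t j * (A * A.transpose) i j) / 2 : ℝ)) := by
  have hm : Measurable fun x : Fin k → ℝ => (WithLp.toLp 2 (A.mulVec x) : EuclideanSpace ℝ (Fin k)) := by
    have : Continuous fun x : Fin k → ℝ => (WithLp.toLp 2 (A.mulVec x) : EuclideanSpace ℝ (Fin k)) :=
      (PiLp.continuous_toLp 2 _).comp (Continuous.matrix_mulVec continuous_const continuous_id)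
    exact this.measurable
  rw [charFun_apply, integral_map hm.aemeasurable (Measurable.aestronglyMeasurable (by fun_prop))]
  have e : ∀ x : Fin k → ℝ, Complex.exp ((inner ℝ (WithLp.toLp 2 (A.mulVec x) : EuclideanSpace ℝ (Fin k)) t : ℝ) * Complex.I) =
      ∏ j, Complex.exp (((∑ i, t i * A i j : ℝ) : ℂ) * (x j : ℂ) * Complex.I) := by
    intro x
    rw [← Complex.exp_sum, ← Finset.sum_mul]
    congr 2
    simp only [PiLp.inner_apply, Matrix.mulVec, dotProduct, ← Complex.ofReal_mul, ← Complex.ofReal_sum, Finset.sum_mul]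
    rw [Finset.sum_comm]
    simp [Finset.mul_sum]
    refine Finset.sum_congr rfl fun i _ => Finset.sum_congr rfl fun j _ => ?_
    ring
  simp only [e]
  rw [integral_fintype_prod_eq_prod (f := fun j (x : ℝ) => Complex.exp (((∑ i, t i * A i j : ℝ) : ℂ) * (x : ℂ) * Complex.I))]
  simp only [← charFun_apply_real, charFun_gaussianReal, ← Complex.exp_sum]
  congr 1
  simp only [Matrix.mul_apply, Matrix.transpose_apply]
  have : ∑ i, ∑ j, t i * t j * ∑ l, A i l * A j l = ∑ l, (∑ i, t i * A i l) ^ 2 := by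
    simp only [pow_two, Finset.sum_mul_sum]
    simp only [Finset.mul_sum]
    rw [Finset.sum_congr rfl fun i _ => Finset.sum_comm, Finset.sum_comm]
    refine Finset.sum_congr rfl fun i _ => Finset.sum_congr rfl fun j _ => Finset.sum_congr rfl fun l _ => ?_
    ring
  rw [this, Finset.sum_div, Complex.ofReal_sum, ← Finset.sum_neg_distrib]
  refine Finset.sum_congr rfl fun j _ => ?_
  push_cast
  ring

lemma av_integral {Ω : Type} [Fintype Ω] {E F : Type} [MeasurableSpace E] [MeasurableSingletonClass E] [NormedAddCommGroup F] [NormedSpace ℝ F] [CompleteSpace F]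
    (Y : Ω → E) (f : E → F) :
    ∫ x, f x ∂((Fintype.card Ω : ENNReal)⁻¹ • ∑ p, Measure.dirac (Y p)) = av (fun p => f (Y p)) := by
  rw [integral_smul_measure, integral_finsetSum_measure (fun i _ => integrable_dirac (by finiteness))]
  simp [av]

lemma ev_bdd {f : ℕ → ℝ} {K : ℝ} (h : ∀ᶠ n in Filter.atTop, f n ≤ K) : ∃ C, ∀ n, f n ≤ C := by
  have := Filter.IsBoundedUnder.bddAbove_range (f := f) ⟨K, h⟩
  obtain ⟨C, hC⟩ := this
  exact ⟨C, fun n => hC ⟨n, rfl⟩⟩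

end IsoCLT

open scoped Classical BigOperators ContDiff
open MeasureTheory ProbabilityTheory

/-- Fix distinct natural numbers `d 0 < d 1 < … < d (k-1)`.
For the random vector `X_n` of vertex-degree counts in a uniformly random pair
of isomorphic rooted labeled trees on `n` vertices, there are `μ ∈ ℝ^k` and a
symmetric positive semidefinite matrix `Σ` such that `E[X_n] - nμ` and
`Cov(X_n) - nΣ` stay bounded, and `(X_n - E[X_n])/√n` converges in
distribution to the centered Gaussian with covariance `Σ` (the pushforward of
a standard Gaussian under a matrix square root `A` of `Σ`). -/
theorem degree_counts_isomorphic_pairs_clt (k : ℕ) (d : Fin k → ℕ) (hd : StrictMono d) :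
    ∃ (μ : Fin k → ℝ) (Sigm : Matrix (Fin k) (Fin k) ℝ),
      Sigm.PosSemidef ∧
      (∃ C : ℝ, ∀ n : ℕ, 1 ≤ n →
        (∀ i, |degMean n (d i) - n * μ i| ≤ C) ∧
        (∀ i j, |degCov n (d i) (d j) - n * Sigm i j| ≤ C)) ∧
      (∃ A : Matrix (Fin k) (Fin k) ℝ, A * A.transpose = Sigm ∧
        ∀ f : BoundedContinuousFunction (Fin k → ℝ) ℝ,
          Filter.Tendsto
            (fun n : ℕ =>
              (∑ p : IsoPair n,
                  f (fun i => ((degCount p (d i) : ℝ) - degMean n (d i)) / Real.sqrt n)) /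
                (Nat.card (IsoPair n) : ℝ))
            Filter.atTop
            (nhds (∫ x, f x ∂(Measure.map A.mulVec
              (Measure.pi fun _ : Fin k => gaussianReal 0 1))))) := by
  choose m σ K hK hpos hcf using IsoCLT.dim1 d
  set e : Fin k → Fin k → ℝ := fun i => Pi.single i 1 with he
  set S : Matrix (Fin k) (Fin k) ℝ := fun i j => (σ (e i + e j) - σ (e i) - σ (e j)) / 2 with hS
  have hsym : ∀ n a b, degCov n a b = degCov n b a := fun n a b => by
    simp only [degCov, mul_comm]
  have q1 : ∀ n i, ∑ a, ∑ b, e i a * e i b * degCov n (d a) (d b) = degCov n (d i) (d i) := by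
    intro n i; simp [he, Pi.single_apply]
  have q2 : ∀ n i j, ∑ a, ∑ b, (e i + e j) a * (e i + e j) b * degCov n (d a) (d b) =
      degCov n (d i) (d i) + degCov n (d j) (d j) + 2 * degCov n (d i) (d j) := by
    intro n i j
    simp [he, Pi.single_apply, add_mul, mul_add, Finset.sum_add_distrib]
    rw [hsym n (d j) (d i)]; ring
  have hM : ∀ i, ∀ᶠ n : ℕ in Filter.atTop, |degMean n (d i) - n * m (e i)| ≤ K (e i) := fun i => by
    filter_upwards [hK (e i)] with n hn
    have := hn.2.1
    simpa [he, Pi.single_apply] using this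
  have hC : ∀ i j, ∀ᶠ n : ℕ in Filter.atTop, |degCov n (d i) (d j) - n * S i j| ≤ K (e i + e j) + K (e i) + K (e j) := fun i j => by
    filter_upwards [hK (e i + e j), hK (e i), hK (e j)] with n h1 h2 h3
    have h1 := h1.2.2
    have h2 := h2.2.2
    have h3 := h3.2.2
    rw [q2] at h1
    rw [q1] at h2 h3
    rw [abs_le] at h1 h2 h3 ⊢
    simp only [hS]
    constructor <;> linarith
  have hlim : ∀ s : Fin k → ℝ, Filter.Tendsto (fun n : ℕ => (∑ i, ∑ j, s i * s j * degCov n (d i) (d j)) / n) Filter.atTop (nhds (σ s)) ∧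
      ∑ i, ∑ j, s i * s j * S i j = σ s := by
    have key : ∀ (x : ℕ → ℝ) (v C : ℝ), (∀ᶠ n : ℕ in Filter.atTop, |x n - n * v| ≤ C) →
        Filter.Tendsto (fun n : ℕ => x n / n) Filter.atTop (nhds v) := by
      intro x v C h
      rw [tendsto_iff_norm_sub_tendsto_zero]
      refine squeeze_zero' (Filter.Eventually.of_forall fun n => norm_nonneg _) ?_ (tendsto_const_div_atTop_nhds_zero_nat C)
      filter_upwards [h, Filter.eventually_gt_atTop 0] with n hn h0
      have h0' : (0 : ℝ) < n := by exact_mod_cast h0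
      rw [le_div_iff₀ h0', Real.norm_eq_abs, ← abs_of_pos h0', ← abs_mul, abs_of_pos h0', sub_mul, div_mul_cancel₀ _ h0'.ne', mul_comm v]
      exact hn
    intro s
    have h1 := key _ _ _ ((hK s).mono fun n hn => hn.2.2)
    refine ⟨h1, tendsto_nhds_unique ?_ h1⟩
    simp only [Finset.sum_div, mul_div_assoc]
    exact tendsto_finsetSum _ fun i _ => tendsto_finsetSum _ fun j _ => (key _ _ _ (hC i j)).const_mul _
  have hPSD : S.PosSemidef := by
    refine .of_dotProduct_mulVec_nonneg ?_ fun s => ?_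
    · ext i j
      show (σ (e j + e i) - σ (e j) - σ (e i)) / 2 = (σ (e i + e j) - σ (e i) - σ (e j)) / 2
      rw [add_comm (e j)]; ring
    · have : star s ⬝ᵥ S.mulVec s = ∑ i, ∑ j, s i * s j * S i j := by
        simp only [dotProduct, Matrix.mulVec, Finset.mul_sum, star_trivial]
        refine Finset.sum_congr rfl fun i _ => Finset.sum_congr rfl fun j _ => ?_
        ring
      rw [this, (hlim s).2]
      exact ge_of_tendsto' (hlim s).1 fun n => div_nonneg (hpos s n) (Nat.cast_nonneg n)
  refine ⟨fun i => m (e i), S, hPSD, ?_, ?_⟩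
  · have hF : ∀ᶠ n : ℕ in Filter.atTop, ∑ i, |degMean n (d i) - n * m (e i)| + ∑ i, ∑ j, |degCov n (d i) (d j) - n * S i j| ≤
        ∑ i, K (e i) + ∑ i, ∑ j, (K (e i + e j) + K (e i) + K (e j)) := by
      filter_upwards [Filter.eventually_all.2 hM, Filter.eventually_all.2 fun i => Filter.eventually_all.2 (hC i)] with n h1 h2
      exact add_le_add (Finset.sum_le_sum fun i _ => h1 i) (Finset.sum_le_sum fun i _ => Finset.sum_le_sum fun j _ => h2 i j)
    obtain ⟨C, hCC⟩ := IsoCLT.ev_bdd hF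
    refine ⟨C, fun n _ => ⟨fun i => ?_, fun i j => ?_⟩⟩
    · refine le_trans ?_ (hCC n)
      refine (Finset.single_le_sum (f := fun i => |degMean n (d i) - n * m (e i)|) (fun _ _ => abs_nonneg _) (Finset.mem_univ i)).trans ?_
      exact le_add_of_nonneg_right (Finset.sum_nonneg fun _ _ => Finset.sum_nonneg fun _ _ => abs_nonneg _)
    · refine le_trans ?_ (hCC n)
      refine (Finset.single_le_sum (f := fun j => |degCov n (d i) (d j) - n * S i j|) (fun _ _ => abs_nonneg _) (Finset.mem_univ j)).trans ?_
      refine (Finset.single_le_sum (f := fun i => ∑ j, |degCov n (d i) (d j) - n * S i j|) (fun _ _ => Finset.sum_nonneg fun _ _ => abs_nonneg _) (Finset.mem_univ i)).trans ?_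
      exact le_add_of_nonneg_left (Finset.sum_nonneg fun _ _ => abs_nonneg _)
  obtain ⟨R, hR⟩ : ∃ R : Matrix (Fin k) (Fin k) ℝ, S = star R * R := by
    open scoped MatrixOrder Matrix.Norms.L2Operator in
    exact CStarAlgebra.nonneg_iff_eq_star_mul_self.mp hPSD.nonneg
  have hA : R.transpose * R.transpose.transpose = S := by
    rw [Matrix.transpose_transpose, hR, Matrix.star_eq_conjTranspose, Matrix.conjTranspose_eq_transpose_of_trivial]
  refine ⟨R.transpose, hA, fun f => ?_⟩
  obtain ⟨N, hN⟩ := Filter.eventually_atTop.1 (hK 0)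
  have hcard : ∀ n, Fintype.card (IsoPair (n + N)) ≠ 0 := fun n => (hN _ (by omega)).1
  let Y : ∀ n, IsoPair n → EuclideanSpace ℝ (Fin k) := fun n p =>
    WithLp.toLp 2 (fun i => ((degCount p (d i) : ℝ) - degMean n (d i)) / Real.sqrt n)
  let ν : ℕ → ProbabilityMeasure (EuclideanSpace ℝ (Fin k)) := fun n =>
    ⟨(Fintype.card (IsoPair (n + N)) : ENNReal)⁻¹ • ∑ p, Measure.dirac (Y (n + N) p), ⟨by
      simp only [Measure.smul_apply, Measure.finsetSum_apply, measure_univ, Finset.sum_const, Finset.card_univ, nsmul_eq_mul, mul_one, smul_eq_mul]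
      exact ENNReal.inv_mul_cancel (by exact_mod_cast hcard n) (by finiteness)⟩⟩
  have hm : Measurable fun x : Fin k → ℝ => (WithLp.toLp 2 (R.transpose.mulVec x) : EuclideanSpace ℝ (Fin k)) := by
    have : Continuous fun x : Fin k → ℝ => (WithLp.toLp 2 (R.transpose.mulVec x) : EuclideanSpace ℝ (Fin k)) :=
      (PiLp.continuous_toLp 2 _).comp (Continuous.matrix_mulVec continuous_const continuous_id)
    exact this.measurable
  let ν0 : ProbabilityMeasure (EuclideanSpace ℝ (Fin k)) :=
    ⟨Measure.map (fun x => WithLp.toLp 2 (R.transpose.mulVec x)) (Measure.pi fun _ : Fin k => gaussianReal 0 1),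
      Measure.isProbabilityMeasure_map hm.aemeasurable⟩
  have hconv : Filter.Tendsto ν Filter.atTop (nhds ν0) := by
    rw [ProbabilityMeasure.tendsto_iff_tendsto_charFun]
    intro t
    have e0 : charFun (ν0 : Measure (EuclideanSpace ℝ (Fin k))) t = Complex.exp (-(σ t.ofLp / 2 : ℝ)) := by
      rw [← (hlim t.ofLp).2, ← hA]
      exact IsoCLT.gauss_cf _ t
    rw [e0]
    refine ((Filter.tendsto_add_atTop_iff_nat N).2 (hcf t.ofLp)).congr fun n => ?_
    rw [charFun_apply]
    refine Eq.trans ?_ (IsoCLT.av_integral (Y (n + N)) fun x => Complex.exp ((inner ℝ x t : ℝ) * Complex.I)).symm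
    congr 1
    funext p
    rw [mul_comm]
    simp [Y, PiLp.inner_apply]
  rw [ProbabilityMeasure.tendsto_iff_forall_integral_tendsto] at hconv
  have h := hconv (f.compContinuous ⟨WithLp.ofLp, PiLp.continuous_ofLp 2 _⟩)
  rw [← Filter.tendsto_add_atTop_iff_nat N]
  have e1 : ∫ x, f x ∂(Measure.map R.transpose.mulVec (Measure.pi fun _ : Fin k => gaussianReal 0 1)) =
      ∫ x, (f.compContinuous ⟨WithLp.ofLp, PiLp.continuous_ofLp 2 _⟩) x ∂(ν0 : Measure (EuclideanSpace ℝ (Fin k))) := by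
    have hc : Continuous R.transpose.mulVec := Continuous.matrix_mulVec continuous_const continuous_id
    rw [integral_map hc.measurable.aemeasurable f.continuous.measurable.aestronglyMeasurable]
    exact (integral_map (f := f.compContinuous ⟨WithLp.ofLp, PiLp.continuous_ofLp 2 _⟩) hm.aemeasurable
      (BoundedContinuousFunction.continuous _).measurable.aestronglyMeasurable).symm
  rw [e1]
  refine h.congr fun n => ?_
  refine (IsoCLT.av_integral (Y (n + N)) _).trans ?_
  rw [IsoCLT.av, smul_eq_mul, inv_mul_eq_div, Nat.card_eq_fintype_card]
  rfl
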